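/- Let Ω ⊂ ℝⁿ (n ≥ 2) be a domain and u ∈ C^{1,β}_{loc}(Ω) a weak solution of -Δ_p u = f in Ω, with f ∈ W^{1,1}_{loc}(Ω) ∩ C^{0,β'}_{loc}(Ω). Let q ≥ 2 and let p > 1 satisfy |p-2| < 1/C(n,q). If 1 < p ≤ 2, then u ∈ W^{2,q}_{loc}(Ω). If p > 2, the same conclusion u ∈ W^{2,q}_{loc}(Ω) holds provided in addition q < (p-1)/(p-2). -/

import Mathlib

open MeasureTheory Real Set
open scoped InnerProductSpace ENNReal NNReal Topology

noncomputable section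

abbrev Euc (n : ℕ) : Type := EuclideanSpace ℝ (Fin n)

variable {n : ℕ}

/-- A smooth test function compactly supported in `Ω`. -/
def IsTestFun (Ω : Set (Euc n)) (ψ : Euc n → ℝ) : Prop :=
  ContDiff ℝ (⊤ : ℕ∞) ψ ∧ HasCompactSupport ψ ∧ tsupport ψ ⊆ Ω

/-- `u` is a weak solution of `-Δ_p u = f` in `Ω`. -/
def IsPWeakSol (p : ℝ) (Ω : Set (Euc n)) (u f : Euc n → ℝ) : Prop :=
  ∀ ψ : Euc n → ℝ, IsTestFun Ω ψ →
    (∫ x in Ω, ‖gradient u x‖ ^ (p - 2) * ⟪gradient u x, gradient ψ x⟫_ℝ) =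
      ∫ x in Ω, f x * ψ x

/-- `f ∈ C^{0,β}_loc(Ω)`. -/
def C0Loc (Ω : Set (Euc n)) (β : ℝ≥0) (f : Euc n → ℝ) : Prop :=
  ContinuousOn f Ω ∧
  ∀ K : Set (Euc n), K ⊆ Ω → IsCompact K → ∃ C : ℝ≥0, HolderOnWith C β f K

/-- `u ∈ C^{1,β}_loc(Ω)`. -/
def C1Loc (Ω : Set (Euc n)) (β : ℝ≥0) (u : Euc n → ℝ) : Prop :=
  (∀ x ∈ Ω, DifferentiableAt ℝ u x) ∧
  ∀ K : Set (Euc n), K ⊆ Ω → IsCompact K →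
    ∃ C : ℝ≥0, HolderOnWith C β (fun x => gradient u x) K

/-- The `i`-th partial derivative of `g`. -/
def pd (g : Euc n → ℝ) (i : Fin n) (x : Euc n) : ℝ :=
  fderiv ℝ g x (EuclideanSpace.single i 1)

/-- `h` is the weak `i`-th partial derivative of `g` on `Ω`. -/
def HasWeakPD (Ω : Set (Euc n)) (g h : Euc n → ℝ) (i : Fin n) : Prop :=
  ∀ ψ : Euc n → ℝ, IsTestFun Ω ψ →
    (∫ x in Ω, g x * pd ψ i x) = - ∫ x in Ω, h x * ψ x

/-- `g ∈ W^{1,q}_loc(Ω)`. -/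
def MemW1Loc (Ω : Set (Euc n)) (q : ℝ) (g : Euc n → ℝ) : Prop :=
  ∃ d : Fin n → Euc n → ℝ,
    (∀ i, HasWeakPD Ω g (d i) i) ∧
    ∀ K : Set (Euc n), K ⊆ Ω → IsCompact K →
      IntegrableOn (fun x => |g x| ^ q) K volume ∧
      ∀ i, IntegrableOn (fun x => |d i x| ^ q) K volume

/-- `g ∈ W^{2,q}_loc(Ω)`. -/
def MemW2Loc (Ω : Set (Euc n)) (q : ℝ) (g : Euc n → ℝ) : Prop :=
  ∃ d : Fin n → Euc n → ℝ, ∃ d2 : Fin n → Fin n → Euc n → ℝ,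
    (∀ i, HasWeakPD Ω g (d i) i) ∧
    (∀ i j, HasWeakPD Ω (d i) (d2 i j) j) ∧
    ∀ K : Set (Euc n), K ⊆ Ω → IsCompact K →
      IntegrableOn (fun x => |g x| ^ q) K volume ∧
      (∀ i, IntegrableOn (fun x => |d i x| ^ q) K volume) ∧
      (∀ i j, IntegrableOn (fun x => |d2 i j x| ^ q) K volume)

/-- The Laplacian of `w`. -/
def lapl (w : Euc n → ℝ) (x : Euc n) : ℝ :=
  ∑ i : Fin n, iteratedFDeriv ℝ 2 w x ![EuclideanSpace.single i 1, EuclideanSpace.single i 1]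

/-- The Calderón–Zygmund constant `C(n,q)`: the best constant in
`‖D²w‖_{L^q} ≤ C ‖Δw‖_{L^q}`. -/
def CZ (n : ℕ) (q : ℝ) : ℝ :=
  sInf {C : ℝ | 0 ≤ C ∧ ∀ w : Euc n → ℝ, ContDiff ℝ (⊤ : ℕ∞) w → HasCompactSupport w →
    (∫ x, ‖iteratedFDeriv ℝ 2 w x‖ ^ q) ^ (1 / q) ≤ C * (∫ x, |lapl w x| ^ q) ^ (1 / q)}

/-- The critical set `Z_u` of `u`. -/
def Zset (u : Euc n → ℝ) : Set (Euc n) := {x | gradient u x = 0}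

/-- The recursion `q_N = 2 (q_{N-1} - 1)` starting from `q0`. -/
def qseq (q0 : ℝ) : ℕ → ℝ
  | 0 => q0
  | N + 1 => 2 * (qseq q0 N - 1)

/-- `A` is compactly contained in `Ω`. -/
def CptIn (A Ω : Set (Euc n)) : Prop :=
  IsOpen A ∧ IsCompact (closure A) ∧ closure A ⊆ Ω

/-- `v` is a weak solution of the regularized problem
`-div((ε + |∇v|²)^{(p-2)/2} ∇v) = f` in `B`. -/
def IsRegWeakSol (p ε : ℝ) (B : Set (Euc n)) (v f : Euc n → ℝ) : Prop :=
  ∀ ψ : Euc n → ℝ, IsTestFun B ψ →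
    (∫ x in B, (ε + ‖gradient v x‖ ^ (2 : ℝ)) ^ ((p - 2) / 2) *
        ⟪gradient v x, gradient ψ x⟫_ℝ) =
      ∫ x in B, f x * ψ x


section

open Filter ContinuousLinearMap Metric
open scoped Convolution ContDiff

/-- The `i`-th standard basis vector. -/
abbrev bas (i : Fin n) : Euc n := EuclideanSpace.single i (1 : ℝ)

/-- A `C¹` function with compact support in `O`. -/
def IsC1c (O : Set (Euc n)) (ψ : Euc n → ℝ) : Prop :=
  ContDiff ℝ 1 ψ ∧ HasCompactSupport ψ ∧ tsupport ψ ⊆ O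

/-- `F` is the weak `j`-th partial derivative of the vector valued function `G` on `O`. -/
def WPD {E' : Type*} [NormedAddCommGroup E'] [NormedSpace ℝ E'] (O : Set (Euc n))
    (G F : Euc n → E') (j : Fin n) : Prop :=
  ∀ ψ : Euc n → ℝ, IsTestFun O ψ → (∫ x, pd ψ j x • G x) = - ∫ x, ψ x • F x

lemma IsTestFun.isC1c {O : Set (Euc n)} {ψ : Euc n → ℝ} (h : IsTestFun O ψ) : IsC1c O ψ :=
  ⟨h.1.of_le (by exact_mod_cast le_top), h.2.1, h.2.2⟩

lemma continuous_pd {g : Euc n → ℝ} (hg : ContDiff ℝ 1 g) (i : Fin n) : Continuous (pd g i) :=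
  (hg.continuous_fderiv one_ne_zero).clm_apply continuous_const

lemma hasCompactSupport_pd {g : Euc n → ℝ} (hg : HasCompactSupport g) (i : Fin n) :
    HasCompactSupport (pd g i) :=
  (hg.fderiv (𝕜 := ℝ)).comp_left (g := fun L : Euc n →L[ℝ] ℝ => L (bas i)) (by simp)

lemma tsupport_pd_subset (g : Euc n → ℝ) (i : Fin n) : tsupport (pd g i) ⊆ tsupport g := by
  refine (closure_mono ?_).trans (tsupport_fderiv_subset ℝ (f := g))
  intro x hx h
  apply hx
  simp only [pd]
  rw [h]; simp

lemma contDiff_pd {g : Euc n → ℝ} (hg : ContDiff ℝ ∞ g) (i : Fin n) : ContDiff ℝ ∞ (pd g i) :=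
  (hg.fderiv_right (m := ∞) (by simp)).clm_apply contDiff_const

/-- A sequence of bump functions shrinking to the origin. -/
def bumpSeq (n k : ℕ) : ContDiffBump (0 : Euc n) where
  rIn := 1 / (2 * ((k : ℝ) + 1))
  rOut := 1 / ((k : ℝ) + 1)
  rIn_pos := by positivity
  rIn_lt_rOut := by
    apply one_div_lt_one_div_of_lt <;> nlinarith [(Nat.cast_nonneg k : (0 : ℝ) ≤ k)]

lemma tendsto_bumpSeq_rOut (n : ℕ) : Tendsto (fun k => (bumpSeq n k).rOut) atTop (𝓝 0) :=
  tendsto_one_div_add_atTop_nhds_zero_nat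

/-- The `k`-th mollification of `g`. -/
def mconv {E' : Type*} [NormedAddCommGroup E'] [NormedSpace ℝ E'] (k : ℕ) (g : Euc n → E') :
    Euc n → E' :=
  (bumpSeq n k).normed volume ⋆[lsmul ℝ ℝ, volume] g

section Mollify

variable {E' : Type*} [NormedAddCommGroup E'] [NormedSpace ℝ E']

lemma mconv_apply (k : ℕ) (g : Euc n → E') (x : Euc n) :
    mconv k g x = ∫ y, (bumpSeq n k).normed volume (x - y) • g y := by
  unfold mconv
  rw [convolution_lsmul_swap]

lemma contDiff_mconv (k : ℕ) {g : Euc n → E'} (hg : LocallyIntegrable g) :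
    ContDiff ℝ ∞ (mconv k g) :=
  (bumpSeq n k).hasCompactSupport_normed.contDiff_convolution_left _
    (bumpSeq n k).contDiff_normed hg

lemma hasCompactSupport_mconv (k : ℕ) {g : Euc n → E'} (hg : HasCompactSupport g) :
    HasCompactSupport (mconv k g) :=
  (bumpSeq n k).hasCompactSupport_normed.convolution _ hg

lemma tsupport_mconv_subset (k : ℕ) (g : Euc n → E') :
    tsupport (mconv k g) ⊆ cthickening (1 / ((k : ℝ) + 1)) (tsupport g) := by
  refine closure_minimal ?_ isClosed_cthickening
  refine (support_convolution_subset_swap _).trans ?_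
  rintro x ⟨y, hy, z, hz, rfl⟩
  rw [ContDiffBump.support_normed_eq] at hz
  refine mem_cthickening_of_dist_le _ y _ _ (subset_tsupport _ hy) ?_
  have : dist (y + z) y = ‖z‖ := by simp [dist_eq_norm]
  simp only [mem_ball, dist_zero_right] at hz
  show dist (y + z) y ≤ _
  rw [this]; exact hz.le

lemma dist_mconv_le [CompleteSpace E'] (k : ℕ) {g : Euc n → E'} (hg : AEStronglyMeasurable g)
    {x : Euc n} {z : E'} {ε : ℝ} (h : ∀ y, dist y x < 1 / ((k : ℝ) + 1) → dist (g y) z ≤ ε)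
    : dist (mconv k g x) z ≤ ε := by
  have hε : 0 ≤ ε := dist_nonneg.trans (h x (by simp; positivity))
  refine dist_convolution_le (R := 1 / ((k : ℝ) + 1)) hε ?_
    (bumpSeq n k).nonneg_normed (bumpSeq n k).integral_normed hg ?_
  · rw [ContDiffBump.support_normed_eq]; rfl
  · intro y hy; exact h y hy

lemma norm_mconv_le [CompleteSpace E'] (k : ℕ) {g : Euc n → E'} (hg : AEStronglyMeasurable g)
    {x : Euc n} {C : ℝ} (h : ∀ y, ‖g y‖ ≤ C) : ‖mconv k g x‖ ≤ C := by
  have := dist_mconv_le k hg (x := x) (z := 0) (ε := C) (by simpa using fun y _ => h y)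
  simpa using this

lemma tendstoUniformly_mconv [CompleteSpace E'] {g : Euc n → E'} (hg : Continuous g)
    (hc : HasCompactSupport g) : TendstoUniformly (fun k => mconv k g) g atTop := by
  have huc := hc.uniformContinuous_of_continuous hg
  rw [Metric.tendstoUniformly_iff]
  intro ε hε
  obtain ⟨δ, hδ, h⟩ := Metric.uniformContinuous_iff.1 huc (ε / 2) (by positivity)
  filter_upwards [(tendsto_bumpSeq_rOut n).eventually (gt_mem_nhds hδ)] with k hk x
  rw [dist_comm]
  refine (dist_mconv_le k hg.aestronglyMeasurable (ε := ε / 2) ?_).trans_lt (by linarith)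
  intro y hy
  exact (h (hy.trans hk)).le

lemma ae_tendsto_mconv [CompleteSpace E'] {g : Euc n → E'} (hg : LocallyIntegrable g) :
    ∀ᵐ x, Tendsto (fun k => mconv k g x) atTop (𝓝 (g x)) := by
  refine ContDiffBump.ae_convolution_tendsto_right_of_locallyIntegrable (K := 2)
    (tendsto_bumpSeq_rOut n) (Eventually.of_forall fun k => ?_) hg
  simp only [bumpSeq]
  apply le_of_eq
  have : (k : ℝ) + 1 ≠ 0 := by positivity
  field_simp

lemma fderiv_mconv_apply (k : ℕ) {g : Euc n → E'} (hg : LocallyIntegrable g) (x : Euc n)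
    (j : Fin n) : fderiv ℝ (mconv k g) x (bas j) =
      ∫ y, pd ((bumpSeq n k).normed volume) j (x - y) • g y := by
  have hs := (bumpSeq n k).hasCompactSupport_normed (μ := volume)
  have h := hs.hasFDerivAt_convolution_left (lsmul ℝ ℝ : ℝ →L[ℝ] E' →L[ℝ] E')
    ((bumpSeq n k).contDiff_normed (μ := volume) (n := 1)) hg x
  have h' : HasFDerivAt (mconv k g) _ x := h
  rw [h'.fderiv]
  rw [convolution_eq_swap]
  rw [ContinuousLinearMap.integral_apply]
  · simp [pd]
  · have := (hs.fderiv ℝ).convolutionExists_left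
      ((lsmul ℝ ℝ : ℝ →L[ℝ] E' →L[ℝ] E').precompL (Euc n))
      (((bumpSeq n k).contDiff_normed (μ := volume) (n := 1)).continuous_fderiv one_ne_zero) hg x
    exact this.integrable_swap

lemma isTestFun_reflected (k : ℕ) {O : Set (Euc n)} {x : Euc n}
    (hx : closedBall x (1 / ((k : ℝ) + 1)) ⊆ O) :
    IsTestFun O (fun y => (bumpSeq n k).normed volume (x - y)) := by
  have hs : tsupport (fun y => (bumpSeq n k).normed volume (x - y)) ⊆
      closedBall x (1 / ((k : ℝ) + 1)) := by
    refine closure_minimal ?_ isClosed_closedBall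
    intro y hy
    have hy' : x - y ∈ Function.support ((bumpSeq n k).normed volume) := hy
    rw [ContDiffBump.support_normed_eq] at hy'
    have h2 : dist (x - y) 0 < 1 / ((k : ℝ) + 1) := hy'
    rw [dist_zero_right] at h2
    rw [mem_closedBall, dist_eq_norm, norm_sub_rev]
    exact h2.le
  refine ⟨(bumpSeq n k).contDiff_normed.comp (contDiff_const.sub contDiff_id), ?_, hs.trans hx⟩
  exact (isCompact_closedBall x _).of_isClosed_subset (isClosed_tsupport _) hs

lemma fderiv_mconv_of_wpd (k : ℕ) {O : Set (Euc n)} {G F : Euc n → E'} {j : Fin n}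
    (hG : LocallyIntegrable G) (hW : WPD O G F j) {x : Euc n}
    (hx : closedBall x (1 / ((k : ℝ) + 1)) ⊆ O) :
    fderiv ℝ (mconv k G) x (bas j) = mconv k F x := by
  rw [fderiv_mconv_apply k hG, mconv_apply]
  have := hW _ (isTestFun_reflected k hx)
  have h2 : ∀ y, pd (fun y => (bumpSeq n k).normed volume (x - y)) j y =
      - pd ((bumpSeq n k).normed volume) j (x - y) := by
    intro y
    have hd : DifferentiableAt ℝ ((bumpSeq n k).normed volume) (x - y) :=
      ((bumpSeq n k).contDiff_normed (μ := volume) (n := 1)).differentiable one_ne_zero _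
    have h3 : HasFDerivAt (fun y => (bumpSeq n k).normed volume (x - y))
        ((fderiv ℝ ((bumpSeq n k).normed volume) (x - y)).comp (-ContinuousLinearMap.id ℝ _)) y :=
      hd.hasFDerivAt.comp y ((hasFDerivAt_id y).const_sub x)
    simp [pd, h3.fderiv]
  simp only [h2, neg_smul, integral_neg, neg_inj] at this
  exact this

lemma integral_mconv_swap [CompleteSpace E'] (k : ℕ) {Ψ : Euc n → E' →L[ℝ] ℝ} {F : Euc n → E'}
    (hΨ : Continuous Ψ) (hc : HasCompactSupport Ψ) (hF : Integrable F) :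
    ∫ x, Ψ x (mconv k F x) = ∫ y, mconv k Ψ y (F y) := by
  set ρ := (bumpSeq n k).normed volume with hρ
  have hρc : Continuous ρ := (bumpSeq n k).continuous_normed
  have h_int : Integrable (fun p : Euc n × Euc n => ρ (p.1 - p.2) • Ψ p.1 (F p.2))
      (volume.prod volume) := by
    obtain ⟨C, hC⟩ := (bumpSeq n k).hasCompactSupport_normed.exists_bound_of_continuous hρc
    have hΨi : Integrable Ψ := hΨ.integrable_of_hasCompactSupport hc
    have h1 : Integrable (fun p : Euc n × Euc n => Ψ p.1 (F p.2)) (volume.prod volume) := by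
      refine Integrable.mono' (hΨi.norm.mul_prod hF.norm) ?_ ?_
      · exact (ContinuousLinearMap.apply ℝ ℝ).flip.aestronglyMeasurable_comp₂
          hΨi.aestronglyMeasurable.comp_fst hF.aestronglyMeasurable.comp_snd
      · exact Eventually.of_forall fun p => le_opNorm _ _
    exact h1.bdd_smul (φ := fun p : Euc n × Euc n => ρ (p.1 - p.2)) C
      (hρc.comp (continuous_fst.sub continuous_snd)).aestronglyMeasurable
      (Eventually.of_forall fun p => hC _)
  have hL : ∀ x, Ψ x (mconv k F x) = ∫ y, ρ (x - y) • Ψ x (F y) := by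
    intro x
    rw [mconv_apply, ← ContinuousLinearMap.integral_comp_comm]
    · simp [hρ]
    · have := (bumpSeq n k).hasCompactSupport_normed.convolutionExists_left
        (lsmul ℝ ℝ : ℝ →L[ℝ] E' →L[ℝ] E') hρc hF.locallyIntegrable x
      exact this.integrable_swap
  have hR : ∀ y, mconv k Ψ y (F y) = ∫ x, ρ (x - y) • Ψ x (F y) := by
    intro y
    rw [mconv_apply, ContinuousLinearMap.integral_apply]
    · refine integral_congr_ae (Eventually.of_forall fun x => ?_)
      simp only [_root_.smul_apply]
      rw [← neg_sub x y, ContDiffBump.normed_neg]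
    · have := (bumpSeq n k).hasCompactSupport_normed.convolutionExists_left
        (lsmul ℝ ℝ : ℝ →L[ℝ] _ →L[ℝ] (E' →L[ℝ] ℝ)) hρc
        (hΨ.integrable_of_hasCompactSupport hc (μ := volume)).locallyIntegrable y
      exact this.integrable_swap
  simp only [hL, hR]
  exact integral_integral_swap h_int

end Mollify

lemma integral_mul_pd {ψ g : Euc n → ℝ} (hψ : ContDiff ℝ 1 ψ) (hψc : HasCompactSupport ψ)
    (hg : ContDiff ℝ 1 g) (j : Fin n) : ∫ x, ψ x * pd g j x = -∫ x, pd ψ j x * g x := by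
  refine integral_mul_fderiv_eq_neg_fderiv_mul_of_integrable ?_ ?_ ?_
    (fun x _ => hψ.differentiable one_ne_zero x) (fun x _ => hg.differentiable one_ne_zero x)
  · exact ((continuous_pd hψ j).mul hg.continuous).integrable_of_hasCompactSupport
      (hasCompactSupport_pd hψc j).mul_right
  · exact (hψ.continuous.mul (continuous_pd hg j)).integrable_of_hasCompactSupport hψc.mul_right
  · exact (hψ.continuous.mul hg.continuous).integrable_of_hasCompactSupport hψc.mul_right

/-- The chain rule for weak derivatives of continuous functions. -/
lemma WPD.comp {E' : Type*} [NormedAddCommGroup E'] [NormedSpace ℝ E'] [CompleteSpace E']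
    [ProperSpace E'] {O : Set (Euc n)} (hO : IsOpen O) {G F : Euc n → E'} {j : Fin n}
    (hGc : Continuous G) (hGs : HasCompactSupport G) (hF : Integrable F) (hW : WPD O G F j)
    {Φ : E' → ℝ} (hΦ : ContDiff ℝ 1 Φ) :
    WPD O (fun x => Φ (G x)) (fun x => fderiv ℝ Φ (G x) (F x)) j := by
  intro ψ hψ
  have hψ1 := hψ.isC1c
  obtain ⟨δ, hδ, hδO⟩ := hψ.2.1.isCompact.exists_cthickening_subset_open hO hψ.2.2
  have hGl : LocallyIntegrable G := hGc.locallyIntegrable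
  obtain ⟨M, hM⟩ := hGs.exists_bound_of_continuous hGc
  have hGk : ∀ k x, ‖mconv k G x‖ ≤ M := fun k x => norm_mconv_le k hGc.aestronglyMeasurable hM
  have hGkd : ∀ k, ContDiff ℝ 1 (mconv k G) :=
    fun k => (contDiff_mconv k hGl).of_le (by exact_mod_cast le_top)
  have hu := tendstoUniformly_mconv hGc hGs
  have hΦ' := hΦ.continuous_fderiv one_ne_zero
  obtain ⟨C1, hC1⟩ := (isCompact_closedBall (0 : E') M).exists_bound_of_continuousOn
    hΦ.continuous.continuousOn
  obtain ⟨C2, hC2⟩ := (isCompact_closedBall (0 : E') M).exists_bound_of_continuousOn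
    hΦ'.continuousOn
  obtain ⟨C3, hC3⟩ := hψ.2.1.exists_bound_of_continuous hψ1.1.continuous
  have hC30 : 0 ≤ C3 := (norm_nonneg _).trans (hC3 0)
  set Ψ : ℕ → Euc n → (E' →L[ℝ] ℝ) := fun k x => ψ x • fderiv ℝ Φ (mconv k G x) with hΨ
  have hΨb : ∀ k x, ‖Ψ k x‖ ≤ C3 * C2 := by
    intro k x
    rw [hΨ, norm_smul]
    exact mul_le_mul (hC3 x) (hC2 _ (by simpa using hGk k x)) (norm_nonneg _) hC30
  have hΨc : ∀ k, Continuous (Ψ k) :=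
    fun k => hψ1.1.continuous.smul (hΦ'.comp (hGkd k).continuous)
  have hΨs : ∀ k, HasCompactSupport (Ψ k) := fun k => hψ.2.1.smul_right
  have hjoint : ∀ y, ∀ ε > 0, ∃ η > 0, ∀ᶠ k in atTop, ∀ z, dist z y < η →
      dist (mconv k G z) (G y) < ε := by
    intro y ε hε
    obtain ⟨η, hη, h⟩ := Metric.continuous_iff.1 hGc y (ε / 2) (by positivity)
    refine ⟨η, hη, ?_⟩
    filter_upwards [Metric.tendstoUniformly_iff.1 hu (ε / 2) (by positivity)] with k hk z hz
    have h1 := hk z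
    rw [dist_comm] at h1
    linarith [dist_triangle (mconv k G z) (G z) (G y), h z hz]
  have hpt : ∀ y, Tendsto (fun k => mconv k G y) atTop (𝓝 (G y)) := fun y => hu.tendsto_at y
  have heq : ∀ᶠ k : ℕ in atTop, ∫ x, pd ψ j x • Φ (mconv k G x) = - ∫ y, mconv k (Ψ k) y (F y) := by
    have : ∀ᶠ k : ℕ in atTop, 1 / ((k : ℝ) + 1) < δ :=
      tendsto_one_div_add_atTop_nhds_zero_nat.eventually (gt_mem_nhds hδ)
    filter_upwards [this] with k hk
    have h1 := integral_mul_pd hψ1.1 hψ.2.1 (hΦ.comp (hGkd k)) j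
    have h2 : ∀ x, ψ x * pd (Φ ∘ mconv k G) j x = Ψ k x (mconv k F x) := by
      intro x
      by_cases hx : x ∈ tsupport ψ
      · have h3 : closedBall x (1 / ((k : ℝ) + 1)) ⊆ O :=
          ((closedBall_subset_closedBall hk.le).trans
            (closedBall_subset_cthickening hx δ)).trans hδO
        rw [← fderiv_mconv_of_wpd k hGl hW h3]
        simp only [pd]
        rw [fderiv_comp x (hΦ.differentiable one_ne_zero _)
          ((hGkd k).differentiable one_ne_zero x)]
        simp [hΨ]
      · simp [hΨ, image_eq_zero_of_notMem_tsupport hx]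
    simp only [h2] at h1
    rw [integral_mconv_swap k (hΨc k) (hΨs k) hF] at h1
    rw [h1, neg_neg]
    rfl
  have hlim1 : Tendsto (fun k => ∫ x, pd ψ j x • Φ (mconv k G x)) atTop
      (𝓝 (∫ x, pd ψ j x • Φ (G x))) := by
    refine tendsto_integral_of_dominated_convergence (fun x => ‖pd ψ j x‖ * C1) ?_ ?_ ?_ ?_
    · intro k
      exact ((continuous_pd hψ1.1 j).smul
        (hΦ.continuous.comp (hGkd k).continuous)).aestronglyMeasurable
    · exact (((continuous_pd hψ1.1 j).integrable_of_hasCompactSupport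
        (hasCompactSupport_pd hψ.2.1 j)).norm).mul_const _
    · intro k
      refine Eventually.of_forall fun x => ?_
      rw [norm_smul]
      exact mul_le_mul_of_nonneg_left (hC1 _ (by simpa using hGk k x)) (norm_nonneg _)
    · exact Eventually.of_forall fun x =>
        ((hΦ.continuous.tendsto _).comp (hpt x)).const_smul _
  have hlim2 : Tendsto (fun k => ∫ y, mconv k (Ψ k) y (F y)) atTop
      (𝓝 (∫ y, ψ y • fderiv ℝ Φ (G y) (F y))) := by
    refine tendsto_integral_of_dominated_convergence (fun x => C3 * C2 * ‖F x‖) ?_ ?_ ?_ ?_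
    · intro k
      have hc : Continuous (mconv k (Ψ k)) :=
        (contDiff_mconv k (hΨc k).locallyIntegrable).continuous
      exact (ContinuousLinearMap.apply ℝ ℝ).flip.aestronglyMeasurable_comp₂
        hc.aestronglyMeasurable hF.aestronglyMeasurable
    · exact hF.norm.const_mul _
    · intro k
      refine Eventually.of_forall fun x => ?_
      refine (le_opNorm _ _).trans ?_
      exact mul_le_mul_of_nonneg_right
        (norm_mconv_le k (hΨc k).aestronglyMeasurable (hΨb k)) (norm_nonneg _)
    · refine Eventually.of_forall fun y => ?_
      suffices h : Tendsto (fun k => mconv k (Ψ k) y) atTop (𝓝 (ψ y • fderiv ℝ Φ (G y))) by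
        have := (((ContinuousLinearMap.apply ℝ ℝ (F y)).continuous.tendsto _).comp h)
        simpa [Function.comp_def] using this
      rw [Metric.tendsto_nhds]
      intro ε hε
      have hA : Continuous fun q : Euc n × E' => ψ q.1 • fderiv ℝ Φ q.2 :=
        (hψ1.1.continuous.comp continuous_fst).smul (hΦ'.comp continuous_snd)
      obtain ⟨η1, hη1, h1⟩ := Metric.continuous_iff.1 hA (y, G y) (ε / 2) (by positivity)
      obtain ⟨η2, hη2, h2⟩ := hjoint y η1 hη1
      filter_upwards [h2, (tendsto_bumpSeq_rOut n).eventually (gt_mem_nhds (lt_min hη1 hη2))]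
        with k hk hk2
      refine (dist_mconv_le k (hΨc k).aestronglyMeasurable (ε := ε / 2) ?_).trans_lt (by linarith)
      intro z hz
      have hz' := hz.trans (lt_min_iff.1 hk2).1
      have hz2 := hz.trans (lt_min_iff.1 hk2).2
      exact (h1 (z, mconv k G z) (by
        rw [Prod.dist_eq]; exact max_lt hz' (hk z hz2))).le
  have := tendsto_nhds_unique (hlim1.congr' heq) hlim2.neg
  simpa using this

lemma exists_riesz {E H : Type*} [AddCommGroup E] [Module ℝ E] [NormedAddCommGroup H]
    [InnerProductSpace ℝ H] [CompleteSpace H] (ι : E →ₗ[ℝ] H) (l : E →ₗ[ℝ] ℝ) (C : ℝ)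
    (h : ∀ x, |l x| ≤ C * ‖ι x‖) : ∃ F : H, ∀ x, l x = ⟪F, ι x⟫_ℝ := by
  have hker : LinearMap.ker ι ≤ LinearMap.ker l := by
    intro x hx
    rw [LinearMap.mem_ker] at hx ⊢
    have := h x
    rw [hx, norm_zero, mul_zero] at this
    exact abs_nonpos_iff.1 this
  let l' : LinearMap.range ι →ₗ[ℝ] ℝ :=
    ((LinearMap.ker ι).liftQ l hker).comp ι.quotKerEquivRange.symm.toLinearMap
  have hl' : ∀ x, l' ⟨ι x, LinearMap.mem_range_self ι x⟩ = l x := by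
    intro x
    have : ι.quotKerEquivRange.symm ⟨ι x, LinearMap.mem_range_self ι x⟩ =
        Submodule.Quotient.mk x := by
      rw [LinearEquiv.symm_apply_eq]; rfl
    simp only [l', LinearMap.comp_apply, LinearEquiv.coe_coe, this]
    rfl
  let L : LinearMap.range ι →L[ℝ] ℝ := l'.mkContinuous C (by
    rintro ⟨_, x, rfl⟩
    rw [hl']
    exact h x)
  obtain ⟨g, hg, -⟩ := _root_.exists_extension_norm_eq _ L
  refine ⟨(InnerProductSpace.toDual ℝ H).symm g, fun x => ?_⟩
  rw [InnerProductSpace.toDual_symm_apply]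
  have := hg ⟨ι x, LinearMap.mem_range_self ι x⟩
  rw [this]
  exact (hl' x).symm

/-- The space of test functions on `O`. -/
def testSubmodule (O : Set (Euc n)) : Submodule ℝ (Euc n → ℝ) where
  carrier := {ψ | IsTestFun O ψ}
  zero_mem' := by
    refine ⟨contDiff_const, HasCompactSupport.zero, ?_⟩
    simp [tsupport]
  add_mem' := by
    intro a b ha hb
    exact ⟨ha.1.add hb.1, ha.2.1.add hb.2.1,
      (tsupport_add a b).trans (union_subset ha.2.2 hb.2.2)⟩
  smul_mem' := by
    intro c a ha
    refine ⟨ha.1.const_smul c, ha.2.1.smul_left (f := fun _ => c), ?_⟩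
    exact (tsupport_smul_subset_right (fun _ => c) a).trans ha.2.2

lemma pd_add {a b : Euc n → ℝ} {x : Euc n} (ha : DifferentiableAt ℝ a x)
    (hb : DifferentiableAt ℝ b x) (j : Fin n) : pd (a + b) j x = pd a j x + pd b j x := by
  simp [pd, fderiv_add ha hb]

lemma pd_const_smul {a : Euc n → ℝ} {x : Euc n} (ha : DifferentiableAt ℝ a x) (c : ℝ)
    (j : Fin n) : pd (c • a) j x = c * pd a j x := by
  simp [pd, fderiv_const_smul ha]

/-- An `L²` bound for the distributional derivative gives a weak derivative in `L²`. -/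
lemma exists_wpd_of_bound {O : Set (Euc n)} (hO : IsOpen O) {τ : Euc n → ℝ}
    (hτ : LocallyIntegrable τ) (j : Fin n) (C : ℝ)
    (h : ∀ ψ, IsTestFun O ψ → |∫ x, pd ψ j x * τ x| ≤ C * Real.sqrt (∫ x, ψ x ^ 2)) :
    ∃ F : Euc n → ℝ, MemLp F 2 volume ∧ (∀ x, x ∉ O → F x = 0) ∧ WPD O τ F j := by
  have hmem : ∀ ψ : testSubmodule O, MemLp (ψ : Euc n → ℝ) 2 volume := fun ψ =>
    ψ.2.1.continuous.memLp_of_hasCompactSupport ψ.2.2.1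
  have hd : ∀ ψ : testSubmodule O, Differentiable ℝ (ψ : Euc n → ℝ) := fun ψ =>
    ψ.2.isC1c.1.differentiable one_ne_zero
  have h_int : ∀ ψ : testSubmodule O, Integrable (fun x => pd (ψ : Euc n → ℝ) j x * τ x) :=
    fun ψ => hτ.integrable_smul_left_of_hasCompactSupport (continuous_pd ψ.2.isC1c.1 j)
      (hasCompactSupport_pd ψ.2.2.1 j)
  let ι : testSubmodule O →ₗ[ℝ] Lp ℝ 2 (volume : Measure (Euc n)) :=
    { toFun := fun ψ => (hmem ψ).toLp
      map_add' := fun a b => (hmem a).toLp_add (hmem b)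
      map_smul' := fun c a => (hmem a).toLp_const_smul c }
  let l : testSubmodule O →ₗ[ℝ] ℝ :=
    { toFun := fun ψ => ∫ x, pd (ψ : Euc n → ℝ) j x * τ x
      map_add' := fun a b => by
        rw [← integral_add (h_int a) (h_int b)]
        refine integral_congr_ae (Eventually.of_forall fun x => ?_)
        have := pd_add (hd a x) (hd b x) j
        simp only [Submodule.coe_add, this, add_mul]
      map_smul' := fun c a => by
        rw [RingHom.id_apply, smul_eq_mul, ← integral_const_mul]
        refine integral_congr_ae (Eventually.of_forall fun x => ?_)
        have := pd_const_smul (hd a x) c j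
        simp only [Submodule.coe_smul, this, mul_assoc] }
  obtain ⟨F0, hF0⟩ := exists_riesz ι l C (by
    intro ψ
    have h1 : ‖ι ψ‖ = Real.sqrt (∫ x, (ψ : Euc n → ℝ) x ^ 2) := by
      rw [← Real.sqrt_sq (norm_nonneg (ι ψ)), ← real_inner_self_eq_norm_sq]
      rw [L2.inner_def]
      congr 1
      refine integral_congr_ae ?_
      filter_upwards [(hmem ψ).coeFn_toLp] with x hx
      have : (ι ψ : Euc n → ℝ) x = (ψ : Euc n → ℝ) x := hx
      rw [this]
      simp [sq]
    rw [h1]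
    exact h ψ ψ.2)
  have hFm := Lp.memLp F0
  refine ⟨O.indicator (fun x => - F0 x), hFm.neg.indicator hO.measurableSet,
    fun x hx => indicator_of_notMem hx _, fun ψ hψ => ?_⟩
  have h1 := hF0 ⟨ψ, hψ⟩
  rw [L2.inner_def] at h1
  have h2 : l ⟨ψ, hψ⟩ = ∫ x, pd ψ j x • τ x := rfl
  rw [← h2, h1, ← integral_neg]
  refine integral_congr_ae ?_
  filter_upwards [(hmem ⟨ψ, hψ⟩).coeFn_toLp] with x hx
  have : (ι ⟨ψ, hψ⟩ : Euc n → ℝ) x = ψ x := hx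
  rw [this]
  by_cases hxO : x ∈ O
  · simp [hxO]
  · simp [image_eq_zero_of_notMem_tsupport (fun h => hxO (hψ.2.2 h))]

/-- The odd power `t ↦ sign t * |t| ^ a`. -/
def spow (a t : ℝ) : ℝ := t * |t| ^ (a - 1)

lemma spow_neg (a t : ℝ) : spow a (-t) = - spow a t := by simp [spow]

lemma spow_of_pos {t : ℝ} (a : ℝ) (ht : 0 < t) : spow a t = t ^ a := by
  rw [spow, abs_of_pos ht, Real.rpow_sub_one ht.ne']
  field_simp

lemma spow_of_nonneg {a t : ℝ} (ha : 0 < a) (ht : 0 ≤ t) : spow a t = t ^ a := by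
  rcases ht.eq_or_lt with rfl | h
  · simp [spow, Real.zero_rpow ha.ne']
  · exact spow_of_pos a h

lemma abs_spow {a : ℝ} (ha : 0 < a) (t : ℝ) : |spow a t| = |t| ^ a := by
  rw [← spow_of_nonneg ha (abs_nonneg t), spow, spow, abs_mul, abs_abs,
    abs_of_nonneg (Real.rpow_nonneg (abs_nonneg _) _)]

lemma continuous_spow {a : ℝ} (ha : 0 < a) : Continuous (spow a) := by
  have h : spow a = fun t : ℝ => max t 0 ^ a - max (-t) 0 ^ a := by
    ext t
    rcases le_total 0 t with h | h
    · rw [spow_of_nonneg ha h, max_eq_left h, max_eq_right (by linarith),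
        Real.zero_rpow ha.ne', sub_zero]
    · have := spow_neg a (-t)
      rw [neg_neg, spow_of_nonneg ha (by linarith : 0 ≤ -t)] at this
      rw [this, max_eq_right h, max_eq_left (by linarith), Real.zero_rpow ha.ne', zero_sub]
  rw [h]
  exact ((continuous_id.max continuous_const).rpow_const fun _ => Or.inr ha.le).sub
    ((continuous_neg.max continuous_const).rpow_const fun _ => Or.inr ha.le)

lemma hasDerivAt_spow {a : ℝ} (ha : 1 < a) (t : ℝ) :
    HasDerivAt (spow a) (a * |t| ^ (a - 1)) t := by
  have hpos : ∀ t : ℝ, 0 < t → HasDerivAt (spow a) (a * |t| ^ (a - 1)) t := by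
    intro t ht
    rw [abs_of_pos ht]
    refine (Real.hasDerivAt_rpow_const (Or.inl ht.ne')).congr_of_eventuallyEq ?_
    filter_upwards [lt_mem_nhds ht] with s hs using spow_of_pos a hs
  have hne : ∀ t : ℝ, t ≠ 0 → HasDerivAt (spow a) (a * |t| ^ (a - 1)) t := by
    intro t ht
    rcases ht.lt_or_gt with h | h
    · have h1 := (hpos (-t) (by linarith)).comp t (hasDerivAt_neg t)
      have h2 := h1.neg
      rw [abs_neg] at h2
      have h3 : spow a = -spow a ∘ Neg.neg := by
        ext s; simp [spow_neg]
      rw [h3]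
      exact h2.congr_deriv (by ring)
    · exact hpos t h
  by_cases ht : t = 0
  · subst ht
    refine hasDerivAt_of_hasDerivAt_of_ne (g := fun t => a * |t| ^ (a - 1))
      (fun y hy => hne y hy) (continuous_spow (by linarith)).continuousAt ?_
    exact (continuous_const.mul
      (continuous_abs.rpow_const fun _ => Or.inr (by linarith))).continuousAt
  · exact hne t ht

lemma contDiff_spow {a : ℝ} (ha : 1 < a) : ContDiff ℝ 1 (spow a) := by
  rw [contDiff_one_iff_deriv]
  refine ⟨fun t => (hasDerivAt_spow ha t).differentiableAt, ?_⟩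
  have : deriv (spow a) = fun t => a * |t| ^ (a - 1) := funext fun t => (hasDerivAt_spow ha t).deriv
  rw [this]
  exact continuous_const.mul (continuous_abs.rpow_const fun _ => Or.inr (by linarith))

lemma spow_inv_spow {a : ℝ} (ha : 0 < a) (t : ℝ) : spow (1 / a) (spow a t) = t := by
  by_cases ht : t = 0
  · simp [ht, spow]
  rw [spow, abs_spow ha, ← Real.rpow_mul (abs_nonneg t), spow, mul_assoc,
    ← Real.rpow_add (abs_pos.2 ht)]
  have : a - 1 + a * (1 / a - 1) = 0 := by field_simp; ring
  rw [this, Real.rpow_zero, mul_one]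

/-- A continuous cutoff vanishing for `|s| ≤ ε` and equal to `1` for `|s| ≥ 2 ε`. -/
def cutZero (ε s : ℝ) : ℝ := min 1 (max 0 (|s| / ε - 1))

lemma cutZero_nonneg (ε s : ℝ) : 0 ≤ cutZero ε s := le_min zero_le_one (le_max_left _ _)

lemma cutZero_le_one (ε s : ℝ) : cutZero ε s ≤ 1 := min_le_left _ _

lemma cutZero_eq_zero {ε s : ℝ} (hε : 0 < ε) (hs : |s| ≤ ε) : cutZero ε s = 0 := by
  have : |s| / ε - 1 ≤ 0 := by rw [sub_nonpos, div_le_one hε]; exact hs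
  simp [cutZero, this]

lemma cutZero_eq_one {ε s : ℝ} (hε : 0 < ε) (hs : 2 * ε ≤ |s|) : cutZero ε s = 1 := by
  have h : 2 ≤ |s| / ε := by rw [le_div_iff₀ hε]; exact hs
  exact min_eq_left (le_max_of_le_right (by linarith))

lemma cutZero_mono {ε s t : ℝ} (hε : 0 < ε) (h : |s| ≤ |t|) : cutZero ε s ≤ cutZero ε t := by
  unfold cutZero; gcongr

/-- The truncated power `|s| ^ (m - 1)`. -/
def truncDeriv (ε m s : ℝ) : ℝ := cutZero ε s * |s| ^ (m - 1)

/-- The odd primitive of `truncDeriv`. -/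
def trunc (ε m t : ℝ) : ℝ := ∫ s in (0 : ℝ)..t, truncDeriv ε m s

lemma truncDeriv_nonneg (ε m s : ℝ) : 0 ≤ truncDeriv ε m s :=
  mul_nonneg (cutZero_nonneg _ _) (Real.rpow_nonneg (abs_nonneg _) _)

lemma truncDeriv_neg (ε m s : ℝ) : truncDeriv ε m (-s) = truncDeriv ε m s := by
  simp [truncDeriv, cutZero]

lemma truncDeriv_eq_zero {ε m s : ℝ} (hε : 0 < ε) (hs : |s| ≤ ε) : truncDeriv ε m s = 0 := by
  rw [truncDeriv, cutZero_eq_zero hε hs, zero_mul]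

lemma continuous_truncDeriv {ε : ℝ} (hε : 0 < ε) (m : ℝ) : Continuous (truncDeriv ε m) := by
  have h : truncDeriv ε m = fun s => cutZero ε s * (max ε |s|) ^ (m - 1) := by
    ext s
    rcases le_total |s| ε with h | h
    · rw [truncDeriv_eq_zero hε h, cutZero_eq_zero hε h, zero_mul]
    · rw [truncDeriv, max_eq_right h]
  rw [h]
  refine Continuous.mul ?_ ?_
  · unfold cutZero; fun_prop
  · exact (continuous_const.max continuous_abs).rpow_const
      fun s => Or.inl (hε.trans_le (le_max_left _ _)).ne'

lemma hasDerivAt_trunc {ε : ℝ} (hε : 0 < ε) (m t : ℝ) :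
    HasDerivAt (trunc ε m) (truncDeriv ε m t) t :=
  (continuous_truncDeriv hε m).integral_hasStrictDerivAt 0 t |>.hasDerivAt

lemma contDiff_trunc {ε : ℝ} (hε : 0 < ε) (m : ℝ) : ContDiff ℝ 1 (trunc ε m) := by
  rw [contDiff_one_iff_deriv]
  refine ⟨fun t => (hasDerivAt_trunc hε m t).differentiableAt, ?_⟩
  have : deriv (trunc ε m) = truncDeriv ε m := funext fun t => (hasDerivAt_trunc hε m t).deriv
  rw [this]
  exact continuous_truncDeriv hε m

lemma trunc_neg (ε m t : ℝ) : trunc ε m (-t) = - trunc ε m t := by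
  have := intervalIntegral.integral_comp_neg (a := 0) (b := t) (truncDeriv ε m)
  simp only [truncDeriv_neg, neg_zero] at this
  rw [trunc, trunc, this, intervalIntegral.integral_symm]

lemma trunc_nonneg {ε m t : ℝ} (ht : 0 ≤ t) : 0 ≤ trunc ε m t :=
  intervalIntegral.integral_nonneg ht fun _ _ => truncDeriv_nonneg _ _ _

lemma trunc_le {ε m t : ℝ} (hε : 0 < ε) (hm : 0 < m) (ht : 0 ≤ t) :
    trunc ε m t ≤ cutZero ε t * (t ^ m / m) := by
  have h1 : trunc ε m t ≤ ∫ s in (0 : ℝ)..t, cutZero ε t * s ^ (m - 1) := by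
    refine intervalIntegral.integral_mono_on ht
      ((continuous_truncDeriv hε m).intervalIntegrable _ _)
      ((intervalIntegral.intervalIntegrable_rpow' (by linarith)).const_mul _) ?_
    intro s hs
    rw [truncDeriv, abs_of_nonneg hs.1]
    refine mul_le_mul_of_nonneg_right (cutZero_mono hε ?_) (Real.rpow_nonneg hs.1 _)
    rw [abs_of_nonneg hs.1, abs_of_nonneg ht]; exact hs.2
  rw [intervalIntegral.integral_const_mul, integral_rpow (Or.inl (by linarith))] at h1
  simpa [Real.zero_rpow hm.ne'] using h1

lemma trunc_eq_zero {ε m t : ℝ} (hε : 0 < ε) (hm : 0 < m) (ht : |t| ≤ ε) : trunc ε m t = 0 := by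
  have key : ∀ t : ℝ, 0 ≤ t → |t| ≤ ε → trunc ε m t = 0 := by
    intro t h0 ht
    have := trunc_le hε hm h0
    rw [cutZero_eq_zero hε ht, zero_mul] at this
    exact le_antisymm this (trunc_nonneg h0)
  rcases le_total 0 t with h | h
  · exact key t h ht
  · have := key (-t) (by linarith) (by rwa [abs_neg])
    rw [trunc_neg] at this
    linarith

lemma sq_trunc_le {ε m : ℝ} (hε : 0 < ε) (hm : 0 < m) (t : ℝ) :
    trunc ε m t ^ 2 ≤ truncDeriv ε m t * (|t| ^ (m + 1) / m ^ 2) := by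
  have key : ∀ t : ℝ, 0 ≤ t → trunc ε m t ^ 2 ≤ truncDeriv ε m t * (|t| ^ (m + 1) / m ^ 2) := by
    intro t h0
    rcases h0.eq_or_lt with rfl | h
    · rw [trunc_eq_zero hε hm (by simpa using hε.le)]
      have := truncDeriv_nonneg ε m 0
      have : (0 : ℝ) ≤ |(0 : ℝ)| ^ (m + 1) := Real.rpow_nonneg (abs_nonneg _) _
      rw [zero_pow two_ne_zero]
      exact mul_nonneg ‹_› (by positivity)
    have h1 : trunc ε m t ^ 2 ≤ (cutZero ε t * (t ^ m / m)) ^ 2 :=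
      pow_le_pow_left₀ (trunc_nonneg h0) (trunc_le hε hm h0) 2
    refine h1.trans ?_
    have h2 : t ^ (m - 1) * t ^ (m + 1) = (t ^ m) ^ 2 := by
      rw [← Real.rpow_add h, sq, ← Real.rpow_add h]; ring_nf
    have h3 : truncDeriv ε m t * (|t| ^ (m + 1) / m ^ 2) = cutZero ε t * (t ^ m / m) ^ 2 := by
      rw [truncDeriv, abs_of_pos h, div_pow, ← h2]; ring
    rw [h3, mul_pow]
    refine mul_le_mul_of_nonneg_right ?_ (sq_nonneg _)
    nlinarith [cutZero_nonneg ε t, cutZero_le_one ε t]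
  rcases le_total 0 t with h | h
  · exact key t h
  · have := key (-t) (by linarith)
    rwa [trunc_neg, truncDeriv_neg, abs_neg, neg_sq] at this

lemma abs_trunc_sub_le {ε m : ℝ} (hε : 0 < ε) (hm : 0 < m) (t : ℝ) :
    |trunc ε m t - spow m t / m| ≤ (2 * ε) ^ m / m := by
  have key : ∀ t : ℝ, 0 ≤ t → |trunc ε m t - spow m t / m| ≤ (2 * ε) ^ m / m := by
    intro t h0
    rw [spow_of_nonneg hm h0]
    have h1 : trunc ε m t ≤ t ^ m / m := by
      refine (trunc_le hε hm h0).trans ?_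
      exact mul_le_of_le_one_left (by positivity) (cutZero_le_one _ _)
    rw [abs_of_nonpos (by linarith)]
    rcases le_total t (2 * ε) with h | h
    · have h2 : t ^ m / m ≤ (2 * ε) ^ m / m := by gcongr
      linarith [trunc_nonneg (ε := ε) (m := m) h0]
    · have h3 : trunc ε m t = trunc ε m (2 * ε) + ∫ s in (2 * ε)..t, truncDeriv ε m s :=
        (intervalIntegral.integral_add_adjacent_intervals
          ((continuous_truncDeriv hε m).intervalIntegrable _ _)
          ((continuous_truncDeriv hε m).intervalIntegrable _ _)).symm
      have h4 : ∫ s in (2 * ε)..t, truncDeriv ε m s = ∫ s in (2 * ε)..t, s ^ (m - 1) := by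
        refine intervalIntegral.integral_congr fun s hs => ?_
        rw [uIcc_of_le h] at hs
        have : 0 ≤ s := by linarith [hs.1]
        rw [truncDeriv, cutZero_eq_one hε (by rw [abs_of_nonneg this]; exact hs.1), one_mul,
          abs_of_nonneg this]
      rw [h4, integral_rpow (Or.inl (by linarith)), sub_add_cancel] at h3
      have h5 := trunc_nonneg (ε := ε) (m := m) (t := 2 * ε) (by linarith)
      rw [sub_div] at h3
      linarith
  rcases le_total 0 t with h | h
  · exact key t h
  · have := key (-t) (by linarith)
    rw [trunc_neg, spow_neg, neg_div, sub_neg_eq_add, neg_add_eq_sub, abs_sub_comm] at this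
    exact this

lemma sq_truncDeriv_le {ε m a s : ℝ} (hε : 0 < ε) (h : 2 * a - 2 = m - 1 + s) (t : ℝ) :
    truncDeriv ε a t ^ 2 ≤ truncDeriv ε m t * |t| ^ s := by
  rcases le_or_gt |t| ε with ht | ht
  · simp [truncDeriv_eq_zero hε ht]
  have ht0 : 0 < |t| := hε.trans ht
  have h2 : (|t| ^ (a - 1)) ^ 2 = |t| ^ (m - 1) * |t| ^ s := by
    rw [← Real.rpow_add ht0, sq, ← Real.rpow_add ht0]; congr 1; linarith
  rw [truncDeriv, truncDeriv, mul_pow, h2, mul_assoc]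
  have := Real.rpow_nonneg ht0.le (m - 1)
  have := Real.rpow_nonneg ht0.le s
  refine mul_le_mul_of_nonneg_right ?_ (by positivity)
  nlinarith [cutZero_nonneg ε t, cutZero_le_one ε t]

/-- The vector field `z ↦ ‖z‖ ^ (p - 2) • z`. -/
def Vf {E : Type*} [NormedAddCommGroup E] [InnerProductSpace ℝ E] (p : ℝ) (z : E) : E :=
  ‖z‖ ^ (p - 2) • z

lemma rpow_comparable {x ρ : ℝ} (r : ℝ) (hρ : 0 < ρ) (h1 : ρ / 2 ≤ x) (h2 : x ≤ 2 * ρ) :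
    2 ^ (-|r|) * ρ ^ r ≤ x ^ r ∧ x ^ r ≤ 2 ^ |r| * ρ ^ r := by
  have hx : 0 < x := by linarith
  have hy : 0 < x / ρ := by positivity
  have hl1 : Real.log (x / ρ) ≤ Real.log 2 :=
    Real.log_le_log hy (by rw [div_le_iff₀ hρ]; exact h2)
  have hl2 : -Real.log 2 ≤ Real.log (x / ρ) := by
    rw [← Real.log_inv]
    exact Real.log_le_log (by norm_num) (by rw [le_div_iff₀ hρ]; linarith)
  have hab : |Real.log (x / ρ) * r| ≤ Real.log 2 * |r| := by
    rw [abs_mul]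
    exact mul_le_mul_of_nonneg_right (abs_le.2 ⟨hl2, hl1⟩) (abs_nonneg _)
  have hxr : x ^ r = (x / ρ) ^ r * ρ ^ r := by
    rw [← Real.mul_rpow hy.le hρ.le]; congr 1; field_simp
  have hρr : 0 ≤ ρ ^ r := Real.rpow_nonneg hρ.le _
  rw [hxr]
  constructor <;> refine mul_le_mul_of_nonneg_right ?_ hρr
  · rw [Real.rpow_def_of_pos two_pos, Real.rpow_def_of_pos hy]
    apply Real.exp_le_exp.2
    rw [mul_neg]
    exact (abs_le.1 hab).1
  · rw [Real.rpow_def_of_pos two_pos, Real.rpow_def_of_pos hy]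
    exact Real.exp_le_exp.2 (abs_le.1 hab).2

lemma exists_Vf_bounds {E : Type*} [NormedAddCommGroup E] [InnerProductSpace ℝ E]
    {p : ℝ} (hp : 1 < p) : ∃ c1 > 0, ∃ c2 > 0, ∀ a b : E, b ≠ 0 → ‖a - b‖ ≤ ‖b‖ / 2 →
      ‖Vf p a - Vf p b‖ ≤ c2 * ‖b‖ ^ (p - 2) * ‖a - b‖ ∧
      c1 * ‖b‖ ^ (p - 2) * ‖a - b‖ ^ 2 ≤ ⟪Vf p a - Vf p b, a - b⟫_ℝ := by
  set r := p - 2 with hr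
  have hr1 : -1 < r := by linarith
  refine ⟨min 1 (1 + r) * 2 ^ (-|r|), mul_pos (lt_min one_pos (by linarith)) (by positivity),
    (1 + |r|) * 2 ^ |r|, by positivity, fun a b hb hab => ?_⟩
  have hρ : 0 < ‖b‖ := norm_pos_iff.2 hb
  set w := a - b with hw
  set z : ℝ → E := fun s => b + s • w with hz
  have hz1 : ∀ s ∈ Icc (0 : ℝ) 1, ‖b‖ / 2 ≤ ‖z s‖ ∧ ‖z s‖ ≤ 2 * ‖b‖ := by
    intro s hs
    have h1 : ‖s • w‖ ≤ ‖b‖ / 2 := by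
      rw [norm_smul, Real.norm_of_nonneg hs.1]
      exact (mul_le_of_le_one_left (norm_nonneg _) hs.2).trans hab
    have h2 := norm_add_le b (s • w)
    have h3 := norm_sub_norm_le b (-(s • w))
    rw [norm_neg, sub_neg_eq_add] at h3
    constructor <;> simp only [hz] <;> linarith
  set V' : ℝ → E := fun s => ‖z s‖ ^ r • w + (r * ‖z s‖ ^ (r - 2) * ⟪z s, w⟫_ℝ) • z s with hV'
  have hd : ∀ s ∈ Icc (0 : ℝ) 1, HasDerivAt (fun s => Vf p (z s)) (V' s) s := by
    intro s hs
    have hzd : HasDerivAt z w s := by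
      simpa [hz] using ((hasDerivAt_id s).smul_const w).const_add b
    have hzp : 0 < ‖z s‖ := by linarith [(hz1 s hs).1]
    have h1 := hzd.norm_sq
    have h2 := h1.rpow_const (p := r / 2) (Or.inl (by positivity))
    have h3 := h2.smul hzd
    have hpow : ∀ (x : ℝ) (e : ℝ), 0 ≤ x → (x ^ 2) ^ (e / 2) = x ^ e := by
      intro x e hx
      rw [← Real.rpow_natCast, ← Real.rpow_mul hx]
      congr 1; push_cast; ring
    have h4 : (fun s => Vf p (z s)) = fun s => (‖z s‖ ^ 2) ^ (r / 2) • z s := by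
      ext1 s
      rw [hpow _ _ (norm_nonneg _), Vf]
    rw [h4]
    refine h3.congr_deriv ?_
    have h5 : r / 2 - 1 = (r - 2) / 2 := by ring
    rw [h5, hpow _ _ hzp.le, hpow _ _ hzp.le, hV']
    congr 2
    ring
  have hin : ∀ s, ⟪z s, w⟫_ℝ ^ 2 ≤ ‖z s‖ ^ 2 * ‖w‖ ^ 2 := by
    intro s
    rw [← mul_pow, ← sq_abs]
    exact pow_le_pow_left₀ (abs_nonneg _) (abs_real_inner_le_norm _ _) 2
  have hpow2 : ∀ s ∈ Icc (0 : ℝ) 1, ‖z s‖ ^ r = ‖z s‖ ^ (r - 2) * ‖z s‖ ^ 2 := by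
    intro s hs
    have hzp : 0 < ‖z s‖ := by linarith [(hz1 s hs).1]
    rw [← Real.rpow_natCast, ← Real.rpow_add hzp]; norm_num
  have h0 : z 0 = b := by simp [hz]
  have h1 : z 1 = a := by simp [hz, hw]
  constructor
  · have := norm_image_sub_le_of_norm_deriv_le_segment_01' (f := fun s => Vf p (z s)) (f' := V')
      (C := (1 + |r|) * 2 ^ |r| * ‖b‖ ^ r * ‖w‖) (fun s hs => (hd s hs).hasDerivWithinAt) ?_
    · simpa [h0, h1] using this
    intro s hs
    have hs' := Ico_subset_Icc_self hs
    have hzp : 0 < ‖z s‖ := by linarith [(hz1 s hs').1]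
    have hn : ‖V' s‖ ≤ (1 + |r|) * ‖z s‖ ^ r * ‖w‖ := by
      have e1 : ‖‖z s‖ ^ r • w‖ = ‖z s‖ ^ r * ‖w‖ := by
        rw [norm_smul, Real.norm_of_nonneg (Real.rpow_nonneg hzp.le _)]
      have e2 : ‖(r * ‖z s‖ ^ (r - 2) * ⟪z s, w⟫_ℝ) • z s‖ ≤ |r| * (‖z s‖ ^ r * ‖w‖) := by
        rw [norm_smul, norm_mul, norm_mul, Real.norm_eq_abs,
          Real.norm_of_nonneg (Real.rpow_nonneg hzp.le _), hpow2 s hs']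
        have := norm_inner_le_norm (𝕜 := ℝ) (z s) w
        have h5 : 0 ≤ |r| * ‖z s‖ ^ (r - 2) * ‖z s‖ :=
          mul_nonneg (mul_nonneg (abs_nonneg _) (Real.rpow_nonneg hzp.le _)) hzp.le
        nlinarith [mul_le_mul_of_nonneg_left this h5]
      have := norm_add_le (‖z s‖ ^ r • w) ((r * ‖z s‖ ^ (r - 2) * ⟪z s, w⟫_ℝ) • z s)
      simp only [hV']
      linarith
    refine hn.trans ?_
    have := (rpow_comparable r hρ (hz1 s hs').1 (hz1 s hs').2).2
    calc (1 + |r|) * ‖z s‖ ^ r * ‖w‖ ≤ (1 + |r|) * (2 ^ |r| * ‖b‖ ^ r) * ‖w‖ := by gcongr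
      _ = _ := by ring
  · have hd2 : ∀ s ∈ Icc (0 : ℝ) 1,
        HasDerivAt (fun s => ⟪Vf p (z s), w⟫_ℝ) ⟪V' s, w⟫_ℝ s := by
      intro s hs
      have := (hd s hs).inner ℝ (hasDerivAt_const s w)
      simpa using this
    obtain ⟨s, hs, hs2⟩ := exists_hasDerivAt_eq_slope (fun s => ⟪Vf p (z s), w⟫_ℝ)
      (fun s => ⟪V' s, w⟫_ℝ) zero_lt_one
      (fun s hs => (hd2 s hs).continuousAt.continuousWithinAt)
      (fun s hs => hd2 s (Ioo_subset_Icc_self hs))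
    have hs' := Ioo_subset_Icc_self hs
    simp only [h0, h1, sub_zero, div_one] at hs2
    rw [inner_sub_left, ← hs2]
    have hzp : 0 < ‖z s‖ := by linarith [(hz1 s hs').1]
    have e1 : ⟪V' s, w⟫_ℝ = ‖z s‖ ^ (r - 2) * (‖z s‖ ^ 2 * ‖w‖ ^ 2 + r * ⟪z s, w⟫_ℝ ^ 2) := by
      simp only [hV']
      rw [inner_add_left, real_inner_smul_left, real_inner_smul_left, hpow2 s hs',
        real_inner_self_eq_norm_sq]
      ring
    have e2 : min 1 (1 + r) * (‖z s‖ ^ 2 * ‖w‖ ^ 2) ≤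
        ‖z s‖ ^ 2 * ‖w‖ ^ 2 + r * ⟪z s, w⟫_ℝ ^ 2 := by
      have hn : 0 ≤ ‖z s‖ ^ 2 * ‖w‖ ^ 2 := by positivity
      rcases le_total 0 r with h | h
      · rw [min_eq_left (by linarith), one_mul]
        nlinarith [sq_nonneg ⟪z s, w⟫_ℝ]
      · rw [min_eq_right (by linarith)]
        nlinarith [hin s]
    have e3 := (rpow_comparable r hρ (hz1 s hs').1 (hz1 s hs').2).1
    have hmin : 0 ≤ min 1 (1 + r) := le_min zero_le_one (by linarith)
    calc min 1 (1 + r) * 2 ^ (-|r|) * ‖b‖ ^ r * ‖w‖ ^ 2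
        = min 1 (1 + r) * (2 ^ (-|r|) * ‖b‖ ^ r) * ‖w‖ ^ 2 := by ring
      _ ≤ min 1 (1 + r) * ‖z s‖ ^ r * ‖w‖ ^ 2 := by gcongr
      _ = ‖z s‖ ^ (r - 2) * (min 1 (1 + r) * (‖z s‖ ^ 2 * ‖w‖ ^ 2)) := by
        rw [hpow2 s hs']; ring
      _ ≤ ⟪V' s, w⟫_ℝ := by
        rw [e1]
        exact mul_le_mul_of_nonneg_left e2 (Real.rpow_nonneg hzp.le _)

lemma exists_rpow_bounds {p m M : ℝ} (hp : 1 < p) (hm : 0 < m) (hM : 0 < M) :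
    ∃ c > 0, ∃ C ≥ 0, ∀ t β : ℝ, t ≠ 0 → |t| / 2 ≤ β → β ≤ M →
      c * |t| ^ max (p - 2) 0 ≤ β ^ (p - 2) ∧ β ^ (p - 2) * (|t| ^ (m + 1) / m ^ 2) ≤ C := by
  rcases le_total 2 p with h | h
  · refine ⟨2⁻¹ ^ (p - 2), by positivity, M ^ (p - 2) * ((2 * M) ^ (m + 1) / m ^ 2),
      by positivity, fun t β ht h1 h2 => ?_⟩
    have htp : 0 < |t| := abs_pos.2 ht
    have hβ : 0 ≤ β := by linarith
    rw [max_eq_left (by linarith)]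
    constructor
    · rw [← Real.mul_rpow (by norm_num) htp.le]
      exact Real.rpow_le_rpow (by positivity) (by linarith) (by linarith)
    · have e1 : β ^ (p - 2) ≤ M ^ (p - 2) := Real.rpow_le_rpow hβ h2 (by linarith)
      have e2 : |t| ^ (m + 1) ≤ (2 * M) ^ (m + 1) :=
        Real.rpow_le_rpow htp.le (by linarith) (by linarith)
      gcongr
  · refine ⟨M ^ (p - 2), by positivity, 2⁻¹ ^ (p - 2) * (2 * M) ^ (m + p - 1) / m ^ 2,
      by positivity, fun t β ht h1 h2 => ?_⟩
    have htp : 0 < |t| := abs_pos.2 ht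
    have hβ : 0 < β := by linarith
    rw [max_eq_right (by linarith), Real.rpow_zero, mul_one]
    constructor
    · exact Real.rpow_le_rpow_of_nonpos hβ h2 (by linarith)
    · have e1 : β ^ (p - 2) ≤ (|t| * 2⁻¹) ^ (p - 2) :=
        Real.rpow_le_rpow_of_nonpos (by positivity) (by linarith) (by linarith)
      rw [Real.mul_rpow htp.le (by norm_num)] at e1
      have e2 : |t| ^ (m + p - 1) ≤ (2 * M) ^ (m + p - 1) :=
        Real.rpow_le_rpow htp.le (by linarith) (by linarith)
      have e3 : |t| ^ (p - 2) * |t| ^ (m + 1) = |t| ^ (m + p - 1) := by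
        rw [← Real.rpow_add htp]; ring_nf
      calc β ^ (p - 2) * (|t| ^ (m + 1) / m ^ 2)
          ≤ |t| ^ (p - 2) * 2⁻¹ ^ (p - 2) * (|t| ^ (m + 1) / m ^ 2) := by gcongr
        _ = 2⁻¹ ^ (p - 2) * (|t| ^ (p - 2) * |t| ^ (m + 1)) / m ^ 2 := by ring
        _ ≤ _ := by rw [e3]; gcongr

lemma energy_pointwise {E : Type*} [NormedAddCommGroup E] [InnerProductSpace ℝ E]
    {c1 c2 c3 C3 X Q H H' T φ h S : ℝ} {v a b g : E} (hc1 : 0 < c1) (hc2 : 0 < c2)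
    (hX : 0 ≤ X) (hQ : 0 ≤ Q) (hH' : 0 ≤ H') (hh : 0 < h)
    (hV1 : ‖v‖ ≤ c2 * X * ‖a - b‖) (hV2 : c1 * X * ‖a - b‖ ^ 2 ≤ ⟪v, a - b⟫_ℝ)
    (hXs : c3 * S ≤ X) (hXQ : X * Q ≤ C3) (hT : T ^ 2 ≤ H' * S) (hc3 : 0 ≤ c3)
    (hH : H ^ 2 ≤ H' * Q) :
    c1 / 2 * c3 * (φ ^ 2 * T ^ 2 * ‖h⁻¹ • (a - b)‖ ^ 2) - 2 * c2 ^ 2 / c1 * C3 * ‖g‖ ^ 2 ≤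
      h⁻¹ * ⟪v, (φ ^ 2 * H') • (h⁻¹ • (a - b)) + (2 * φ * H) • g⟫_ℝ := by
  set y := ‖h⁻¹ • (a - b)‖ with hy
  have hab : ‖a - b‖ = h * y := by
    rw [hy, norm_smul, norm_inv, Real.norm_of_nonneg hh.le]; field_simp
  rw [hab] at hV1 hV2
  have e1 : c1 * X * y ^ 2 ≤ h⁻¹ * ⟪v, h⁻¹ • (a - b)⟫_ℝ := by
    rw [real_inner_smul_right, ← mul_assoc, ← sq, inv_pow, ← div_eq_inv_mul,
      le_div_iff₀ (by positivity)]
    linarith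
  have e2 : |h⁻¹ * ⟪v, g⟫_ℝ| ≤ c2 * X * y * ‖g‖ := by
    rw [abs_mul, abs_of_pos (inv_pos.2 hh), ← div_eq_inv_mul, div_le_iff₀ hh]
    refine (abs_real_inner_le_norm v g).trans ?_
    calc ‖v‖ * ‖g‖ ≤ c2 * X * (h * y) * ‖g‖ := by gcongr
      _ = _ := by ring
  have hy0 : 0 ≤ y := norm_nonneg _
  have e3 : h⁻¹ * ⟪v, (φ ^ 2 * H') • (h⁻¹ • (a - b)) + (2 * φ * H) • g⟫_ℝ =
      φ ^ 2 * H' * (h⁻¹ * ⟪v, h⁻¹ • (a - b)⟫_ℝ) + 2 * φ * H * (h⁻¹ * ⟪v, g⟫_ℝ) := by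
    rw [inner_add_right, real_inner_smul_right _ _ (φ ^ 2 * H'), real_inner_smul_right v g]; ring
  rw [e3]
  have e4 : φ ^ 2 * H' * (c1 * X * y ^ 2) ≤ φ ^ 2 * H' * (h⁻¹ * ⟪v, h⁻¹ • (a - b)⟫_ℝ) := by gcongr
  have e5 : -(2 * (|φ| * |H|) * (c2 * X * y * ‖g‖)) ≤ 2 * φ * H * (h⁻¹ * ⟪v, g⟫_ℝ) := by
    have : |2 * φ * H * (h⁻¹ * ⟪v, g⟫_ℝ)| ≤ 2 * (|φ| * |H|) * (c2 * X * y * ‖g‖) := by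
      rw [abs_mul, abs_mul, abs_mul, abs_two, mul_assoc 2]
      gcongr
    exact (abs_le.1 this).1
  have e6 : |H| ≤ Real.sqrt H' * Real.sqrt Q := by
    rw [← Real.sqrt_mul hH']; exact Real.abs_le_sqrt hH
  set sH := Real.sqrt H'
  set sQ := Real.sqrt Q
  have hsH : sH ^ 2 = H' := Real.sq_sqrt hH'
  have hsQ : sQ ^ 2 = Q := Real.sq_sqrt hQ
  have e7 : 2 * (|φ| * |H|) * (c2 * X * y * ‖g‖) ≤
      2 * (|φ| * (sH * sQ)) * (c2 * X * y * ‖g‖) := by gcongr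
  have e8 : 2 * (|φ| * (sH * sQ)) * (c2 * X * y * ‖g‖) ≤
      X * (c1 / 2 * (φ ^ 2 * H' * y ^ 2) + 2 * c2 ^ 2 / c1 * (Q * ‖g‖ ^ 2)) := by
    have : 2 * c2 * (|φ| * sH * y) * (sQ * ‖g‖) ≤
        c1 / 2 * (|φ| * sH * y) ^ 2 + 2 * c2 ^ 2 / c1 * (sQ * ‖g‖) ^ 2 := by
      have h0 := sq_nonneg (c1 * (|φ| * sH * y) - 2 * c2 * (sQ * ‖g‖))
      have h1 : c1 / 2 * (|φ| * sH * y) ^ 2 + 2 * c2 ^ 2 / c1 * (sQ * ‖g‖) ^ 2 -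
          2 * c2 * (|φ| * sH * y) * (sQ * ‖g‖) =
          (c1 * (|φ| * sH * y) - 2 * c2 * (sQ * ‖g‖)) ^ 2 / (2 * c1) := by
        field_simp; ring
      have h2 : 0 ≤ (c1 * (|φ| * sH * y) - 2 * c2 * (sQ * ‖g‖)) ^ 2 / (2 * c1) := by positivity
      linarith
    have h3 := mul_le_mul_of_nonneg_left this hX
    rw [mul_pow, mul_pow, mul_pow, sq_abs, hsH, hsQ] at h3
    linarith
  have e9 : c3 * T ^ 2 ≤ X * H' := by nlinarith
  have e10 : c1 / 2 * c3 * (φ ^ 2 * T ^ 2 * y ^ 2) ≤ X * (c1 / 2 * (φ ^ 2 * H' * y ^ 2)) := by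
    have := mul_le_mul_of_nonneg_left e9 (by positivity : 0 ≤ c1 / 2 * φ ^ 2 * y ^ 2)
    linarith
  have e11 : X * (2 * c2 ^ 2 / c1 * (Q * ‖g‖ ^ 2)) ≤ 2 * c2 ^ 2 / c1 * C3 * ‖g‖ ^ 2 := by
    have := mul_le_mul_of_nonneg_left hXQ (by positivity : 0 ≤ 2 * c2 ^ 2 / c1 * ‖g‖ ^ 2)
    linarith
  linarith

lemma gradient_eq_toDual_symm (g : Euc n → ℝ) (x : Euc n) :
    gradient g x = (InnerProductSpace.toDual ℝ (Euc n)).symm (fderiv ℝ g x) := rfl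

lemma inner_gradient (g : Euc n → ℝ) (x v : Euc n) : ⟪gradient g x, v⟫_ℝ = fderiv ℝ g x v := by
  rw [gradient_eq_toDual_symm, InnerProductSpace.toDual_symm_apply]

lemma gradient_apply (g : Euc n → ℝ) (x : Euc n) (j : Fin n) : gradient g x j = pd g j x := by
  have := inner_gradient g x (bas j)
  rw [EuclideanSpace.inner_single_right] at this
  simpa [pd] using this

lemma continuous_gradient {g : Euc n → ℝ} (hg : ContDiff ℝ 1 g) : Continuous (gradient g) :=
  (InnerProductSpace.toDual ℝ (Euc n)).symm.continuous.comp (hg.continuous_fderiv one_ne_zero)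

lemma hasCompactSupport_gradient {g : Euc n → ℝ} (hg : HasCompactSupport g) :
    HasCompactSupport (gradient g) :=
  (hg.fderiv (𝕜 := ℝ)).comp_left (g := (InnerProductSpace.toDual ℝ (Euc n)).symm) (by simp)

lemma tsupport_gradient_subset (g : Euc n → ℝ) : tsupport (gradient g) ⊆ tsupport g := by
  refine (closure_mono ?_).trans (tsupport_fderiv_subset ℝ (f := g))
  intro x hx h
  apply hx
  rw [gradient_eq_toDual_symm, h, map_zero]

lemma norm_coord_le (v : Euc n) (j : Fin n) : |v j| ≤ ‖v‖ := PiLp.norm_apply_le v j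

lemma abs_pd_le (g : Euc n → ℝ) (x : Euc n) (j : Fin n) : |pd g j x| ≤ ‖gradient g x‖ := by
  rw [← gradient_apply]; exact norm_coord_le _ _

lemma gradient_mul {a b : Euc n → ℝ} {x : Euc n} (ha : DifferentiableAt ℝ a x)
    (hb : DifferentiableAt ℝ b x) :
    gradient (fun x => a x * b x) x = a x • gradient b x + b x • gradient a x := by
  have : fderiv ℝ (fun x => a x * b x) x = a x • fderiv ℝ b x + b x • fderiv ℝ a x :=
    fderiv_mul ha hb
  rw [gradient_eq_toDual_symm, this]
  simp [gradient_eq_toDual_symm]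

lemma gradient_comp_real {H : ℝ → ℝ} {H' : ℝ} {a : Euc n → ℝ} {x : Euc n}
    (hH : HasDerivAt H H' (a x)) (ha : DifferentiableAt ℝ a x) :
    gradient (fun x => H (a x)) x = H' • gradient a x := by
  have : fderiv ℝ (fun x => H (a x)) x = H' • fderiv ℝ a x :=
    (hH.comp_hasFDerivAt x ha.hasFDerivAt).fderiv
  rw [gradient_eq_toDual_symm, this]
  simp [gradient_eq_toDual_symm]

lemma gradient_comp_add (a : Euc n → ℝ) (v x : Euc n) :
    gradient (fun x => a (x + v)) x = gradient a (x + v) := by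
  rw [gradient_eq_toDual_symm, fderiv_comp_add_right, gradient_eq_toDual_symm]

lemma pd_comp_add (a : Euc n → ℝ) (v x : Euc n) (j : Fin n) :
    pd (fun x => a (x + v)) j x = pd a j (x + v) := by
  rw [pd, fderiv_comp_add_right, pd]

lemma norm_Vf {E : Type*} [NormedAddCommGroup E] [InnerProductSpace ℝ E] {p : ℝ} (hp : 1 < p)
    (z : E) : ‖Vf p z‖ = ‖z‖ ^ (p - 1) := by
  rw [Vf, norm_smul, Real.norm_of_nonneg (Real.rpow_nonneg (norm_nonneg _) _)]
  rcases (norm_nonneg z).eq_or_lt with h | h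
  · rw [← h, mul_zero, Real.zero_rpow (by linarith)]
  · rw [← Real.rpow_add_one h.ne']; congr 1; ring

lemma continuous_Vf {E : Type*} [NormedAddCommGroup E] [InnerProductSpace ℝ E] {p : ℝ}
    (hp : 1 < p) : Continuous (Vf p : E → E) := by
  rw [continuous_iff_continuousAt]
  intro z
  by_cases hz : z = 0
  · subst hz
    have h0 : Vf p (0 : E) = 0 := by simp [Vf]
    rw [ContinuousAt, h0, tendsto_zero_iff_norm_tendsto_zero]
    simp only [norm_Vf hp]
    have : Continuous fun z : E => ‖z‖ ^ (p - 1) :=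
      continuous_norm.rpow_const fun _ => Or.inr (by linarith)
    have := this.tendsto 0
    rwa [norm_zero, Real.zero_rpow (by linarith)] at this
  · exact (continuousAt_id.norm.rpow_const (Or.inl (norm_ne_zero_iff.2 hz))).smul continuousAt_id

/-- A compactly supported `C¹` solution of the `p`-Laplace equation on `O`, with right-hand side
whose distributional derivatives are measures. -/
structure IsLocSol (p : ℝ) (O : Set (Euc n)) (u f : Euc n → ℝ) : Prop where
  isOpen : IsOpen O
  contDiff : ContDiff ℝ 1 u
  hasCompactSupport : HasCompactSupport u
  continuous_rhs : Continuous f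
  hasCompactSupport_rhs : HasCompactSupport f
  eqn : ∀ ψ, IsC1c O ψ → ∫ x, ⟪Vf p (gradient u x), gradient ψ x⟫_ℝ = ∫ x, f x * ψ x
  rhs_bound : ∀ i : Fin n, ∃ C ≥ 0, ∀ ψ, IsC1c O ψ → ∀ B, (∀ x, |ψ x| ≤ B) →
    |∫ x, f x * pd ψ i x| ≤ C * B

/-- The difference quotient of `u` in direction `i`. -/
def dq (i : Fin n) (h : ℝ) (u : Euc n → ℝ) (x : Euc n) : ℝ := h⁻¹ * (u (x + h • bas i) - u x)

lemma contDiff_dq {u : Euc n → ℝ} (hu : ContDiff ℝ 1 u) (i : Fin n) (h : ℝ) :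
    ContDiff ℝ 1 (dq i h u) :=
  contDiff_const.mul ((hu.comp (contDiff_id.add contDiff_const)).sub hu)

lemma gradient_dq {u : Euc n → ℝ} (hu : ContDiff ℝ 1 u) (i : Fin n) (h : ℝ) (x : Euc n) :
    gradient (dq i h u) x = h⁻¹ • (gradient u (x + h • bas i) - gradient u x) := by
  have h1 : DifferentiableAt ℝ u (x + h • bas i) := hu.differentiable one_ne_zero _
  have h1' : DifferentiableAt ℝ (fun x => u (x + h • bas i)) x :=
    (differentiableAt_comp_add_right _).2 h1
  have h2 : DifferentiableAt ℝ u x := hu.differentiable one_ne_zero _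
  have h3 : fderiv ℝ (dq i h u) x =
      h⁻¹ • (fderiv ℝ u (x + h • bas i) - fderiv ℝ u x) := by
    have : dq i h u = h⁻¹ • ((fun x => u (x + h • bas i)) - u) := by
      ext y; simp [dq]
    rw [this, fderiv_const_smul (h1'.sub h2), fderiv_sub h1' h2, fderiv_comp_add_right]
  rw [gradient_eq_toDual_symm, h3]
  simp [gradient_eq_toDual_symm]

lemma hasDerivAt_line {u : Euc n → ℝ} (hu : ContDiff ℝ 1 u) (i : Fin n) (x : Euc n) (s : ℝ) :
    HasDerivAt (fun s : ℝ => u (x + s • bas i)) (pd u i (x + s • bas i)) s := by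
  have h1 : HasFDerivAt u (fderiv ℝ u (x + s • bas i)) (x + s • bas i) :=
    (hu.differentiable one_ne_zero _).hasFDerivAt
  have h2 : HasDerivAt (fun s : ℝ => x + s • bas i) (bas i) s := by
    simpa using ((hasDerivAt_id s).smul_const (bas i)).const_add x
  exact h1.comp_hasDerivAt s h2

lemma exists_dq_eq {u : Euc n → ℝ} (hu : ContDiff ℝ 1 u) (i : Fin n) {h : ℝ} (hh : 0 < h)
    (x : Euc n) : ∃ s ∈ Ioo 0 h, dq i h u x = pd u i (x + s • bas i) := by
  obtain ⟨s, hs, h2⟩ := exists_hasDerivAt_eq_slope (fun s : ℝ => u (x + s • bas i))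
    (fun s => pd u i (x + s • bas i)) hh
    (fun s _ => (hasDerivAt_line hu i x s).continuousAt.continuousWithinAt)
    (fun s _ => hasDerivAt_line hu i x s)
  refine ⟨s, hs, ?_⟩
  rw [h2, dq]
  simp [div_eq_inv_mul]

lemma integral_mul_translate_sub {O : Set (Euc n)} {f ψ : Euc n → ℝ} {i : Fin n} {C B h : ℝ}
    (hf : Continuous f) (hfc : HasCompactSupport f) (hh : 0 < h)
    (hC : ∀ ψ, IsC1c O ψ → ∀ B, (∀ x, |ψ x| ≤ B) → |∫ x, f x * pd ψ i x| ≤ C * B)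
    (hψ : ∀ s ∈ Icc 0 h, IsC1c O (fun x => ψ (x + s • (-bas i)))) (hB : ∀ x, |ψ x| ≤ B) :
    |∫ x, f x * (ψ (x + h • (-bas i)) - ψ x)| ≤ h * (C * B) := by
  have hψ0 : IsC1c O ψ := by simpa using hψ 0 ⟨le_rfl, hh.le⟩
  have hψd := hψ0.1
  have hfi : Integrable f := hf.integrable_of_hasCompactSupport hfc
  obtain ⟨D, hD⟩ := (hasCompactSupport_pd hψ0.2.1 i).exists_bound_of_continuous
    (continuous_pd hψd i)
  have hline : ∀ (x : Euc n) (s : ℝ), HasDerivAt (fun s : ℝ => ψ (x + s • (-bas i)))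
      (- pd ψ i (x + s • (-bas i))) s := by
    intro x s
    have h1 : HasFDerivAt ψ (fderiv ℝ ψ (x + s • (-bas i))) (x + s • (-bas i)) :=
      (hψd.differentiable one_ne_zero _).hasFDerivAt
    have h2 : HasDerivAt (fun s : ℝ => x + s • (-bas i)) (-bas i) s := by
      simpa using ((hasDerivAt_id s).smul_const (-bas i)).const_add x
    have h3 := h1.comp_hasDerivAt s h2
    rw [map_neg] at h3
    exact h3
  have h_int : ∀ s : ℝ, Integrable fun x => f x * ψ (x + s • (-bas i)) := fun s =>
    (hf.mul
      (hψd.continuous.comp (continuous_id.add continuous_const))).integrable_of_hasCompactSupport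
      hfc.mul_right
  have hder : ∀ s : ℝ, HasDerivAt (fun s : ℝ => ∫ x, f x * ψ (x + s • (-bas i)))
      (∫ x, f x * (- pd ψ i (x + s • (-bas i)))) s := by
    intro s
    refine (hasDerivAt_integral_of_dominated_loc_of_deriv_le
      (F := fun s x => f x * ψ (x + s • (-bas i)))
      (F' := fun s x => f x * (- pd ψ i (x + s • (-bas i))))
      (bound := fun x => ‖f x‖ * D) (s := univ) univ_mem ?_ (h_int s) ?_ ?_
      (hfi.norm.mul_const D) ?_).2
    · exact Eventually.of_forall fun s => (h_int s).aestronglyMeasurable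
    · exact (hf.mul ((continuous_pd hψd i).comp
        (continuous_id.add continuous_const)).neg).aestronglyMeasurable
    · refine Eventually.of_forall fun x s _ => ?_
      rw [norm_mul, norm_neg]
      exact mul_le_mul_of_nonneg_left (hD _) (norm_nonneg _)
    · exact Eventually.of_forall fun x s _ => (hline x s).const_mul (f x)
  obtain ⟨s, hs, h2⟩ := exists_hasDerivAt_eq_slope
    (fun s : ℝ => ∫ x, f x * ψ (x + s • (-bas i))) _ hh
    (fun s _ => (hder s).continuousAt.continuousWithinAt) (fun s _ => hder s)
  have h3 := hC _ (hψ s (Ioo_subset_Icc_self hs)) B (fun x => hB _)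
  simp only [pd_comp_add] at h3
  have h4 : ∫ x, f x * (ψ (x + h • (-bas i)) - ψ x) =
      h * ∫ x, f x * (- pd ψ i (x + s • (-bas i))) := by
    rw [h2, sub_zero, mul_div_cancel₀ _ hh.ne', ← integral_sub (h_int h) (h_int 0)]
    simp [mul_sub]
  rw [h4, abs_mul, abs_of_pos hh]
  simp only [mul_neg, integral_neg, abs_neg]
  exact mul_le_mul_of_nonneg_left h3 hh.le

lemma abs_trunc_le {ε m : ℝ} (hε : 0 < ε) (hm : 0 < m) (t : ℝ) : |trunc ε m t| ≤ |t| ^ m / m := by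
  have key : ∀ t : ℝ, 0 ≤ t → |trunc ε m t| ≤ |t| ^ m / m := by
    intro t h0
    rw [abs_of_nonneg (trunc_nonneg h0), abs_of_nonneg h0]
    refine (trunc_le hε hm h0).trans ?_
    exact mul_le_of_le_one_left (by positivity) (cutZero_le_one _ _)
  rcases le_total 0 t with h | h
  · exact key t h
  · simpa [trunc_neg] using key (-t) (by linarith)

lemma IsLocSol.energy_bound {p m α : ℝ} {O : Set (Euc n)} {u f φ : Euc n → ℝ}
    (S : IsLocSol p O u f) (hp : 1 < p) (hm : 0 < m) (hα : 2 * α - 2 = m - 1 + max (p - 2) 0)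
    (i : Fin n) (hφ : IsC1c O φ) :
    ∃ K, ∀ ε > 0, ∃ h0 > 0, ∀ h : ℝ, 0 < h → h < h0 →
      ∫ x, φ x ^ 2 * truncDeriv ε α (dq i h u x) ^ 2 * ‖gradient (dq i h u) x‖ ^ 2 ≤ K := by
  obtain ⟨c1, hc1, c2, hc2, hV⟩ := exists_Vf_bounds (E := Euc n) hp
  have hgc := continuous_gradient S.contDiff
  have hgs := hasCompactSupport_gradient S.hasCompactSupport
  obtain ⟨M0, hM0⟩ := hgs.exists_bound_of_continuous hgc
  set M := max M0 1 with hMdef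
  have hM : 0 < M := lt_max_of_lt_right one_pos
  have hgM : ∀ x, ‖gradient u x‖ ≤ M := fun x => (hM0 x).trans (le_max_left _ _)
  obtain ⟨c3, hc3, C3, hC3, hX⟩ := exists_rpow_bounds hp hm hM
  obtain ⟨Cf, hCf, hfb⟩ := S.rhs_bound i
  obtain ⟨Φ, hΦ⟩ := hφ.2.1.exists_bound_of_continuous hφ.1.continuous
  obtain ⟨δ, hδ, hδO⟩ := hφ.2.1.isCompact.exists_cthickening_subset_open S.isOpen hφ.2.2
  have huc := hgs.uniformContinuous_of_continuous hgc
  set B := Φ ^ 2 * (M ^ m / m) with hBdef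
  set G := ∫ x, ‖gradient φ x‖ ^ 2 with hG
  set A := c1 / 2 * c3 with hA
  have hApos : 0 < A := by positivity
  refine ⟨A⁻¹ * (Cf * B + 2 * c2 ^ 2 / c1 * C3 * G), fun ε hε => ?_⟩
  obtain ⟨δ', hδ', hδu⟩ := Metric.uniformContinuous_iff.1 huc (ε / 8) (by positivity)
  refine ⟨min δ δ', lt_min hδ hδ', fun h hh hh0 => ?_⟩
  have hhδ : h < δ := hh0.trans_le (min_le_left _ _)
  have hhδ' : h < δ' := hh0.trans_le (min_le_right _ _)
  have hnb : ∀ s : ℝ, ‖s • bas i‖ = |s| := fun s => by simp [norm_smul]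
  set D := dq i h u with hD
  have hDc : ContDiff ℝ 1 D := contDiff_dq S.contDiff i h
  have hDd : Differentiable ℝ D := hDc.differentiable one_ne_zero
  have hφd : Differentiable ℝ φ := hφ.1.differentiable one_ne_zero
  set H : ℝ → ℝ := trunc ε m
  set ψ : Euc n → ℝ := fun x => φ x * φ x * H (D x) with hψ
  have hHc : ContDiff ℝ 1 fun x => H (D x) := (contDiff_trunc hε m).comp hDc
  have hψC1 : ContDiff ℝ 1 ψ := (hφ.1.mul hφ.1).mul hHc
  have hψs : tsupport ψ ⊆ tsupport φ := by
    refine closure_mono fun x hx hx2 => hx ?_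
    simp [hψ, hx2]
  have hψcs : HasCompactSupport ψ := hφ.2.1.isCompact.of_isClosed_subset (isClosed_tsupport _) hψs
  have hψtr : ∀ s ∈ Icc 0 h, IsC1c O (fun x => ψ (x + s • (-bas i))) := by
    intro s hs
    have hsub : tsupport (fun x => ψ (x + s • (-bas i))) ⊆ cthickening δ (tsupport φ) := by
      refine closure_minimal (fun x hx => ?_) isClosed_cthickening
      refine mem_cthickening_of_dist_le x (x + s • (-bas i)) _ _
        (hψs (subset_tsupport _ hx)) ?_
      have : dist x (x + s • (-bas i)) = |s| := by
        rw [dist_eq_norm, smul_neg, ← sub_eq_add_neg, sub_sub_cancel, hnb]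
      rw [this, abs_of_nonneg hs.1]
      exact hs.2.trans hhδ.le
    refine ⟨hψC1.comp (contDiff_id.add contDiff_const), ?_, hsub.trans hδO⟩
    exact (hφ.2.1.isCompact.cthickening).of_isClosed_subset (isClosed_tsupport _) hsub
  have hgψ : ∀ x, gradient ψ x = (φ x ^ 2 * truncDeriv ε m (D x)) • gradient D x +
      (2 * φ x * H (D x)) • gradient φ x := by
    intro x
    have e1 : gradient (fun x => H (D x)) x = truncDeriv ε m (D x) • gradient D x :=
      gradient_comp_real (hasDerivAt_trunc hε m _) (hDd x)
    rw [hψ, gradient_mul (a := fun x => φ x * φ x) ((hφd x).mul (hφd x))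
      (hHc.differentiable one_ne_zero x),
      gradient_mul (hφd x) (hφd x), e1]
    module
  have hDM : ∀ x, |D x| ≤ M := by
    intro x
    obtain ⟨s, -, hs⟩ := exists_dq_eq S.contDiff i hh x
    rw [hD, hs]
    exact (abs_pd_le _ _ _).trans (hgM _)
  have hψB : ∀ x, |ψ x| ≤ B := by
    intro x
    rw [hψ]
    simp only [abs_mul]
    rw [← sq]
    have e1 : |φ x| ≤ Φ := hΦ x
    have e2 : |H (D x)| ≤ M ^ m / m := by
      refine (abs_trunc_le hε hm _).trans ?_
      gcongr
      exact hDM x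
    exact mul_le_mul (pow_le_pow_left₀ (abs_nonneg _) e1 2) e2 (abs_nonneg _) (sq_nonneg _)
  have hrhs := integral_mul_translate_sub S.continuous_rhs S.hasCompactSupport_rhs hh hfb hψtr hψB
  -- the equation tested with `ψ` and its translate
  have hVc : Continuous fun x => Vf p (gradient u x) := (continuous_Vf hp).comp hgc
  have hgψc := continuous_gradient hψC1
  have hgψs := hasCompactSupport_gradient hψcs
  have hi1 : Integrable fun x => ⟪Vf p (gradient u (x + h • bas i)), gradient ψ x⟫_ℝ := by
    refine ((hVc.comp (continuous_id.add continuous_const)).inner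
      hgψc).integrable_of_hasCompactSupport ?_
    exact hgψs.mono fun x hx h0 => hx (by simp [h0])
  have hi2 : Integrable fun x => ⟪Vf p (gradient u x), gradient ψ x⟫_ℝ := by
    refine (hVc.inner hgψc).integrable_of_hasCompactSupport ?_
    exact hgψs.mono fun x hx h0 => hx (by simp [h0])
  have heq0 := S.eqn ψ (by simpa using hψtr 0 ⟨le_rfl, hh.le⟩)
  have heq1 := S.eqn _ (hψtr h ⟨hh.le, le_rfl⟩)
  have hshift : ∫ x, ⟪Vf p (gradient u x), gradient (fun x => ψ (x + h • (-bas i))) x⟫_ℝ =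
      ∫ x, ⟪Vf p (gradient u (x + h • bas i)), gradient ψ x⟫_ℝ := by
    rw [← integral_add_right_eq_self _ (h • bas i)]
    refine integral_congr_ae (Eventually.of_forall fun x => ?_)
    simp only [gradient_comp_add]
    rw [smul_neg, add_neg_cancel_right]
  have hfi : ∀ g : Euc n → ℝ, Continuous g → Integrable fun x => f x * g x := fun g hg =>
    (S.continuous_rhs.mul hg).integrable_of_hasCompactSupport S.hasCompactSupport_rhs.mul_right
  have htested : ∫ x, ⟪Vf p (gradient u (x + h • bas i)) - Vf p (gradient u x), gradient ψ x⟫_ℝ =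
      ∫ x, f x * (ψ (x + h • (-bas i)) - ψ x) := by
    simp only [inner_sub_left, mul_sub]
    have hψt : Continuous fun x => ψ (x + h • (-bas i)) :=
      hψC1.continuous.comp (continuous_id.add continuous_const)
    rw [integral_sub hi1 hi2, integral_sub (hfi _ hψt) (hfi _ hψC1.continuous),
      heq0, ← hshift, heq1]
  -- the pointwise inequality
  have hpt : ∀ x, A * (φ x ^ 2 * truncDeriv ε α (D x) ^ 2 * ‖gradient D x‖ ^ 2) -
      2 * c2 ^ 2 / c1 * C3 * ‖gradient φ x‖ ^ 2 ≤
      h⁻¹ * ⟪Vf p (gradient u (x + h • bas i)) - Vf p (gradient u x), gradient ψ x⟫_ℝ := by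
    intro x
    rw [hgψ]
    rcases le_or_gt |D x| ε with ht | ht
    · have e1 : H (D x) = 0 := trunc_eq_zero hε hm ht
      rw [truncDeriv_eq_zero hε ht, truncDeriv_eq_zero hε ht, e1]
      have : 0 ≤ 2 * c2 ^ 2 / c1 * C3 * ‖gradient φ x‖ ^ 2 := by positivity
      simpa using this
    have ht0 : D x ≠ 0 := fun h0 => by rw [h0, abs_zero] at ht; linarith
    obtain ⟨s, hs, hs2⟩ := exists_dq_eq S.contDiff i hh x
    have e1 : ‖gradient u (x + s • bas i) - gradient u x‖ < ε / 8 := by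
      rw [← dist_eq_norm]
      refine hδu ?_
      rw [dist_eq_norm, add_sub_cancel_left, hnb, abs_of_pos hs.1]
      exact hs.2.trans hhδ'
    have e2 : ‖gradient u (x + h • bas i) - gradient u x‖ < ε / 8 := by
      rw [← dist_eq_norm]
      refine hδu ?_
      rw [dist_eq_norm, add_sub_cancel_left, hnb, abs_of_pos hh]
      exact hhδ'
    have e3 : |D x| ≤ ‖gradient u (x + s • bas i)‖ := by
      rw [hD, hs2]; exact abs_pd_le _ _ _
    have e4 : |D x| / 2 ≤ ‖gradient u x‖ := by
      have := norm_sub_norm_le (gradient u (x + s • bas i)) (gradient u x)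
      linarith
    have hb0 : gradient u x ≠ 0 := by
      rw [← norm_pos_iff]; linarith
    obtain ⟨hV1, hV2⟩ := hV (gradient u (x + h • bas i)) (gradient u x) hb0 (by linarith)
    obtain ⟨hX1, hX2⟩ := hX (D x) ‖gradient u x‖ ht0 e4 (hgM x)
    rw [hD, gradient_dq S.contDiff]
    exact energy_pointwise hc1 hc2 (Real.rpow_nonneg (norm_nonneg _) _)
      (div_nonneg (Real.rpow_nonneg (abs_nonneg _) _) (sq_nonneg _)) (truncDeriv_nonneg ε m _) hh
      hV1 hV2 hX1 hX2 (sq_truncDeriv_le hε hα _) hc3.le (sq_trunc_le hε hm _)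
  have hsqi : Integrable fun x => φ x ^ 2 * truncDeriv ε α (D x) ^ 2 * ‖gradient D x‖ ^ 2 := by
    refine Continuous.integrable_of_hasCompactSupport ?_ ?_
    · exact ((hφ.1.continuous.pow 2).mul (((continuous_truncDeriv hε α).comp
        hDc.continuous).pow 2)).mul ((continuous_gradient hDc).norm.pow 2)
    · exact hφ.2.1.mono fun x hx h0 => hx (by simp [h0])
  have hgφi : Integrable fun x => ‖gradient φ x‖ ^ 2 := by
    refine ((continuous_gradient hφ.1).norm.pow 2).integrable_of_hasCompactSupport ?_
    exact (hasCompactSupport_gradient hφ.2.1).mono fun x hx h0 => hx (by simp [h0])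
  have hfin := integral_mono ((hsqi.const_mul A).sub (hgφi.const_mul (2 * c2 ^ 2 / c1 * C3)))
    (((hi1.sub hi2).congr (Eventually.of_forall fun x => by
      simp only [Pi.sub_apply]; rw [← inner_sub_left])).const_mul h⁻¹) hpt
  simp only [Pi.sub_apply] at hfin
  rw [integral_sub (hsqi.const_mul A) (hgφi.const_mul _), integral_const_mul, integral_const_mul,
    integral_const_mul, htested] at hfin
  have hr : h⁻¹ * ∫ x, f x * (ψ (x + h • (-bas i)) - ψ x) ≤ Cf * B := by
    rw [inv_mul_le_iff₀ hh]
    exact (le_abs_self _).trans hrhs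
  rw [← div_eq_inv_mul, le_div_iff₀ hApos]
  linarith

lemma abs_integral_mul_le_sqrt {X : Type*} [MeasurableSpace X] {μ : Measure X} {f g : X → ℝ}
    (hf : MemLp f 2 μ) (hg : MemLp g 2 μ) :
    |∫ x, f x * g x ∂μ| ≤ Real.sqrt (∫ x, f x ^ 2 ∂μ) * Real.sqrt (∫ x, g x ^ 2 ∂μ) := by
  have h1 := integral_mul_norm_le_Lp_mul_Lq (μ := μ) (f := f) (g := g) Real.HolderConjugate.two_two
    (by simpa using hf) (by simpa using hg)
  have h2 : |∫ x, f x * g x ∂μ| ≤ ∫ x, ‖f x‖ * ‖g x‖ ∂μ := by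
    refine (norm_integral_le_integral_norm (fun x => f x * g x)).trans (le_of_eq ?_)
    simp only [norm_mul]
  refine h2.trans (h1.trans (le_of_eq ?_))
  rw [Real.sqrt_eq_rpow, Real.sqrt_eq_rpow]
  simp

lemma IsLocSol.exists_wpd_spow {p m α : ℝ} {O O' : Set (Euc n)} {u f φ : Euc n → ℝ}
    (S : IsLocSol p O u f) (hp : 1 < p) (hm : 0 < m) (hα0 : 0 < α)
    (hα : 2 * α - 2 = m - 1 + max (p - 2) 0) (hO' : IsOpen O') (hφ : IsC1c O φ)
    (hφ1 : ∀ x ∈ O', φ x = 1) (i j : Fin n) :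
    ∃ F : Euc n → ℝ, MemLp F 2 volume ∧ (∀ x, x ∉ O' → F x = 0) ∧
      WPD O' (fun x => spow α (pd u i x)) F j := by
  have hpc : Continuous (pd u i) := continuous_pd S.contDiff i
  have hsc : Continuous fun x => spow α (pd u i x) := (continuous_spow hα0).comp hpc
  obtain ⟨K, hK⟩ := S.energy_bound hp hm hα i hφ
  obtain ⟨M, hM⟩ := (hasCompactSupport_pd S.hasCompactSupport i).exists_bound_of_continuous hpc
  refine exists_wpd_of_bound hO' hsc.locallyIntegrable j (α * Real.sqrt K) fun ψ hψ => ?_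
  have hψ1 := hψ.isC1c
  have hε : ∀ k : ℕ, 0 < 1 / ((k : ℝ) + 1) := fun k => by positivity
  choose h0 hh0 hK' using fun k : ℕ => hK (1 / ((k : ℝ) + 1)) (hε k)
  set ε : ℕ → ℝ := fun k => 1 / ((k : ℝ) + 1) with hεdef
  set h : ℕ → ℝ := fun k => min (h0 k) (ε k) / 2 with hh
  have hhpos : ∀ k, 0 < h k := fun k => half_pos (lt_min (hh0 k) (hε k))
  have hhlt : ∀ k, h k < h0 k := fun k =>
    (half_lt_self (lt_min (hh0 k) (hε k))).trans_le (min_le_left _ _)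
  have hhε : ∀ k, h k ≤ ε k := fun k =>
    (half_le_self (lt_min (hh0 k) (hε k)).le).trans (min_le_right _ _)
  have hεlim : Tendsto ε atTop (𝓝 0) := tendsto_one_div_add_atTop_nhds_zero_nat
  have hhlim : Tendsto h atTop (𝓝 0) :=
    squeeze_zero (fun k => (hhpos k).le) hhε hεlim
  set g : ℕ → Euc n → ℝ := fun k x => trunc (ε k) α (dq i (h k) u x) with hg
  have hgd : ∀ k, ContDiff ℝ 1 (g k) := fun k =>
    (contDiff_trunc (hε k) α).comp (contDiff_dq S.contDiff i (h k))
  have hbound : ∀ k, |∫ x, pd ψ j x * g k x| ≤ Real.sqrt (∫ x, ψ x ^ 2) * Real.sqrt K := by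
    intro k
    have e1 := integral_mul_pd hψ1.1 hψ1.2.1 (hgd k) j
    have e2 : |∫ x, pd ψ j x * g k x| = |∫ x, ψ x * pd (g k) j x| := by rw [e1, abs_neg]
    set E : Euc n → ℝ := fun x => φ x * pd (g k) j x with hE
    have hEc : Continuous E := hφ.1.continuous.mul (continuous_pd (hgd k) j)
    have hEs : HasCompactSupport E := hφ.2.1.mul_right
    have e3 : ∀ x, ψ x * pd (g k) j x = ψ x * E x := by
      intro x
      by_cases hx : x ∈ tsupport ψ
      · rw [hE]; simp only; rw [hφ1 x (hψ.2.2 hx), one_mul]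
      · rw [image_eq_zero_of_notMem_tsupport hx, zero_mul, zero_mul]
    rw [e2]
    simp only [e3]
    refine (abs_integral_mul_le_sqrt (hψ1.1.continuous.memLp_of_hasCompactSupport hψ1.2.1)
      (hEc.memLp_of_hasCompactSupport hEs)).trans ?_
    refine mul_le_mul_of_nonneg_left (Real.sqrt_le_sqrt ?_) (Real.sqrt_nonneg _)
    refine le_trans ?_ (hK' k (h k) (hhpos k) (hhlt k))
    have hDc := contDiff_dq S.contDiff i (h k)
    refine integral_mono_of_nonneg (Eventually.of_forall fun x => sq_nonneg _) ?_
      (Eventually.of_forall fun x => ?_)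
    · refine Continuous.integrable_of_hasCompactSupport ?_ ?_
      · exact ((hφ.1.continuous.pow 2).mul (((continuous_truncDeriv (hε k) α).comp
          hDc.continuous).pow 2)).mul ((continuous_gradient hDc).norm.pow 2)
      · exact hφ.2.1.mono fun x hx h0 => hx (by simp [h0])
    · have e4 : |pd (g k) j x| ≤ |truncDeriv (ε k) α (dq i (h k) u x)| *
          ‖gradient (dq i (h k) u) x‖ := by
        refine (abs_pd_le _ _ _).trans (le_of_eq ?_)
        rw [hg]
        simp only
        rw [gradient_comp_real (hasDerivAt_trunc (hε k) α _)
          (hDc.differentiable one_ne_zero x), norm_smul, Real.norm_eq_abs]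
      have e5 : pd (g k) j x ^ 2 ≤ (|truncDeriv (ε k) α (dq i (h k) u x)| *
          ‖gradient (dq i (h k) u) x‖) ^ 2 := by
        rw [← sq_abs]; exact pow_le_pow_left₀ (abs_nonneg _) e4 2
      rw [mul_pow, sq_abs] at e5
      simp only [hE, mul_pow]
      rw [mul_assoc]
      exact mul_le_mul_of_nonneg_left e5 (sq_nonneg _)
  have hDlim : ∀ x, Tendsto (fun k => dq i (h k) u x) atTop (𝓝 (pd u i x)) := by
    intro x
    choose s hs hs2 using fun k => exists_dq_eq S.contDiff i (hhpos k) x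
    simp only [hs2]
    have hs0 : Tendsto s atTop (𝓝 0) :=
      squeeze_zero (fun k => (hs k).1.le) (fun k => (hs k).2.le) hhlim
    have : Continuous fun s : ℝ => pd u i (x + s • bas i) :=
      hpc.comp (continuous_const.add (continuous_id.smul continuous_const))
    have := (this.tendsto 0).comp hs0
    simpa [Function.comp_def] using this
  have hglim : ∀ x, Tendsto (fun k => g k x) atTop (𝓝 (spow α (pd u i x) / α)) := by
    intro x
    have e1 : Tendsto (fun k => spow α (dq i (h k) u x) / α) atTop
        (𝓝 (spow α (pd u i x) / α)) :=
      (((continuous_spow hα0).tendsto _).comp (hDlim x)).div_const α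
    have e2 : Tendsto (fun k => (2 * ε k) ^ α / α) atTop (𝓝 0) := by
      have := ((hεlim.const_mul 2).rpow_const (p := α) (Or.inr hα0.le)).div_const α
      simpa [Real.zero_rpow hα0.ne'] using this
    have e3 : Tendsto (fun k => g k x - spow α (dq i (h k) u x) / α) atTop (𝓝 0) :=
      squeeze_zero_norm (fun k => abs_trunc_sub_le (hε k) hα0 _) e2
    simpa using e3.add e1
  have hlim : Tendsto (fun k => ∫ x, pd ψ j x * g k x) atTop
      (𝓝 (∫ x, pd ψ j x * (spow α (pd u i x) / α))) := by
    refine tendsto_integral_of_dominated_convergence (fun x => ‖pd ψ j x‖ * (M ^ α / α)) ?_ ?_ ?_ ?_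
    · exact fun k => ((continuous_pd hψ1.1 j).mul (hgd k).continuous).aestronglyMeasurable
    · exact (((continuous_pd hψ1.1 j).integrable_of_hasCompactSupport
        (hasCompactSupport_pd hψ.2.1 j)).norm).mul_const _
    · refine fun k => Eventually.of_forall fun x => ?_
      rw [norm_mul]
      refine mul_le_mul_of_nonneg_left ?_ (norm_nonneg _)
      refine (abs_trunc_le (hε k) hα0 _).trans ?_
      obtain ⟨s, -, hs⟩ := exists_dq_eq S.contDiff i (hhpos k) x
      rw [hs]
      have := hM (x + s • bas i)
      rw [Real.norm_eq_abs] at this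
      gcongr
    · exact Eventually.of_forall fun x => (hglim x).const_mul _
  have hle := le_of_tendsto hlim.abs (Eventually.of_forall hbound)
  have e6 : ∫ x, pd ψ j x * (spow α (pd u i x) / α) = (∫ x, pd ψ j x * spow α (pd u i x)) / α := by
    rw [← integral_div]
    simp only [mul_div_assoc]
  rw [e6, abs_div, abs_of_pos hα0, div_le_iff₀ hα0] at hle
  linarith

lemma MemLp.integrable_of_eq_zero {F : Euc n → ℝ} {K : Set (Euc n)} (hF : MemLp F 2 volume)
    (hK : IsCompact K) (h0 : ∀ x, x ∉ K → F x = 0) : Integrable F := by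
  have h1 : IntegrableOn F K := by
    have : IsFiniteMeasure (volume.restrict K) := ⟨by simpa using hK.measure_lt_top⟩
    exact (hF.restrict K).integrable (by norm_num)
  rwa [integrableOn_iff_integrable_of_support_subset] at h1
  intro x hx
  by_contra hxK
  exact hx (h0 x hxK)

/-- Second weak derivatives with quantitative decay at the critical set. -/
lemma IsLocSol.exists_hessian {p κ : ℝ} {O O' : Set (Euc n)} {u f φ : Euc n → ℝ}
    (S : IsLocSol p O u f) (hp : 1 < p) (hκ : 0 < κ) (hκ1 : κ + max (p - 2) 0 < 1)
    (hO' : IsOpen O') (hφ : IsC1c O φ) (hφ1 : ∀ x ∈ O', φ x = 1) :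
    ∃ D F : Fin n → Fin n → Euc n → ℝ, (∀ i j, MemLp (F i j) 2 volume) ∧
      (∀ i j, MemLp (D i j) 2 volume) ∧ (∀ i j, Integrable (D i j)) ∧
      (∀ i j x, x ∉ O' → D i j x = 0) ∧
      (∀ i j, WPD O' (pd u i) (D i j) j) ∧
      (∀ i j x, |D i j x| ≤ 2 * |pd u i x| ^ (κ / 2) * |F i j x|) := by
  have hmax : 0 ≤ max (p - 2) 0 := le_max_right _ _
  set α : ℝ := 1 - κ / 2 with hα
  have hα0 : 1 / 2 < α := by rw [hα]; linarith
  have hα1 : α < 1 := by rw [hα]; linarith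
  have hαp : 0 < α := by linarith
  choose F hF hF0 hFW using fun i j => S.exists_wpd_spow (m := 1 - κ - max (p - 2) 0) (α := α) hp
    (by linarith) hαp (by rw [hα]; ring) hO' hφ hφ1 i j
  have hK : ∀ x, x ∉ tsupport φ → x ∉ O' := fun x hx hx' => hx (subset_tsupport _ (by
    simp [hφ1 x hx']))
  have hFi : ∀ i j, Integrable (F i j) := fun i j =>
    MemLp.integrable_of_eq_zero (hF i j) hφ.2.1 fun x hx => hF0 i j x (hK x hx)
  have hinv : 1 < 1 / α := by rw [lt_div_iff₀ hαp]; linarith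
  have hpc : ∀ i, Continuous (pd u i) := continuous_pd S.contDiff
  have hps : ∀ i, HasCompactSupport (pd u i) := hasCompactSupport_pd S.hasCompactSupport
  have hW : ∀ i j, WPD O' (pd u i)
      (fun x => (1 / α * |pd u i x| ^ (κ / 2)) * F i j x) j := by
    intro i j
    have h := WPD.comp (Φ := spow (1 / α)) hO' ((continuous_spow hαp).comp (hpc i))
      ((hps i).comp_left (g := spow α) (by simp [spow])) (hFi i j) (hFW i j) (contDiff_spow hinv)
    have e1 : (fun x => spow (1 / α) ((spow α ∘ pd u i) x)) = pd u i :=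
      funext fun x => spow_inv_spow hαp _
    rw [e1] at h
    convert h using 2 with x
    rw [(hasDerivAt_spow hinv _).hasFDerivAt.fderiv]
    simp only [ContinuousLinearMap.toSpanSingleton_apply, Function.comp, smul_eq_mul,
      abs_spow hαp]
    rw [← Real.rpow_mul (abs_nonneg _)]
    have : α * (1 / α - 1) = κ / 2 := by
      have : α ≠ 0 := hαp.ne'
      field_simp; rw [hα]; ring
    rw [this]; ring
  have hc : ∀ i, Continuous fun x => 1 / α * |pd u i x| ^ (κ / 2) := fun i =>
    continuous_const.mul ((hpc i).abs.rpow_const fun _ => Or.inr (by linarith))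
  have hL : ∀ i j, MemLp (fun x => (1 / α * |pd u i x| ^ (κ / 2)) * F i j x) 2 volume := by
    intro i j
    obtain ⟨C, hC⟩ := (hps i).exists_bound_of_continuous (hpc i)
    refine MemLp.of_le_mul (c := 1 / α * C ^ (κ / 2)) (hF i j)
      ((hc i).aestronglyMeasurable.mul (hF i j).1) (Eventually.of_forall fun x => ?_)
    rw [norm_mul]
    gcongr
    rw [Real.norm_of_nonneg (by positivity)]
    gcongr
    exact hC x
  refine ⟨fun i j x => (1 / α * |pd u i x| ^ (κ / 2)) * F i j x, F, hF, hL, fun i j =>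
    MemLp.integrable_of_eq_zero (hL i j) hφ.2.1 fun x hx => ?_, fun i j x hx => ?_, hW,
    fun i j x => ?_⟩
  · simp [hF0 i j x (hK x hx)]
  · simp [hF0 i j x hx]
  · rw [abs_mul, abs_of_nonneg (by positivity : 0 ≤ 1 / α * |pd u i x| ^ (κ / 2))]
    gcongr
    rw [div_le_iff₀ hαp]; linarith

lemma sum_smul_bas (a : Fin n → ℝ) : ∑ i, a i • bas i = WithLp.toLp 2 a := by
  ext k
  simp [bas, Pi.single_apply]

lemma integrable_toEuc {D : Fin n → Euc n → ℝ} (hD : ∀ i, Integrable (D i)) :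
    Integrable (fun x => (WithLp.toLp 2 fun i => D i x : Euc n)) := by
  have : Integrable (fun x => ∑ i, D i x • bas i) :=
    integrable_finsetSum _ fun i _ => (hD i).smul_const _
  exact this.congr (Eventually.of_forall fun x => sum_smul_bas _)

lemma euc_proj_apply (i : Fin n) (v : Euc n) : (EuclideanSpace.proj i : Euc n →L[ℝ] ℝ) v = v i :=
  rfl

lemma WPD.toEuc {O : Set (Euc n)} {g : Euc n → Euc n} {D : Fin n → Euc n → ℝ} {j : Fin n}
    (hg : Continuous g) (hD : ∀ i, Integrable (D i))
    (h : ∀ i, WPD O (fun x => g x i) (D i) j) :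
    WPD O g (fun x => WithLp.toLp 2 fun i => D i x) j := by
  have hDi := integrable_toEuc hD
  intro ψ hψ
  have hψ1 := hψ.isC1c
  ext i
  have e1 := (EuclideanSpace.proj i : Euc n →L[ℝ] ℝ).integral_comp_comm (μ := volume)
    (φ := fun x => pd ψ j x • g x) (((continuous_pd hψ1.1 j).smul hg).integrable_of_hasCompactSupport
      (hasCompactSupport_pd hψ1.2.1 j).smul_right)
  obtain ⟨C, hC⟩ := hψ1.2.1.exists_bound_of_continuous hψ1.1.continuous
  have e2 := (EuclideanSpace.proj i : Euc n →L[ℝ] ℝ).integral_comp_comm (μ := volume)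
    (φ := fun x => ψ x • (WithLp.toLp 2 fun i => D i x : Euc n))
    (hDi.bdd_smul C hψ1.1.continuous.aestronglyMeasurable (Eventually.of_forall hC))
  simp only [euc_proj_apply] at e1 e2
  rw [PiLp.neg_apply, ← e1, ← e2]
  exact h i ψ hψ

/-- A smooth function that agrees with `s ^ r` for `c ≤ s`. -/
lemma exists_contDiff_rpow (r : ℝ) {c : ℝ} (hc : 0 < c) :
    ∃ h : ℝ → ℝ, ContDiff ℝ ∞ h ∧ ∀ s, c ≤ s → h s = s ^ r := by
  refine ⟨fun s => Real.smoothTransition (2 * s / c - 1) * s ^ r, ?_, fun s hs => ?_⟩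
  · rw [contDiff_iff_contDiffAt]
    intro s
    rcases le_or_gt s 0 with h0 | h0
    · have : (fun s => Real.smoothTransition (2 * s / c - 1) * s ^ r) =ᶠ[𝓝 s] fun _ => 0 := by
        filter_upwards [gt_mem_nhds (show s < c / 2 by linarith)] with t ht
        rw [Real.smoothTransition.zero_of_nonpos, zero_mul]
        rw [sub_nonpos, div_le_one hc]; linarith
      exact contDiffAt_const.congr_of_eventuallyEq this
    · refine ContDiffAt.mul ?_ (Real.contDiffAt_rpow_const_of_ne h0.ne')
      exact (Real.smoothTransition.contDiff (n := (⊤ : ℕ∞))).contDiffAt.comp s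
        (((contDiff_const.mul contDiff_id).div_const c).sub contDiff_const).contDiffAt
  · simp only
    rw [Real.smoothTransition.one_of_one_le, one_mul]
    rw [le_sub_iff_add_le, le_div_iff₀ hc]; linarith

lemma fderiv_radial_apply {h : ℝ → ℝ} {r : ℝ} {z : Euc n}
    (hz : z ≠ 0) (hev : ∀ᶠ s in 𝓝 (‖z‖ ^ 2), h s = s ^ r) (w : Euc n)
    (j : Fin n) : fderiv ℝ (fun z : Euc n => h (‖z‖ ^ 2) * z j) z w =
      ‖z‖ ^ (2 * r) * (w j + 2 * r * (⟪‖z‖⁻¹ • z, w⟫_ℝ * (‖z‖⁻¹ * z j))) := by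
  have hz0 : 0 < ‖z‖ := norm_pos_iff.2 hz
  have hz2 : 0 < ‖z‖ ^ 2 := by positivity
  have d0 : HasDerivAt h (r * (‖z‖ ^ 2) ^ (r - 1)) (‖z‖ ^ 2) :=
    (Real.hasDerivAt_rpow_const (Or.inl hz2.ne')).congr_of_eventuallyEq hev
  have d1 : HasFDerivAt (fun z : Euc n => ‖z‖ ^ 2) (2 • (innerSL ℝ z)) z :=
    (hasStrictFDerivAt_norm_sq z).hasFDerivAt
  have d2 := d0.comp_hasFDerivAt z d1
  have d3 : HasFDerivAt (fun z : Euc n => z j) (EuclideanSpace.proj j : Euc n →L[ℝ] ℝ) z :=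
    (EuclideanSpace.proj j : Euc n →L[ℝ] ℝ).hasFDerivAt
  have d4 : fderiv ℝ (fun z : Euc n => h (‖z‖ ^ 2) * z j) z = _ := (d2.mul d3).fderiv
  rw [d4]
  simp only [Function.comp, _root_.add_apply, _root_.smul_apply,
    euc_proj_apply, innerSL_apply_apply, smul_eq_mul, hev.self_of_nhds, nsmul_eq_mul,
    Nat.cast_ofNat, real_inner_smul_left]
  have e1 : (‖z‖ ^ 2) ^ r = ‖z‖ ^ (2 * r) := by
    rw [← Real.rpow_natCast, ← Real.rpow_mul hz0.le]; norm_num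
  have e2 : (‖z‖ ^ 2) ^ (r - 1) = ‖z‖ ^ (2 * r) * (‖z‖⁻¹ * ‖z‖⁻¹) := by
    rw [Real.rpow_sub_one hz2.ne', e1]; field_simp
  rw [e1, e2]
  ring

/-- The direction of the gradient. -/
def dir (u : Euc n → ℝ) (x : Euc n) : Euc n := ‖gradient u x‖⁻¹ • gradient u x

lemma norm_dir_le (u : Euc n → ℝ) (x : Euc n) : ‖dir u x‖ ≤ 1 := by
  rw [dir, norm_smul, norm_inv, norm_norm]
  exact inv_mul_le_one

/-- The normalized `p`-Laplacian applied to a matrix. -/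
def npl (p : ℝ) (u : Euc n → ℝ) (D : Fin n → Fin n → Euc n → ℝ) (x : Euc n) : ℝ :=
  ∑ i, D i i x + (p - 2) * ∑ i, ∑ j, dir u x i * dir u x j * D i j x

lemma IsLocSol.ae_npl_eq {p : ℝ} {O O' : Set (Euc n)} {u f : Euc n → ℝ}
    {D : Fin n → Fin n → Euc n → ℝ}
    (S : IsLocSol p O u f) (hO' : IsOpen O') (hOO : O' ⊆ O)
    (hDi : ∀ i j, Integrable (D i j)) (hDW : ∀ i j, WPD O' (pd u i) (D i j) j) :
    ∀ᵐ x, x ∈ O' → gradient u x ≠ 0 → ‖gradient u x‖ ^ (p - 2) * npl p u D x = - f x := by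
  have hgc := continuous_gradient S.contDiff
  have hgs := hasCompactSupport_gradient S.hasCompactSupport
  set O2 : Set (Euc n) := O' ∩ {x | gradient u x ≠ 0} with hO2
  have hO2o : IsOpen O2 := hO'.inter (isOpen_ne_fun hgc continuous_const)
  have hdirc : ∀ i, ContinuousOn (fun x => dir u x i) O2 := by
    intro i
    have : ContinuousOn (dir u) O2 :=
      (hgc.norm.continuousOn.inv₀ fun x hx => norm_ne_zero_iff.2 hx.2).smul hgc.continuousOn
    exact (EuclideanSpace.proj i : Euc n →L[ℝ] ℝ).continuous.comp_continuousOn this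
  have hpw : ContinuousOn (fun x => ‖gradient u x‖ ^ (p - 2)) O2 :=
    hgc.norm.continuousOn.rpow_const fun x hx => Or.inl (norm_ne_zero_iff.2 hx.2)
  have hloc : LocallyIntegrableOn (fun x => ‖gradient u x‖ ^ (p - 2) * npl p u D x + f x) O2 := by
    refine LocallyIntegrableOn.add ?_ ?_
    · refine LocallyIntegrableOn.continuousOn_mul ?_ hpw hO2o.isLocallyClosed
      unfold npl
      refine LocallyIntegrableOn.add ?_ ?_
      · exact (integrable_finsetSum _ fun i _ => hDi i i).locallyIntegrable.locallyIntegrableOn _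
      · refine LocallyIntegrableOn.continuousOn_mul ?_ continuousOn_const hO2o.isLocallyClosed
        have : ∀ i j, LocallyIntegrableOn (fun x => dir u x i * dir u x j * D i j x) O2 :=
          fun i j => ((hDi i j).locallyIntegrable.locallyIntegrableOn _).continuousOn_mul
            ((hdirc i).mul (hdirc j)) hO2o.isLocallyClosed
        rw [locallyIntegrableOn_iff hO2o.isLocallyClosed]
        intro k hk hkc
        refine integrable_finsetSum _ fun i _ => integrable_finsetSum _ fun j _ => ?_
        exact (this i j).integrableOn_compact_subset hk hkc
    · exact S.continuous_rhs.locallyIntegrable.locallyIntegrableOn _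
  have key := hO2o.ae_eq_zero_of_integral_contDiff_smul_eq_zero hloc ?_
  · filter_upwards [key] with x hx h1 h2
    linarith [hx ⟨h1, h2⟩]
  intro ψ hψ hψc hψO
  have hψt : IsTestFun O' ψ := ⟨hψ, hψc, hψO.trans inter_subset_left⟩
  have hψ1 : IsC1c O ψ := ⟨hψt.isC1c.1, hψc, hψt.2.2.trans hOO⟩
  obtain ⟨c, hc, hcb⟩ : ∃ c > 0, ∀ x ∈ tsupport ψ, c < ‖gradient u x‖ ^ 2 := by
    rcases (tsupport ψ).eq_empty_or_nonempty with h | h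
    · exact ⟨1, one_pos, by simp [h]⟩
    · obtain ⟨x, hx, hmin⟩ := hψc.isCompact.exists_isMinOn h (hgc.norm.pow 2).continuousOn
      have : 0 < ‖gradient u x‖ := norm_pos_iff.2 (hψO hx).2
      refine ⟨‖gradient u x‖ ^ 2 / 2, by positivity, fun y hy => ?_⟩
      have : ‖gradient u x‖ ^ 2 ≤ ‖gradient u y‖ ^ 2 := hmin hy
      have : 0 < ‖gradient u x‖ ^ 2 := by positivity
      linarith
  obtain ⟨h, hh', hhe⟩ := exists_contDiff_rpow ((p - 2) / 2) hc
  have hh : ContDiff ℝ 1 h := hh'.of_le (by simp)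
  have hΦ : ∀ j, ContDiff ℝ 1 (fun z : Euc n => h (‖z‖ ^ 2) * z j) := fun j =>
    (hh.comp (contDiff_norm_sq ℝ)).mul (EuclideanSpace.proj j : Euc n →L[ℝ] ℝ).contDiff
  have hF : ∀ j, Integrable (fun x => (WithLp.toLp 2 fun i => D i j x : Euc n)) := fun j =>
    integrable_toEuc fun i => hDi i j
  have hW : ∀ j, WPD O' (gradient u) (fun x => (WithLp.toLp 2 fun i => D i j x : Euc n)) j :=
    fun j => WPD.toEuc hgc (fun i => hDi i j) (by simpa only [gradient_apply] using fun i => hDW i j)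
  have hcomp : ∀ j, _ := fun j => WPD.comp hO' hgc hgs (hF j) (hW j) (hΦ j) ψ hψt
  have hnorm : ∀ x ∈ tsupport ψ, ∀ᶠ s in 𝓝 (‖gradient u x‖ ^ 2), h s = s ^ ((p - 2) / 2) :=
    fun x hx => by filter_upwards [lt_mem_nhds (hcb x hx)] with s hs using hhe s hs.le
  have hint1 : ∀ j, Integrable fun x => pd ψ j x • (h (‖gradient u x‖ ^ 2) * gradient u x j) :=
    fun j => ((continuous_pd hψ1.1 j).smul
      ((hΦ j).continuous.comp hgc)).integrable_of_hasCompactSupport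
      (hasCompactSupport_pd hψc j).smul_right
  have hL : ∑ j, ∫ x, pd ψ j x • (h (‖gradient u x‖ ^ 2) * gradient u x j) = ∫ x, f x * ψ x := by
    rw [← integral_finsetSum _ fun j _ => hint1 j, ← S.eqn ψ hψ1]
    congr 1 with x
    by_cases hx : x ∈ tsupport ψ
    · rw [(hnorm x hx).self_of_nhds, Vf, real_inner_smul_left, PiLp.inner_apply, Finset.mul_sum,
        ← Real.rpow_natCast, ← Real.rpow_mul (norm_nonneg _)]
      refine Finset.sum_congr rfl fun j _ => ?_
      rw [gradient_apply ψ]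
      have : ((2 : ℕ) : ℝ) * ((p - 2) / 2) = p - 2 := by push_cast; ring
      rw [this]
      simp; ring
    · have h1 : ∀ j, pd ψ j x = 0 := fun j =>
        image_eq_zero_of_notMem_tsupport fun hx' => hx (tsupport_pd_subset _ _ hx')
      have h2 : gradient ψ x = 0 :=
        image_eq_zero_of_notMem_tsupport fun hx' => hx (tsupport_gradient_subset _ hx')
      simp [h1, h2]
  obtain ⟨Cψ, hCψ⟩ := hψc.exists_bound_of_continuous hψ.continuous
  have hint2 : ∀ j, Integrable fun x => ψ x • (fderiv ℝ (fun z : Euc n => h (‖z‖ ^ 2) * z j)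
      (gradient u x) (WithLp.toLp 2 fun i => D i j x : Euc n)) := by
    intro j
    have hcc : Continuous fun x => ψ x • fderiv ℝ (fun z : Euc n => h (‖z‖ ^ 2) * z j)
        (gradient u x) := hψ.continuous.smul (((hΦ j).continuous_fderiv one_ne_zero).comp hgc)
    obtain ⟨C, hC⟩ := (hψc.smul_right (f' := fun x => fderiv ℝ (fun z : Euc n => h (‖z‖ ^ 2) * z j)
        (gradient u x))).exists_bound_of_continuous hcc
    refine ((hF j).norm.const_mul C).mono' ?_ (Eventually.of_forall fun x => ?_)
    · exact hψ.continuous.aestronglyMeasurable.smul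
        (isBoundedBilinearMap_apply.continuous.comp_aestronglyMeasurable ((((hΦ j).continuous_fderiv
        one_ne_zero).comp hgc).aestronglyMeasurable.prodMk (hF j).1))
    · exact (((ψ x • fderiv ℝ (fun z : Euc n => h (‖z‖ ^ 2) * z j)
        (gradient u x)) : Euc n →L[ℝ] ℝ).le_opNorm _).trans (by gcongr; exact hC x)
  have hR0 : ∀ x, ∑ j, ψ x • (fderiv ℝ (fun z : Euc n => h (‖z‖ ^ 2) * z j)
      (gradient u x) (WithLp.toLp 2 fun i => D i j x : Euc n)) =
      ψ x • (‖gradient u x‖ ^ (p - 2) * npl p u D x) := by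
    intro x
    by_cases hx : x ∈ tsupport ψ
    · rw [← Finset.smul_sum]
      congr 1
      simp_rw [fun j => fderiv_radial_apply (hψO hx).2 (hnorm x hx)
        (WithLp.toLp 2 fun i => D i j x : Euc n) j]
      rw [← Finset.mul_sum, Finset.sum_add_distrib, npl]
      have : 2 * ((p - 2) / 2) = p - 2 := by ring
      rw [this, Finset.sum_comm, ← Finset.mul_sum]
      congr 3
      refine Finset.sum_congr rfl fun j _ => ?_
      rw [PiLp.inner_apply, Finset.sum_mul]
      refine Finset.sum_congr rfl fun i _ => ?_
      simp [dir]
      ring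
    · simp [image_eq_zero_of_notMem_tsupport hx]
  have hR : ∑ j, ∫ x, ψ x • (fderiv ℝ (fun z : Euc n => h (‖z‖ ^ 2) * z j)
      (gradient u x) (WithLp.toLp 2 fun i => D i j x : Euc n)) =
      ∫ x, ψ x • (‖gradient u x‖ ^ (p - 2) * npl p u D x) := by
    rw [← integral_finsetSum _ fun j _ => hint2 j]
    simp_rw [hR0]
  have hsum : ∑ j, ∫ x, pd ψ j x • (h (‖gradient u x‖ ^ 2) * gradient u x j) = - ∑ j, ∫ x, ψ x •
      (fderiv ℝ (fun z : Euc n => h (‖z‖ ^ 2) * z j)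
      (gradient u x) (WithLp.toLp 2 fun i => D i j x : Euc n)) := by
    rw [← Finset.sum_neg_distrib]
    exact Finset.sum_congr rfl fun j _ => hcomp j
  rw [hL, hR] at hsum
  have hint3 : Integrable fun x => ψ x • (‖gradient u x‖ ^ (p - 2) * npl p u D x) := by
    simpa only [hR0] using integrable_finsetSum Finset.univ fun j _ => hint2 j
  have hint4 : Integrable fun x => ψ x • f x :=
    (hψ.continuous.smul S.continuous_rhs).integrable_of_hasCompactSupport hψc.smul_right
  simp_rw [smul_add]
  rw [integral_add hint3 hint4]
  have : ∫ x, ψ x • f x = ∫ x, f x * ψ x := by congr 1 with x; simp [mul_comm]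
  rw [this, hsum]; ring

lemma abs_dir_le (u : Euc n → ℝ) (x : Euc n) (i : Fin n) : |dir u x i| ≤ 1 :=
  (norm_coord_le _ _).trans (norm_dir_le u x)

lemma abs_npl_le (p : ℝ) (u : Euc n → ℝ) (D : Fin n → Fin n → Euc n → ℝ) (x : Euc n) :
    |npl p u D x| ≤ (1 + |p - 2|) * ∑ i, ∑ j, |D i j x| := by
  have h1 : |∑ i, D i i x| ≤ ∑ i, ∑ j, |D i j x| :=
    (Finset.abs_sum_le_sum_abs _ _).trans (Finset.sum_le_sum fun i _ =>
      Finset.single_le_sum (f := fun j => |D i j x|) (fun j _ => abs_nonneg _) (Finset.mem_univ i))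
  have h2 : |∑ i, ∑ j, dir u x i * dir u x j * D i j x| ≤ ∑ i, ∑ j, |D i j x| := by
    refine (Finset.abs_sum_le_sum_abs _ _).trans (Finset.sum_le_sum fun i _ =>
      (Finset.abs_sum_le_sum_abs _ _).trans (Finset.sum_le_sum fun j _ => ?_))
    rw [abs_mul, abs_mul]
    exact mul_le_of_le_one_left (abs_nonneg _)
      (mul_le_one₀ (abs_dir_le u x i) (abs_nonneg _) (abs_dir_le u x j))
  rw [npl]
  refine (abs_add_le _ _).trans ?_
  rw [abs_mul]
  nlinarith [abs_nonneg (p - 2)]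

lemma measurable_dir {u : Euc n → ℝ} (hu : ContDiff ℝ 1 u) (i : Fin n) :
    Measurable fun x => dir u x i := by
  have hm : Measurable (gradient u) := (continuous_gradient hu).measurable
  have : Measurable (dir u) := (hm.norm.inv).smul hm
  exact (EuclideanSpace.proj i : Euc n →L[ℝ] ℝ).continuous.measurable.comp this

lemma aestronglyMeasurable_npl {p : ℝ} {u : Euc n → ℝ} {D : Fin n → Fin n → Euc n → ℝ}
    (hu : ContDiff ℝ 1 u) (hD : ∀ i j, AEStronglyMeasurable (D i j) volume) :
    AEStronglyMeasurable (npl p u D) volume := by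
  refine AEStronglyMeasurable.add ?_ (AEStronglyMeasurable.const_mul ?_ _)
  · exact Finset.aestronglyMeasurable_fun_sum _ fun i _ => hD i i
  · exact Finset.aestronglyMeasurable_fun_sum _ fun i _ =>
      Finset.aestronglyMeasurable_fun_sum _ fun j _ =>
      ((measurable_dir hu i).mul (measurable_dir hu j)).aestronglyMeasurable.mul (hD i j)

lemma sq_sum_sum_le (a : Fin n → Fin n → ℝ) :
    (∑ i, ∑ j, a i j) ^ 2 ≤ (n : ℝ) ^ 2 * ∑ i, ∑ j, a i j ^ 2 := by
  have h1 := sq_sum_le_card_mul_sum_sq (s := (Finset.univ : Finset (Fin n)))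
    (f := fun i => ∑ j, a i j)
  have h2 : ∀ i, (∑ j, a i j) ^ 2 ≤ n * ∑ j, a i j ^ 2 := fun i => by
    simpa using sq_sum_le_card_mul_sum_sq (s := (Finset.univ : Finset (Fin n))) (f := a i)
  simp only [Finset.card_univ, Fintype.card_fin] at h1
  refine h1.trans ?_
  rw [sq, mul_assoc]
  gcongr
  rw [Finset.mul_sum]
  exact Finset.sum_le_sum fun i _ => h2 i

/-- Existence of the Hessian in `L²`, with its normalized `p`-Laplacian in `L^q`. -/
lemma IsLocSol.exists_hessian_memLp {p q : ℝ} {O O' : Set (Euc n)} {u f φ : Euc n → ℝ}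
    (S : IsLocSol p O u f) (hp : 1 < p) (hq : 2 ≤ q) (hpq : 2 < p → (p - 2) * (q - 1) < 1)
    (hO' : IsOpen O') (hOO : O' ⊆ O) (hφ : IsC1c O φ) (hφ1 : ∀ x ∈ O', φ x = 1) :
    ∃ D : Fin n → Fin n → Euc n → ℝ,
      (∀ i j, MemLp (D i j) 2 volume) ∧ (∀ i j, Integrable (D i j)) ∧
      (∀ i j x, x ∉ O' → D i j x = 0) ∧
      (∀ i j, WPD O' (pd u i) (D i j) j) ∧
      MemLp (npl p u D) (ENNReal.ofReal q) volume := by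
  obtain ⟨κ, hκ, hκ1, hκq⟩ : ∃ κ, 0 < κ ∧ κ + max (p - 2) 0 < 1 ∧
      (2 < p → (p - 2) * (q - 2) ≤ κ) := by
    by_cases h : 2 < p
    · have := hpq h
      have h0 : 0 ≤ (p - 2) * (q - 2) := mul_nonneg (by linarith) (by linarith)
      refine ⟨((p - 2) * (q - 2) + (1 - (p - 2))) / 2, ?_, ?_, fun _ => ?_⟩
      · nlinarith
      · rw [max_eq_left (by linarith)]; nlinarith
      · nlinarith
    · refine ⟨1 / 2, by norm_num, ?_, fun h' => absurd h' h⟩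
      rw [max_eq_right (by linarith)]; norm_num
  obtain ⟨D, F, hF, hD, hDi, hD0, hDW, hDF⟩ := S.exists_hessian hp hκ hκ1 hO' hφ hφ1
  refine ⟨D, hD, hDi, hD0, hDW, ?_⟩
  have hq0 : 0 < q := by linarith
  have hKO : ∀ x, x ∉ tsupport φ → x ∉ O' := fun x hx hx' => hx (subset_tsupport _ (by
    simp [hφ1 x hx']))
  have hG0 : ∀ x, (x ∉ O' ∨ gradient u x = 0) → npl p u D x = 0 := by
    intro x hx
    have : ∀ i j, D i j x = 0 := by
      intro i j
      rcases hx with hx | hx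
      · exact hD0 i j x hx
      · have := hDF i j x
        rw [← gradient_apply, hx] at this
        simp [Real.zero_rpow (by linarith : κ / 2 ≠ 0)] at this
        exact this
    simp [npl, this]
  obtain ⟨M, hM⟩ := S.hasCompactSupport_rhs.exists_bound_of_continuous S.continuous_rhs
  obtain ⟨M', hM'⟩ := (hasCompactSupport_gradient S.hasCompactSupport).exists_bound_of_continuous
    (continuous_gradient S.contDiff)
  have hM0 : 0 ≤ M := (norm_nonneg _).trans (hM 0)
  have hM0' : 0 ≤ M' := (norm_nonneg _).trans (hM' 0)
  have hae : ∀ᵐ x, npl p u D x = 0 ∨ (gradient u x ≠ 0 ∧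
      |npl p u D x| ≤ M * ‖gradient u x‖ ^ (2 - p)) := by
    filter_upwards [S.ae_npl_eq hO' hOO hDi hDW] with x hx
    by_cases h1 : x ∉ O' ∨ gradient u x = 0
    · exact Or.inl (hG0 x h1)
    · push Not at h1
      right
      refine ⟨h1.2, ?_⟩
      have h2 := hx h1.1 h1.2
      have hg : 0 < ‖gradient u x‖ := norm_pos_iff.2 h1.2
      have h3 : npl p u D x = - f x * ‖gradient u x‖ ^ (2 - p) := by
        rw [← h2, mul_comm, ← mul_assoc, ← Real.rpow_add hg]; simp
      rw [h3, abs_mul, abs_neg, abs_of_nonneg (Real.rpow_nonneg hg.le (2 - p))]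
      gcongr
      exact hM x
  have hGm := aestronglyMeasurable_npl (p := p) S.contDiff fun i j => (hD i j).1
  rw [← integrable_norm_rpow_iff hGm (by simpa using hq0) ENNReal.ofReal_ne_top,
    ENNReal.toReal_ofReal hq0.le]
  by_cases h2 : 2 < p
  · set A : ℝ := (M ^ (q - 2) * M' ^ (κ - (p - 2) * (q - 2))) * ((1 + |p - 2|) ^ 2 * (n ^ 2 * 4))
    have h_int : Integrable fun x => A * ∑ i, ∑ j, F i j x ^ 2 :=
      (integrable_finsetSum _ fun i _ => integrable_finsetSum _ fun j _ =>
        (hF i j).integrable_sq).const_mul A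
    refine h_int.mono' (hGm.norm.aemeasurable.pow_const q).aestronglyMeasurable ?_
    filter_upwards [hae] with x hx
    rw [Real.norm_of_nonneg (by positivity), Real.norm_eq_abs]
    rcases hx with hx | ⟨hg, hx⟩
    · rw [hx, abs_zero, Real.zero_rpow hq0.ne']
      exact mul_nonneg (by positivity) (Finset.sum_nonneg fun i _ => Finset.sum_nonneg fun j _ =>
        sq_nonneg _)
    have hg0 : 0 < ‖gradient u x‖ := norm_pos_iff.2 hg
    have e1 : |npl p u D x| ^ q ≤ |npl p u D x| ^ (q - 2) * |npl p u D x| ^ 2 := by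
      rw [← Real.rpow_natCast, ← Real.rpow_add' (abs_nonneg _) (by push_cast; linarith)]
      simp
    have e2 : |npl p u D x| ^ (q - 2) ≤ M ^ (q - 2) * ‖gradient u x‖ ^ (-((p - 2) * (q - 2))) := by
      refine (Real.rpow_le_rpow (abs_nonneg _) hx (by linarith)).trans (le_of_eq ?_)
      rw [Real.mul_rpow hM0 (by positivity), ← Real.rpow_mul hg0.le]
      congr 2; ring
    have e3 : |npl p u D x| ^ 2 ≤ (1 + |p - 2|) ^ 2 * (n ^ 2 * 4) *
        (‖gradient u x‖ ^ κ * ∑ i, ∑ j, F i j x ^ 2) := by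
      have h3 := pow_le_pow_left₀ (abs_nonneg _) (abs_npl_le p u D x) 2
      refine h3.trans ?_
      rw [mul_pow, mul_assoc ((1 + |p - 2|) ^ 2)]
      gcongr
      refine (sq_sum_sum_le _).trans ?_
      rw [mul_assoc]
      gcongr
      simp_rw [Finset.mul_sum]
      refine Finset.sum_le_sum fun i _ => Finset.sum_le_sum fun j _ => ?_
      refine (pow_le_pow_left₀ (abs_nonneg _) (hDF i j x) 2).trans ?_
      rw [mul_pow, mul_pow, sq_abs, mul_assoc]
      have : (|pd u i x| ^ (κ / 2)) ^ 2 ≤ ‖gradient u x‖ ^ κ := by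
        rw [← Real.rpow_natCast, ← Real.rpow_mul (abs_nonneg _)]
        have : κ / 2 * ((2 : ℕ) : ℝ) = κ := by push_cast; ring
        rw [this]
        exact Real.rpow_le_rpow (abs_nonneg _) (abs_pd_le _ _ _) hκ.le
      norm_num
      gcongr
    have e4 : ‖gradient u x‖ ^ (-((p - 2) * (q - 2))) * ‖gradient u x‖ ^ κ ≤
        M' ^ (κ - (p - 2) * (q - 2)) := by
      rw [← Real.rpow_add hg0, neg_add_eq_sub]
      exact Real.rpow_le_rpow hg0.le (hM' x) (by linarith [hκq h2])
    have hs : 0 ≤ ∑ i, ∑ j, F i j x ^ 2 :=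
      Finset.sum_nonneg fun i _ => Finset.sum_nonneg fun j _ => sq_nonneg _
    calc |npl p u D x| ^ q ≤ |npl p u D x| ^ (q - 2) * |npl p u D x| ^ 2 := e1
      _ ≤ (M ^ (q - 2) * ‖gradient u x‖ ^ (-((p - 2) * (q - 2)))) *
          ((1 + |p - 2|) ^ 2 * (n ^ 2 * 4) * (‖gradient u x‖ ^ κ * ∑ i, ∑ j, F i j x ^ 2)) := by
          gcongr
      _ = M ^ (q - 2) * (‖gradient u x‖ ^ (-((p - 2) * (q - 2))) * ‖gradient u x‖ ^ κ) *
          ((1 + |p - 2|) ^ 2 * (n ^ 2 * 4)) * ∑ i, ∑ j, F i j x ^ 2 := by ring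
      _ ≤ A * ∑ i, ∑ j, F i j x ^ 2 :=
          mul_le_mul_of_nonneg_right (mul_le_mul_of_nonneg_right
            (mul_le_mul_of_nonneg_left e4 (by positivity)) (by positivity)) hs
  · have h_int : Integrable ((tsupport φ).indicator fun _ => (M * M' ^ (2 - p)) ^ q) :=
      (integrable_indicator_iff hφ.2.1.isCompact.measurableSet).2
        (integrableOn_const hφ.2.1.isCompact.measure_lt_top.ne)
    refine h_int.mono' (hGm.norm.aemeasurable.pow_const q).aestronglyMeasurable ?_
    filter_upwards [hae] with x hx
    rw [Real.norm_of_nonneg (by positivity), Real.norm_eq_abs]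
    by_cases hxK : x ∈ tsupport φ
    · rw [indicator_of_mem hxK]
      gcongr
      rcases hx with hx | ⟨hg, hx⟩
      · rw [hx, abs_zero]; positivity
      · refine hx.trans ?_
        gcongr
        · linarith
        · exact hM' x
    · rw [indicator_of_notMem hxK, hG0 x (Or.inl (hKO x hxK)), abs_zero, Real.zero_rpow hq0.ne']

/-- A smooth step function. -/
def step (s : ℝ) : ℝ := Real.smoothTransition (s - 1)

lemma contDiff_step : ContDiff ℝ ∞ step :=
  Real.smoothTransition.contDiff.comp (contDiff_id.sub contDiff_const)

lemma step_of_le {s : ℝ} (h : s ≤ 1) : step s = 0 :=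
  Real.smoothTransition.zero_of_nonpos (by linarith)

lemma step_of_ge {s : ℝ} (h : 2 ≤ s) : step s = 1 :=
  Real.smoothTransition.one_of_one_le (by linarith)

lemma step_mono : Monotone step := fun _ _ h =>
  Real.smoothTransition.monotone (by linarith)

lemma deriv_step_of_lt {s : ℝ} (h : s < 1) : deriv step s = 0 := by
  have : step =ᶠ[𝓝 s] fun _ => 0 := by
    filter_upwards [gt_mem_nhds h] with t ht using step_of_le ht.le
  rw [this.deriv_eq, deriv_const]

lemma deriv_step_of_gt {s : ℝ} (h : 2 < s) : deriv step s = 0 := by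
  have : step =ᶠ[𝓝 s] fun _ => 1 := by
    filter_upwards [lt_mem_nhds h] with t ht using step_of_ge ht.le
  rw [this.deriv_eq, deriv_const]

/-- The radial profile appearing as the Laplacian of truncated fundamental solutions. -/
def radBump (x : Euc n) : ℝ := 4 * deriv step (‖x‖ ^ 2) * (‖x‖ ^ 2) ^ (1 - (n : ℝ) / 2)

lemma radBump_nonneg (x : Euc n) : 0 ≤ radBump x :=
  mul_nonneg (mul_nonneg (by norm_num) step_mono.deriv_nonneg) (by positivity)

lemma radBump_of_norm_gt {x : Euc n} (h : 2 < ‖x‖) : radBump x = 0 := by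
  rw [radBump, deriv_step_of_gt (by nlinarith)]; simp

lemma continuous_radBump : Continuous (radBump : Euc n → ℝ) := by
  obtain ⟨h, hh, he⟩ := exists_contDiff_rpow (1 - (n : ℝ) / 2) (c := 1 / 2) (by norm_num)
  have e : (radBump : Euc n → ℝ) = fun x => 4 * deriv step (‖x‖ ^ 2) * h (‖x‖ ^ 2) := by
    ext x
    by_cases hx : 1 / 2 ≤ ‖x‖ ^ 2
    · rw [radBump, he _ hx]
    · rw [radBump, deriv_step_of_lt (by linarith)]; simp
  rw [e]
  have h1 : Continuous (deriv step) := contDiff_step.continuous_deriv (by simp)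
  have h2 : Continuous fun x : Euc n => ‖x‖ ^ 2 := continuous_norm.pow 2
  exact (continuous_const.mul (h1.comp h2)).mul (hh.continuous.comp h2)

lemma hasCompactSupport_radBump : HasCompactSupport (radBump : Euc n → ℝ) := by
  refine HasCompactSupport.of_support_subset_isCompact (isCompact_closedBall 0 2) fun x hx => ?_
  by_contra h
  rw [mem_closedBall, dist_zero_right, not_le] at h
  exact hx (radBump_of_norm_gt h)

lemma integral_radBump_pos (hn : 0 < n) : 0 < ∫ x : Euc n, radBump x := by
  obtain ⟨c, hc, hcd⟩ := exists_deriv_eq_slope step (show (1 : ℝ) < 2 by norm_num)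
    contDiff_step.continuous.continuousOn
    (contDiff_step.differentiable (by simp)).differentiableOn
  rw [step_of_le le_rfl, step_of_ge le_rfl] at hcd
  refine continuous_radBump.integral_pos_of_hasCompactSupport_nonneg_nonzero
    hasCompactSupport_radBump radBump_nonneg (x := Real.sqrt c • bas ⟨0, hn⟩) ?_
  have h0 : 0 < c := by linarith [hc.1]
  have : ‖Real.sqrt c • (bas ⟨0, hn⟩ : Euc n)‖ ^ 2 = c := by
    rw [norm_smul, Real.norm_of_nonneg (Real.sqrt_nonneg _)]
    simp [bas, Real.sq_sqrt h0.le]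
  rw [radBump, this, hcd]
  norm_num
  exact ne_of_gt (Real.rpow_pos_of_pos h0 _)

/-- The rescaled radial profile. -/
def radScale (t : ℝ) (x : Euc n) : ℝ := (t ^ n)⁻¹ * radBump (t⁻¹ • x)

lemma radScale_eq {t : ℝ} (ht : 0 < t) {x : Euc n} (hx : x ≠ 0) : radScale t x =
    4 * (deriv step (‖x‖ ^ 2 / t ^ 2) / t ^ 2) * (‖x‖ ^ 2) ^ (1 - (n : ℝ) / 2) := by
  have hx0 : 0 < ‖x‖ := norm_pos_iff.2 hx
  have e1 : ‖t⁻¹ • x‖ ^ 2 = ‖x‖ ^ 2 / t ^ 2 := by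
    rw [norm_smul, norm_inv, Real.norm_of_nonneg ht.le]; field_simp
  rw [radScale, radBump, e1, Real.div_rpow (by positivity) (by positivity)]
  have e2 : (t ^ 2) ^ (1 - (n : ℝ) / 2) = t ^ 2 / t ^ n := by
    rw [← Real.rpow_natCast t 2, ← Real.rpow_mul ht.le, ← Real.rpow_natCast t n, ← Real.rpow_sub ht]
    congr 1; push_cast; ring
  rw [e2]
  field_simp

lemma pd_radial {B : ℝ → ℝ} (hB : Differentiable ℝ B) (x : Euc n) (i : Fin n) :
    pd (fun x : Euc n => B (‖x‖ ^ 2)) i x = deriv B (‖x‖ ^ 2) * (2 * x i) := by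
  have d1 : HasFDerivAt (fun z : Euc n => ‖z‖ ^ 2) (2 • (innerSL ℝ x)) x :=
    (hasStrictFDerivAt_norm_sq x).hasFDerivAt
  have d2 : fderiv ℝ (fun z : Euc n => B (‖z‖ ^ 2)) x = _ :=
    ((hB _).hasDerivAt.comp_hasFDerivAt x d1).fderiv
  rw [pd, d2]
  simp [EuclideanSpace.inner_single_right]

lemma sum_pd_pd_radial {B : ℝ → ℝ} (hB : ContDiff ℝ ∞ B) (x : Euc n) :
    ∑ i, pd (pd (fun x : Euc n => B (‖x‖ ^ 2)) i) i x =
      4 * ‖x‖ ^ 2 * deriv (deriv B) (‖x‖ ^ 2) + 2 * n * deriv B (‖x‖ ^ 2) := by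
  have hB' : ContDiff ℝ ∞ (deriv B) := (contDiff_infty_iff_deriv.1 hB).2
  have hd := hB'.differentiable (by simp)
  have h1 : ∀ i, pd (pd (fun x : Euc n => B (‖x‖ ^ 2)) i) i x =
      4 * deriv (deriv B) (‖x‖ ^ 2) * (x i) ^ 2 + 2 * deriv B (‖x‖ ^ 2) := by
    intro i
    have e : pd (fun x : Euc n => B (‖x‖ ^ 2)) i = fun x => deriv B (‖x‖ ^ 2) * (2 * x i) :=
      funext fun x => pd_radial (hB.differentiable (by simp)) x i
    rw [e]
    have d1 : DifferentiableAt ℝ (fun x : Euc n => deriv B (‖x‖ ^ 2)) x :=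
      (hd _).comp x (hasStrictFDerivAt_norm_sq x).hasFDerivAt.differentiableAt
    have d2 : HasFDerivAt (fun x : Euc n => 2 * x i)
        ((2 : ℝ) • (EuclideanSpace.proj i : Euc n →L[ℝ] ℝ)) x :=
      (EuclideanSpace.proj i : Euc n →L[ℝ] ℝ).hasFDerivAt.const_mul 2
    have d3 : fderiv ℝ (fun x : Euc n => deriv B (‖x‖ ^ 2) * (2 * x i)) x = _ :=
      (d1.hasFDerivAt.mul d2).fderiv
    rw [pd, d3]
    have e2 := pd_radial hd x i
    rw [pd] at e2
    simp [e2]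
    ring
  simp_rw [h1]
  rw [Finset.sum_add_distrib, ← Finset.mul_sum, EuclideanSpace.norm_sq_eq]
  simp
  ring

/-- Smooth compactly supported function whose Laplacian is a difference of rescaled profiles. -/
lemma exists_kernel {δ R : ℝ} (hδ : 0 < δ) (hR : 0 < R) :
    ∃ k : Euc n → ℝ, ContDiff ℝ ∞ k ∧ HasCompactSupport k ∧
      ∀ x, ∑ i, pd (pd k i) i x = radScale δ x - radScale R x := by
  set c : ℝ := min (δ ^ 2) (R ^ 2) with hc
  set S : ℝ := 2 * max (δ ^ 2) (R ^ 2) with hS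
  have hc0 : 0 < c := lt_min (by positivity) (by positivity)
  obtain ⟨h, hh, he⟩ := exists_contDiff_rpow (-((n : ℝ) / 2)) (c := c / 2) (by positivity)
  set w : ℝ → ℝ := fun s => (step (s / δ ^ 2) - step (s / R ^ 2)) * h s with hw
  have hwc : ContDiff ℝ ∞ w :=
    ((contDiff_step.comp (contDiff_id.div_const _)).sub
      (contDiff_step.comp (contDiff_id.div_const _))).mul hh
  have hwS : ∀ s, S ≤ s → w s = 0 := by
    intro s hs
    have h1 : 2 ≤ s / δ ^ 2 := by
      rw [le_div_iff₀ (by positivity)]; linarith [le_max_left (δ ^ 2) (R ^ 2)]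
    have h2 : 2 ≤ s / R ^ 2 := by
      rw [le_div_iff₀ (by positivity)]; linarith [le_max_right (δ ^ 2) (R ^ 2)]
    simp [hw, step_of_ge h1, step_of_ge h2]
  set B : ℝ → ℝ := fun s => ∫ t in S..s, w t with hBd
  have hBder : ∀ s, HasDerivAt B (w s) s := fun s =>
    (hwc.continuous.integral_hasStrictDerivAt S s).hasDerivAt
  have hdB : deriv B = w := funext fun s => (hBder s).deriv
  have hB : ContDiff ℝ ∞ B := by
    rw [contDiff_infty_iff_deriv, hdB]
    exact ⟨fun s => (hBder s).differentiableAt, hwc⟩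
  refine ⟨fun x => B (‖x‖ ^ 2), hB.comp (contDiff_norm_sq ℝ), ?_, fun x => ?_⟩
  · refine HasCompactSupport.of_support_subset_isCompact (isCompact_closedBall 0 (S + 1))
      fun x hx => ?_
    by_contra hx'
    rw [mem_closedBall, dist_zero_right, not_le] at hx'
    apply hx
    have hS0 : 0 ≤ S := by positivity
    have hSx : S ≤ ‖x‖ ^ 2 := by nlinarith
    change ∫ t in S..‖x‖ ^ 2, w t = 0
    rw [intervalIntegral.integral_congr (g := fun _ => 0), intervalIntegral.integral_zero]
    intro t ht
    rw [uIcc_of_le hSx] at ht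
    exact hwS t ht.1
  · rw [sum_pd_pd_radial hB, hdB]
    set s := ‖x‖ ^ 2 with hs
    by_cases hsc : s < c
    · have h1 : ∀ t < c, w t = 0 := by
        intro t ht
        have h1 : t / δ ^ 2 ≤ 1 := by
          rw [div_le_one (by positivity)]; linarith [min_le_left (δ ^ 2) (R ^ 2)]
        have h2 : t / R ^ 2 ≤ 1 := by
          rw [div_le_one (by positivity)]; linarith [min_le_right (δ ^ 2) (R ^ 2)]
        simp [hw, step_of_le h1, step_of_le h2]
      have h2 : deriv w s = 0 := by
        have : w =ᶠ[𝓝 s] fun _ => 0 := by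
          filter_upwards [gt_mem_nhds hsc] with t ht using h1 t ht
        rw [this.deriv_eq, deriv_const]
      have h3 : ∀ t : ℝ, 0 < t → c ≤ t ^ 2 → radScale t x = 0 := by
        intro t ht hct
        have e1 : ‖t⁻¹ • x‖ ^ 2 = s / t ^ 2 := by
          rw [norm_smul, norm_inv, Real.norm_of_nonneg ht.le, hs]; field_simp
        rw [radScale, radBump, e1, deriv_step_of_lt]
        · simp
        · rw [div_lt_one (by positivity)]; linarith
      rw [h1 s hsc, h2, h3 δ hδ (min_le_left _ _), h3 R hR (min_le_right _ _)]
      simp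
    · push Not at hsc
      have hs0 : 0 < s := by linarith
      have hx : x ≠ 0 := by
        rintro rfl
        simp [hs] at hs0
      have hdw : HasDerivAt w ((deriv step (s / δ ^ 2) * (1 / δ ^ 2) -
          deriv step (s / R ^ 2) * (1 / R ^ 2)) * s ^ (-((n : ℝ) / 2)) +
          (step (s / δ ^ 2) - step (s / R ^ 2)) * (-((n : ℝ) / 2) * s ^ (-((n : ℝ) / 2) - 1))) s := by
        have hst : ∀ y, HasDerivAt step (deriv step y) y := fun y =>
          (contDiff_step.differentiable (by simp) y).hasDerivAt
        have d1 : ∀ t : ℝ, HasDerivAt (fun s => step (s / t)) (deriv step (s / t) * (1 / t)) s :=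
          fun t => HasDerivAt.comp (h₂ := step) s (hst (s / t)) ((hasDerivAt_id s).div_const t)
        have d2 := Real.hasDerivAt_rpow_const (x := s) (p := -((n : ℝ) / 2)) (Or.inl hs0.ne')
        refine (((d1 (δ ^ 2)).sub (d1 (R ^ 2))).mul d2).congr_of_eventuallyEq ?_
        filter_upwards [lt_mem_nhds (show c / 2 < s by linarith)] with t ht
        simp [hw, he t ht.le]
      rw [hdw.deriv, radScale_eq hδ hx, radScale_eq hR hx, ← hs, Real.rpow_sub_one hs0.ne']
      have e3 : s ^ (1 - (n : ℝ) / 2) = s * s ^ (-((n : ℝ) / 2)) := by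
        rw [sub_eq_add_neg, Real.rpow_add hs0, Real.rpow_one]
      rw [e3]
      simp only [hw]
      rw [he s (by linarith)]
      field_simp
      ring

/-- The convolution of two real functions. -/
def cv (k g : Euc n → ℝ) : Euc n → ℝ := k ⋆[lsmul ℝ ℝ, volume] g

lemma cv_apply (k g : Euc n → ℝ) (x : Euc n) : cv k g x = ∫ y, k (x - y) * g y := by
  unfold cv
  rw [convolution_lsmul_swap]
  rfl

lemma pd_cv {k g : Euc n → ℝ} (hk : ContDiff ℝ ∞ k) (hkc : HasCompactSupport k)
    (hg : LocallyIntegrable g) (i : Fin n) : pd (cv k g) i = cv (pd k i) g := by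
  ext x
  have hk1 : ContDiff ℝ 1 k := hk.of_le (by simp)
  have h : HasFDerivAt (cv k g) _ x :=
    hkc.hasFDerivAt_convolution_left (lsmul ℝ ℝ : ℝ →L[ℝ] ℝ →L[ℝ] ℝ) hk1 hg x
  rw [pd, h.fderiv, cv_apply, convolution_eq_swap, ContinuousLinearMap.integral_apply]
  · simp [pd]
  · exact ((hkc.fderiv ℝ).convolutionExists_left
      ((lsmul ℝ ℝ : ℝ →L[ℝ] ℝ →L[ℝ] ℝ).precompL (Euc n))
      (hk1.continuous_fderiv one_ne_zero) hg x).integrable_swap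

lemma sum_pd_pd_cv {k g ρ : Euc n → ℝ} (hk : ContDiff ℝ ∞ k) (hkc : HasCompactSupport k)
    (hg : LocallyIntegrable g) (hρ : ∀ x, ∑ i, pd (pd k i) i x = ρ x) (x : Euc n) :
    ∑ i, pd (pd (cv k g) i) i x = cv ρ g x := by
  have h1 : ∀ i, pd (pd (cv k g) i) i x = cv (pd (pd k i) i) g x := fun i => by
    rw [pd_cv hk hkc hg, pd_cv (contDiff_pd hk i) (hasCompactSupport_pd hkc i) hg]
  simp_rw [h1, cv_apply, ← hρ, Finset.sum_mul]
  rw [integral_finsetSum]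
  intro i _
  have := ((hasCompactSupport_pd (hasCompactSupport_pd hkc i) i).convolutionExists_left
    (lsmul ℝ ℝ : ℝ →L[ℝ] ℝ →L[ℝ] ℝ) (contDiff_pd (contDiff_pd hk i) i).continuous hg
    x).integrable_swap
  simpa using this

lemma continuous_radScale (t : ℝ) : Continuous (radScale t : Euc n → ℝ) :=
  continuous_const.mul (continuous_radBump.comp (continuous_const_smul _))

lemma radScale_nonneg {t : ℝ} (ht : 0 < t) (x : Euc n) : 0 ≤ radScale t x :=
  mul_nonneg (by positivity) (radBump_nonneg _)

lemma norm_le_of_radScale_ne_zero {t : ℝ} (ht : 0 < t) {x : Euc n} (hx : radScale t x ≠ 0) :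
    ‖x‖ ≤ 2 * t := by
  by_contra h
  apply hx
  rw [radScale, radBump_of_norm_gt, mul_zero]
  rw [norm_smul, norm_inv, Real.norm_of_nonneg ht.le, ← div_eq_inv_mul, lt_div_iff₀ ht]
  linarith

lemma integral_radScale {t : ℝ} (ht : 0 < t) :
    ∫ x : Euc n, radScale t x = ∫ x : Euc n, radBump x := by
  simp only [radScale]
  rw [integral_const_mul, Measure.integral_comp_inv_smul, finrank_euclideanSpace_fin,
    abs_of_nonneg (by positivity), smul_eq_mul, inv_mul_cancel_left₀ (by positivity)]

lemma hasCompactSupport_radScale {t : ℝ} (ht : 0 < t) :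
    HasCompactSupport (radScale t : Euc n → ℝ) := by
  refine HasCompactSupport.of_support_subset_isCompact (isCompact_closedBall 0 (2 * t))
    fun x hx => ?_
  rw [mem_closedBall, dist_zero_right]
  exact norm_le_of_radScale_ne_zero ht hx

lemma eLpNorm_le_of_bound_of_support {F : Euc n → ℝ} {K : Set (Euc n)} {C : ℝ}
    (hF : ∀ x, |F x| ≤ C) (h0 : ∀ x, x ∉ K → F x = 0) (r : ℝ≥0∞) :
    eLpNorm F r volume ≤ volume K ^ r.toReal⁻¹ * ENNReal.ofReal C := by
  have h1 : eLpNorm F r (volume.restrict K) = eLpNorm F r volume :=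
    eLpNorm_restrict_eq_of_support_subset fun x hx => by
      by_contra hxK; exact hx (h0 x hxK)
  rw [← h1]
  refine (eLpNorm_le_of_ae_bound (C := C) (Eventually.of_forall hF)).trans ?_
  rw [Measure.restrict_apply_univ]

section Approx

variable {g : Euc n → ℝ}

lemma tendsto_eLpNorm_cv_radScale_zero (hn : 0 < n) (hg : Continuous g) (hgc : HasCompactSupport g)
    (r : ℝ≥0∞) :
    Tendsto (fun t => eLpNorm (fun x => (∫ x : Euc n, radBump x)⁻¹ * cv (radScale t) g x - g x) r
      volume) (𝓝[>] 0) (𝓝 0) := by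
  set c : ℝ := ∫ x : Euc n, radBump x with hc
  have hc0 : 0 < c := integral_radBump_pos hn
  set K := cthickening 2 (tsupport g)
  have hKc : IsCompact K := hgc.isCompact.cthickening
  have hKv : volume K ^ r.toReal⁻¹ ≠ ⊤ :=
    ENNReal.rpow_ne_top_of_nonneg (by positivity) hKc.measure_lt_top.ne
  have hbound : ∀ ε > 0, ∀ᶠ t in 𝓝[>] (0 : ℝ),
      eLpNorm (fun x => c⁻¹ * cv (radScale t) g x - g x) r volume ≤
        volume K ^ r.toReal⁻¹ * ENNReal.ofReal ε := by
    intro ε hε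
    obtain ⟨d, hd, h⟩ := Metric.uniformContinuous_iff.1
      (hgc.uniformContinuous_of_continuous hg) ε hε
    filter_upwards [Ioo_mem_nhdsGT (show 0 < min (d / 3) 1 by positivity)] with t ht
    have ht0 : 0 < t := ht.1
    have ht1 : t < d / 3 := ht.2.trans_le (min_le_left _ _)
    have ht2 : t < 1 := ht.2.trans_le (min_le_right _ _)
    refine eLpNorm_le_of_bound_of_support (fun x => ?_) (fun x hx => ?_) r
    · have e : c⁻¹ * cv (radScale t) g x = cv (fun y => c⁻¹ * radScale t y) g x := by
        rw [cv_apply, cv_apply, ← integral_const_mul]; simp only [mul_assoc]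
      rw [e, ← Real.dist_eq]
      refine dist_convolution_le (R := d) hε.le ?_ (fun y => mul_nonneg (by positivity)
        (radScale_nonneg ht0 y)) ?_ hg.aestronglyMeasurable fun y hy => (h hy).le
      · intro y hy
        have := norm_le_of_radScale_ne_zero ht0 (right_ne_zero_of_mul hy)
        rw [mem_ball, dist_zero_right]; linarith
      · rw [integral_const_mul, integral_radScale ht0, inv_mul_cancel₀ hc0.ne']
    · have hgx : ∀ y, dist x y ≤ 2 → g y = 0 := fun y hy => by
        by_contra hy0
        exact hx (mem_cthickening_of_dist_le _ y _ _ (subset_tsupport _ hy0) hy)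
      have hcv : cv (radScale t) g x = 0 := by
        rw [cv_apply]
        refine integral_eq_zero_of_ae (Eventually.of_forall fun y => ?_)
        by_cases hy : radScale t (x - y) = 0
        · simp [hy]
        · have := norm_le_of_radScale_ne_zero ht0 hy
          simp [hgx y (by rw [dist_eq_norm]; linarith)]
      rw [hcv, hgx x (by simp)]; simp
  rw [ENNReal.tendsto_nhds_zero]
  intro ε hε
  have h1 : Tendsto (fun e : ℝ => volume K ^ r.toReal⁻¹ * ENNReal.ofReal e) (𝓝[>] 0) (𝓝 0) := by
    have := ENNReal.Tendsto.const_mul (a := volume K ^ r.toReal⁻¹)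
      ((ENNReal.continuous_ofReal.tendsto 0).mono_left (nhdsWithin_le_nhds (s := Ioi 0)))
      (Or.inr hKv)
    simpa using this
  obtain ⟨e, he, he0⟩ := (((ENNReal.tendsto_nhds_zero.1 h1) ε hε).and self_mem_nhdsWithin).exists
  filter_upwards [hbound e he0] with t ht using ht.trans he

lemma tendsto_eLpNorm_cv_radScale_atTop (hn : 0 < n) (hg : Continuous g) (hgc : HasCompactSupport g)
    {r : ℝ≥0∞} (hr1 : 1 < r) (hr : r ≠ ⊤) (c : ℝ) :
    Tendsto (fun t => eLpNorm (fun x => c * cv (radScale t) g x) r volume) atTop (𝓝 0) := by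
  have hr0 : 1 < r.toReal := by
    rw [← ENNReal.toReal_one]; exact (ENNReal.toReal_lt_toReal (by simp) hr).2 hr1
  obtain ⟨M, hM⟩ := (hasCompactSupport_radBump (n := n)).exists_bound_of_continuous
    continuous_radBump
  have hM0 : 0 ≤ M := (norm_nonneg _).trans (hM 0)
  obtain ⟨R0, hR0⟩ := hgc.isCompact.isBounded.subset_closedBall 0
  set A := |c| * (M * ∫ y, |g y|) with hA
  have hA0 : 0 ≤ A := mul_nonneg (abs_nonneg _) (mul_nonneg hM0 (integral_nonneg fun _ => abs_nonneg _))
  set V := volume (ball (0 : Euc n) 1) with hV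
  have hgi : Integrable g := hg.integrable_of_hasCompactSupport hgc
  have hVt : V ^ r.toReal⁻¹ ≠ ⊤ :=
    ENNReal.rpow_ne_top_of_nonneg (by positivity) measure_ball_lt_top.ne
  have hbound : ∀ᶠ t : ℝ in atTop, eLpNorm (fun x => c * cv (radScale t) g x) r volume ≤
      V ^ r.toReal⁻¹ * ENNReal.ofReal (3 ^ ((n : ℝ) * r.toReal⁻¹) * A *
        t ^ (-((n : ℝ) * (1 - r.toReal⁻¹)))) := by
    filter_upwards [eventually_ge_atTop 1, eventually_ge_atTop R0] with t ht1 htR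
    have ht0 : 0 < t := by linarith
    have hb := eLpNorm_le_of_bound_of_support (F := fun x => c * cv (radScale t) g x)
      (K := closedBall 0 (3 * t)) (C := (t ^ n)⁻¹ * A) ?_ ?_ r
    · refine hb.trans (le_of_eq ?_)
      rw [Measure.addHaar_closedBall _ _ (by positivity), finrank_euclideanSpace_fin,
        ENNReal.mul_rpow_of_nonneg _ _ (by positivity), mul_comm (_ ^ _) (_ ^ _), mul_assoc,
        ENNReal.ofReal_rpow_of_nonneg (by positivity) (by positivity),
        ← ENNReal.ofReal_mul (by positivity)]
      congr 2
      rw [← Real.rpow_natCast, ← Real.rpow_mul (by positivity), Real.mul_rpow (by norm_num) ht0.le,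
        ← Real.rpow_natCast t, ← Real.rpow_neg ht0.le]
      have : t ^ (-((n : ℝ) * (1 - r.toReal⁻¹))) = t ^ ((n : ℝ) * r.toReal⁻¹) * t ^ (-(n : ℝ)) := by
        rw [← Real.rpow_add ht0]; congr 1; ring
      rw [this]; ring
    · intro x
      rw [abs_mul, cv_apply]
      have h1 : |∫ y, radScale t (x - y) * g y| ≤ ∫ y, (t ^ n)⁻¹ * M * |g y| := by
        rw [← Real.norm_eq_abs]
        refine norm_integral_le_of_norm_le (hgi.abs.const_mul _) (Eventually.of_forall fun y => ?_)
        rw [norm_mul, radScale, norm_mul, Real.norm_of_nonneg (by positivity : 0 ≤ (t ^ n)⁻¹)]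
        have := hM (t⁻¹ • (x - y))
        rw [Real.norm_eq_abs (g y)]
        gcongr
      rw [integral_const_mul] at h1
      calc |c| * |∫ y, radScale t (x - y) * g y| ≤ |c| * ((t ^ n)⁻¹ * M * ∫ y, |g y|) := by gcongr
        _ = _ := by rw [hA]; ring
    · intro x hx
      rw [mem_closedBall, dist_zero_right, not_le] at hx
      have h0 : ∫ y, radScale t (x - y) * g y = 0 := by
        refine integral_eq_zero_of_ae (Eventually.of_forall fun y => ?_)
        by_cases hy : radScale t (x - y) = 0
        · simp [hy]
        · have h1 := norm_le_of_radScale_ne_zero ht0 hy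
          have : g y = 0 := by
            by_contra hgy
            have := hR0 (subset_tsupport _ hgy)
            rw [mem_closedBall, dist_zero_right] at this
            have h2 : ‖x‖ ≤ ‖x - y‖ + ‖y‖ := by simpa using norm_add_le (x - y) y
            linarith
          simp [this]
      rw [cv_apply, h0, mul_zero]
  refine tendsto_of_tendsto_of_tendsto_of_le_of_le' tendsto_const_nhds ?_
    (Eventually.of_forall fun _ => bot_le) hbound
  have hexp : 0 < (n : ℝ) * (1 - r.toReal⁻¹) := by
    have : r.toReal⁻¹ < 1 := inv_lt_one_of_one_lt₀ hr0
    have : (0 : ℝ) < n := by exact_mod_cast hn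
    apply mul_pos this; linarith
  have h1 := (tendsto_rpow_neg_atTop hexp).const_mul (3 ^ ((n : ℝ) * r.toReal⁻¹) * A)
  have h2 := (ENNReal.continuous_ofReal.tendsto _).comp h1
  have h3 := ENNReal.Tendsto.const_mul (a := V ^ r.toReal⁻¹) h2 (Or.inr hVt)
  simpa using h3

end Approx

/-- The trace of the matrix of second partial derivatives. -/
def lap (w : Euc n → ℝ) (x : Euc n) : ℝ := ∑ i, pd (pd w i) i x

lemma continuous_lap {w : Euc n → ℝ} (hw : ContDiff ℝ ∞ w) : Continuous (lap w) :=
  continuous_finsetSum _ fun i _ => (contDiff_pd (contDiff_pd hw i) i).continuous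

lemma lap_eq_zero {w : Euc n → ℝ} {x : Euc n} (hx : x ∉ tsupport w) : lap w x = 0 :=
  Finset.sum_eq_zero fun i _ => image_eq_zero_of_notMem_tsupport fun h =>
    hx (tsupport_pd_subset w i (tsupport_pd_subset _ i h))

lemma hasCompactSupport_lap {w : Euc n → ℝ} (hw : HasCompactSupport w) :
    HasCompactSupport (lap w) :=
  HasCompactSupport.of_support_subset_isCompact hw.isCompact fun x hx => by
    by_contra h; exact hx (lap_eq_zero h)

lemma exists_lap_approx_of_continuous (hn : 0 < n) {g : Euc n → ℝ} (hg : Continuous g)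
    (hgc : HasCompactSupport g) {r₁ r₂ : ℝ≥0∞} (hr1 : 1 < r₁) (hr1' : r₁ ≠ ⊤) (hr2 : 1 < r₂)
    (hr2' : r₂ ≠ ⊤) {ε : ℝ≥0∞} (hε : ε ≠ 0) :
    ∃ ψ : Euc n → ℝ, ContDiff ℝ ∞ ψ ∧ HasCompactSupport ψ ∧
      eLpNorm (fun x => lap ψ x - g x) r₁ volume ≤ ε ∧
      eLpNorm (fun x => lap ψ x - g x) r₂ volume ≤ ε := by
  set c : ℝ := ∫ x : Euc n, radBump x
  have hε2 : 0 < ε / 2 := ENNReal.half_pos hε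
  have hz := fun r => ENNReal.tendsto_nhds_zero.1
    (tendsto_eLpNorm_cv_radScale_zero hn hg hgc r) _ hε2
  have ht := fun (r : ℝ≥0∞) (h1 : 1 < r) (h2 : r ≠ ⊤) => ENNReal.tendsto_nhds_zero.1
    (tendsto_eLpNorm_cv_radScale_atTop hn hg hgc h1 h2 c⁻¹) _ hε2
  obtain ⟨δ, ⟨hδ1, hδ2⟩, hδ⟩ := (((hz r₁).and (hz r₂)).and self_mem_nhdsWithin).exists
  obtain ⟨R, ⟨hR1, hR2⟩, hR⟩ :=
    (((ht r₁ hr1 hr1').and (ht r₂ hr2 hr2')).and (eventually_gt_atTop 0)).exists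
  obtain ⟨k, hk, hkc, hkl⟩ := exists_kernel (n := n) hδ hR
  have hgl : LocallyIntegrable g := hg.locallyIntegrable
  have hcvs : ContDiff ℝ ∞ (cv k g) := hkc.contDiff_convolution_left _ hk hgl
  have hl : ∀ x, lap (fun x => c⁻¹ * cv k g x) x - g x =
      (c⁻¹ * cv (radScale δ) g x - g x) - c⁻¹ * cv (radScale R) g x := by
    intro x
    have e1 : ∀ i, pd (fun x => c⁻¹ * cv k g x) i = fun x => c⁻¹ * pd (cv k g) i x := fun i => by
      ext y; exact pd_const_smul (hcvs.differentiable (by simp) y) c⁻¹ i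
    have e2 : ∀ i, pd (pd (fun x => c⁻¹ * cv k g x) i) i x = c⁻¹ * pd (pd (cv k g) i) i x :=
      fun i => by
        rw [e1]; exact pd_const_smul ((contDiff_pd hcvs i).differentiable (by simp) x) c⁻¹ i
    have e3 : cv (fun x => radScale δ x - radScale R x) g x =
        cv (radScale δ) g x - cv (radScale R) g x := by
      have hi : ∀ t, 0 < t → Integrable fun y => radScale t (x - y) * g y := fun t ht => by
        simpa using ((hasCompactSupport_radScale ht).convolutionExists_left
          (lsmul ℝ ℝ : ℝ →L[ℝ] ℝ →L[ℝ] ℝ) (continuous_radScale t) hgl x).integrable_swap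
      rw [cv_apply, cv_apply, cv_apply, ← integral_sub (hi δ hδ) (hi R hR)]
      simp only [sub_mul]
    rw [lap]
    simp_rw [e2]
    rw [← Finset.mul_sum, sum_pd_pd_cv hk hkc hgl hkl, e3]
    ring
  have hmt : ∀ t, Continuous (cv (radScale t) g) := fun t =>
    hgc.continuous_convolution_right _ (continuous_radScale t).locallyIntegrable hg
  have key : ∀ r, 1 < r →
      eLpNorm (fun x => c⁻¹ * cv (radScale δ) g x - g x) r volume ≤ ε / 2 →
      eLpNorm (fun x => c⁻¹ * cv (radScale R) g x) r volume ≤ ε / 2 →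
      eLpNorm (fun x => lap (fun x => c⁻¹ * cv k g x) x - g x) r volume ≤ ε := by
    intro r hr h1 h2
    simp_rw [hl]
    have := eLpNorm_sub_le (μ := volume) (p := r)
      (f := fun x => c⁻¹ * cv (radScale δ) g x - g x) (g := fun x => c⁻¹ * cv (radScale R) g x)
      (((hmt δ).const_mul _).sub hg).aestronglyMeasurable
      ((hmt R).const_mul _).aestronglyMeasurable hr.le
    exact this.trans ((add_le_add h1 h2).trans (ENNReal.add_halves ε).le)
  refine ⟨fun x => c⁻¹ * cv k g x, contDiff_const.mul hcvs, ?_, key r₁ hr1 hδ1 hR1,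
    key r₂ hr2 hδ2 hR2⟩
  exact (HasCompactSupport.convolution (lsmul ℝ ℝ : ℝ →L[ℝ] ℝ →L[ℝ] ℝ) hkc hgc).mul_left

lemma exists_lap_approx (hn : 0 < n) {g : Euc n → ℝ} {r : ℝ≥0∞} (hr : 2 ≤ r) (hr' : r ≠ ⊤)
    (hg : MemLp g r volume) {K : Set (Euc n)} (hK : IsCompact K) (h0 : ∀ x, x ∉ K → g x = 0)
    {ε : ℝ≥0∞} (hε : ε ≠ 0) :
    ∃ ψ : Euc n → ℝ, ContDiff ℝ ∞ ψ ∧ HasCompactSupport ψ ∧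
      eLpNorm (fun x => lap ψ x - g x) 2 volume ≤ ε ∧
      eLpNorm (fun x => lap ψ x - g x) r volume ≤ ε := by
  obtain ⟨χ, hχ1, -, hχc, hχ⟩ := exists_continuous_one_zero_of_isCompact hK
    (isClosed_empty (X := Euc n)) (disjoint_empty K)
  have hε2 : ε / 2 ≠ 0 := (ENNReal.half_pos hε).ne'
  set K' := tsupport χ
  have hK' : IsCompact K' := hχc.isCompact
  set e : ℝ := 1 / (2 : ℝ≥0∞).toReal - 1 / r.toReal
  set A : ℝ≥0∞ := volume K' ^ e
  have hrr : (2 : ℝ) ≤ r.toReal := by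
    simpa using ENNReal.toReal_mono hr' hr
  have he : 0 ≤ e := by
    have : 1 / r.toReal ≤ 1 / 2 := one_div_le_one_div_of_le (by norm_num) hrr
    simp only [e, ENNReal.toReal_ofNat]; linarith
  have hA : A ≠ ⊤ := ENNReal.rpow_ne_top_of_nonneg he hK'.measure_lt_top.ne
  obtain ⟨η, hη0, hη1, hη2⟩ : ∃ η : ℝ≥0∞, η ≠ 0 ∧ η ≤ ε / 2 ∧ η * A ≤ ε / 2 := by
    refine ⟨min (ε / 2) (ε / 2 / (A + 1)), ?_, min_le_left _ _, ?_⟩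
    · refine (lt_min (ENNReal.half_pos hε) (ENNReal.div_pos hε2 (by simp [hA]))).ne'
    · calc _ ≤ ε / 2 / (A + 1) * (A + 1) := by
            gcongr
            · exact min_le_right _ _
            · exact le_self_add
        _ ≤ _ := (ENNReal.div_mul_cancel (by simp) (by simp [hA])).le
  obtain ⟨g1, -, hg1, hg1c, -⟩ := hg.exists_hasCompactSupport_eLpNorm_sub_le hr' hη0
  set g2 : Euc n → ℝ := fun x => χ x * g1 x
  have hg2c : Continuous g2 := χ.continuous.mul hg1c
  have hg2s : HasCompactSupport g2 := hχc.mul_right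
  have hm : AEStronglyMeasurable (fun x => g2 x - g x) volume :=
    hg2c.aestronglyMeasurable.sub hg.1
  have hle : ∀ x, ‖g2 x - g x‖ ≤ ‖(g - g1) x‖ := by
    intro x
    by_cases hx : x ∈ K
    · have : χ x = 1 := hχ1 hx
      simp only [g2, this, one_mul, Pi.sub_apply]; rw [norm_sub_rev]
    · simp only [g2, h0 x hx, Pi.sub_apply, sub_zero, zero_sub, norm_neg, norm_mul]
      have := hχ x
      rw [Real.norm_of_nonneg this.1]
      exact mul_le_of_le_one_left (norm_nonneg _) this.2
  have h2r : eLpNorm (fun x => g2 x - g x) r volume ≤ η := (eLpNorm_mono hle).trans hg1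
  have h22 : eLpNorm (fun x => g2 x - g x) 2 volume ≤ η * A := by
    have hs : ∀ s, eLpNorm (fun x => g2 x - g x) s (volume.restrict K') =
        eLpNorm (fun x => g2 x - g x) s volume := fun s =>
      eLpNorm_restrict_eq_of_support_subset fun x hx => by
        by_contra hxK
        have hχx : χ x = 0 := image_eq_zero_of_notMem_tsupport hxK
        have hxk : x ∉ K := fun h => by simpa [hχx] using hχ1 h
        exact hx (by simp [g2, hχx, h0 x hxk])
    rw [← hs]
    refine (eLpNorm_le_eLpNorm_mul_rpow_measure_univ hr hm.restrict).trans ?_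
    rw [hs, Measure.restrict_apply_univ]
    gcongr
  obtain ⟨ψ, hψ, hψc, h3, h4⟩ := exists_lap_approx_of_continuous hn hg2c hg2s
    (r₁ := 2) (r₂ := r) (by norm_num) (by simp) (lt_of_lt_of_le (by norm_num) hr) hr' hε2
  have key : ∀ s, 1 ≤ s → eLpNorm (fun x => lap ψ x - g2 x) s volume ≤ ε / 2 →
      eLpNorm (fun x => g2 x - g x) s volume ≤ ε / 2 →
      eLpNorm (fun x => lap ψ x - g x) s volume ≤ ε := by
    intro s hs h5 h6
    have := eLpNorm_add_le (μ := volume) ((continuous_lap hψ).sub hg2c).aestronglyMeasurable hm hs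
    have e1 : (fun x => lap ψ x - g x) =
        (fun x => lap ψ x - g2 x) + fun x => g2 x - g x := by ext x; simp
    rw [e1]
    exact this.trans ((add_le_add h5 h6).trans (ENNReal.add_halves ε).le)
  exact ⟨ψ, hψ, hψc, key 2 (by norm_num) h3 (h22.trans hη2),
    key r (le_trans (by norm_num) hr) h4 (h2r.trans hη1)⟩

lemma pd_pd_eq {w : Euc n → ℝ} (hw : ContDiff ℝ ∞ w) (i j : Fin n) (x : Euc n) :
    pd (pd w i) j x = fderiv ℝ (fderiv ℝ w) x (bas j) (bas i) := by
  have hd : DifferentiableAt ℝ (fderiv ℝ w) x :=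
    (hw.fderiv_right (m := ∞) (by simp)).differentiable (by simp) x
  have h : HasFDerivAt (pd w i)
      ((ContinuousLinearMap.apply ℝ ℝ (bas i : Euc n)).comp (fderiv ℝ (fderiv ℝ w) x)) x :=
    (ContinuousLinearMap.apply ℝ ℝ (bas i : Euc n)).hasFDerivAt.comp x hd.hasFDerivAt
  rw [pd, h.fderiv]
  rfl

lemma pd_pd_comm {w : Euc n → ℝ} (hw : ContDiff ℝ ∞ w) (i j : Fin n) :
    pd (pd w i) j = pd (pd w j) i := by
  ext x
  rw [pd_pd_eq hw, pd_pd_eq hw]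
  have h2 : (2 : WithTop ℕ∞) ≤ (⊤ : ℕ∞) := WithTop.coe_le_coe.2 (le_top : (2 : ℕ∞) ≤ ⊤)
  exact (hw.contDiffAt.isSymmSndFDerivAt (by simpa using h2)) _ _

lemma integral_pd_pd_mul {w : Euc n → ℝ} (hw : ContDiff ℝ ∞ w) (hwc : HasCompactSupport w)
    (i j : Fin n) :
    ∫ x, pd (pd w i) j x * pd (pd w i) j x = ∫ x, pd (pd w i) i x * pd (pd w j) j x := by
  have h1 := fun a b => (contDiff_pd (contDiff_pd hw a) b).of_le (n := ∞) (m := 1) (by simp)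
  have h2 := fun a => (contDiff_pd hw a).of_le (n := ∞) (m := 1) (by simp)
  have hc := fun a b => hasCompactSupport_pd (hasCompactSupport_pd hwc a) b
  rw [integral_mul_pd (h1 i j) (hc i j) (h2 i)]
  simp_rw [mul_comm (pd (pd w i) i _)]
  rw [integral_mul_pd (h1 j j) (hc j j) (h2 i), pd_pd_comm hw i j,
    pd_pd_comm (contDiff_pd hw j) i j]

/-- A matrix-valued function as a function with values in a Euclidean space. -/
def hvec (D : Fin n → Fin n → Euc n → ℝ) (x : Euc n) : EuclideanSpace ℝ (Fin n × Fin n) :=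
  WithLp.toLp 2 fun ij => D ij.1 ij.2 x

lemma norm_sq_hvec (D : Fin n → Fin n → Euc n → ℝ) (x : Euc n) :
    ‖hvec D x‖ ^ 2 = ∑ i, ∑ j, D i j x ^ 2 := by
  rw [EuclideanSpace.norm_sq_eq, Fintype.sum_prod_type]
  simp [hvec]

lemma abs_le_norm_hvec (D : Fin n → Fin n → Euc n → ℝ) (i j : Fin n) (x : Euc n) :
    |D i j x| ≤ ‖hvec D x‖ :=
  PiLp.norm_apply_le (hvec D x) (i, j)

lemma aestronglyMeasurable_hvec {D : Fin n → Fin n → Euc n → ℝ}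
    (hD : ∀ i j, AEStronglyMeasurable (D i j) volume) :
    AEStronglyMeasurable (hvec D) volume := by
  refine (PiLp.continuous_toLp 2 _).comp_aestronglyMeasurable ?_
  exact (aemeasurable_pi_lambda _ fun ij : Fin n × Fin n =>
    (hD ij.1 ij.2).aemeasurable).aestronglyMeasurable

/-- Second derivatives. -/
def hess (w : Euc n → ℝ) (i j : Fin n) : Euc n → ℝ := pd (pd w i) j

lemma continuous_hess {w : Euc n → ℝ} (hw : ContDiff ℝ ∞ w) (i j : Fin n) :
    Continuous (hess w i j) := (contDiff_pd (contDiff_pd hw i) j).continuous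

lemma hasCompactSupport_hess {w : Euc n → ℝ} (hw : HasCompactSupport w) (i j : Fin n) :
    HasCompactSupport (hess w i j) := hasCompactSupport_pd (hasCompactSupport_pd hw i) j

lemma eLpNorm_two_eq {E : Type*} [NormedAddCommGroup E] {F : Euc n → E} (hF : MemLp F 2 volume) :
    eLpNorm F 2 volume = ENNReal.ofReal ((∫ x, ‖F x‖ ^ 2) ^ (2⁻¹ : ℝ)) := by
  rw [hF.eLpNorm_eq_integral_rpow_norm (by norm_num) (by norm_num)]
  simp

lemma eLpNorm_hvec_hess {w : Euc n → ℝ} (hw : ContDiff ℝ ∞ w) (hwc : HasCompactSupport w) :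
    eLpNorm (hvec (hess w)) 2 volume = eLpNorm (lap w) 2 volume := by
  have hc : Continuous (hvec (hess w)) := (PiLp.continuous_toLp 2 _).comp
    (continuous_pi fun ij => continuous_hess hw ij.1 ij.2)
  have hcs : HasCompactSupport (hvec (hess w)) :=
    HasCompactSupport.of_support_subset_isCompact hwc.isCompact fun x hx => by
      by_contra h
      apply hx
      ext ij
      simp only [hvec, hess]
      exact image_eq_zero_of_notMem_tsupport fun h2 =>
        h (tsupport_pd_subset w _ (tsupport_pd_subset _ _ h2))
  rw [eLpNorm_two_eq (hc.memLp_of_hasCompactSupport hcs),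
    eLpNorm_two_eq ((continuous_lap hw).memLp_of_hasCompactSupport (hasCompactSupport_lap hwc))]
  congr 2
  have hi : ∀ i j k l, Integrable fun x => hess w i j x * hess w k l x := fun i j k l =>
    ((continuous_hess hw i j).mul (continuous_hess hw k l)).integrable_of_hasCompactSupport
      (hasCompactSupport_hess hwc i j).mul_right
  have e2 : ∀ x, ‖lap w x‖ ^ 2 = ∑ i, ∑ j, hess w i i x * hess w j j x := fun x => by
    rw [Real.norm_eq_abs, sq_abs, sq, lap, Finset.sum_mul_sum]; rfl
  simp_rw [norm_sq_hvec, e2, sq]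
  rw [integral_finsetSum _ fun i _ => integrable_finsetSum _ fun j _ => hi i j i j,
    integral_finsetSum _ fun i _ => integrable_finsetSum _ fun j _ => hi i i j j]
  refine Finset.sum_congr rfl fun i _ => ?_
  rw [integral_finsetSum _ fun j _ => hi i j i j, integral_finsetSum _ fun j _ => hi i i j j]
  exact Finset.sum_congr rfl fun j _ => integral_pd_pd_mul hw hwc i j

lemma eLpNorm_mconv_two_le (k : ℕ) {g : Euc n → ℝ} (hg : MemLp g 2 volume)
    (hgi : Integrable g) : eLpNorm (mconv k g) 2 volume ≤ eLpNorm g 2 volume := by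
  set ρ : Euc n → ℝ := (bumpSeq n k).normed volume with hρ
  have hρ0 : ∀ x, 0 ≤ ρ x := (bumpSeq n k).nonneg_normed
  have hρc : Continuous ρ := (bumpSeq n k).continuous_normed
  have hρs : HasCompactSupport ρ := (bumpSeq n k).hasCompactSupport_normed
  have hρ1 : ∫ x, ρ x = 1 := (bumpSeq n k).integral_normed
  have hg2 : Integrable fun x => g x ^ 2 := hg.integrable_sq
  have hconv : ∀ {h : Euc n → ℝ}, Integrable h → ∀ x, Integrable fun y => ρ (x - y) * h y :=
    fun hh x => by
      simpa using (hρs.convolutionExists_left (lsmul ℝ ℝ : ℝ →L[ℝ] ℝ →L[ℝ] ℝ) hρc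
        hh.locallyIntegrable x).integrable_swap
  have hρx : ∀ x, Integrable fun y => ρ (x - y) := fun x =>
    (hρc.integrable_of_hasCompactSupport hρs).comp_sub_left x
  have hρx1 : ∀ x, ∫ y, ρ (x - y) = 1 := fun x => by
    rw [integral_sub_left_eq_self (fun y => ρ y) volume x, hρ1]
  have hpt : ∀ x, mconv k g x ^ 2 ≤ mconv k (fun y => g y ^ 2) x := by
    intro x
    set m := mconv k g x with hm
    have hm' : m = ∫ y, ρ (x - y) * g y := by rw [hm, mconv_apply]; simp [hρ]
    have h0 : 0 ≤ ∫ y, (ρ (x - y) * g y ^ 2 - 2 * m * (ρ (x - y) * g y)) + m ^ 2 * ρ (x - y) :=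
      integral_nonneg fun y => by
        have : (ρ (x - y) * g y ^ 2 - 2 * m * (ρ (x - y) * g y)) + m ^ 2 * ρ (x - y) =
          ρ (x - y) * (g y - m) ^ 2 := by ring
        simp only [this, Pi.zero_apply]
        exact mul_nonneg (hρ0 _) (sq_nonneg _)
    have hA : Integrable fun y => ρ (x - y) * g y ^ 2 - 2 * m * (ρ (x - y) * g y) :=
      (hconv hg2 x).sub ((hconv hgi x).const_mul _)
    rw [integral_add hA ((hρx x).const_mul _),
      integral_sub (hconv hg2 x) ((hconv hgi x).const_mul _), integral_const_mul,
      integral_const_mul, hρx1, ← hm'] at h0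
    have h3 : mconv k (fun y => g y ^ 2) x = ∫ y, ρ (x - y) * g y ^ 2 := by
      rw [mconv_apply]; simp [hρ]
    rw [h3]; nlinarith
  have hρi : Integrable ρ := hρc.integrable_of_hasCompactSupport hρs
  have hci : Integrable (mconv k fun y => g y ^ 2) := hρi.integrable_convolution _ hg2
  have hmm : AEStronglyMeasurable (mconv k g) volume :=
    (contDiff_mconv k hgi.locallyIntegrable).continuous.aestronglyMeasurable
  have hml : MemLp (mconv k g) 2 volume := by
    rw [memLp_two_iff_integrable_sq hmm]
    refine hci.mono' (hmm.pow 2) (Eventually.of_forall fun x => ?_)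
    rw [Real.norm_of_nonneg (sq_nonneg _)]; exact hpt x
  rw [eLpNorm_two_eq hml, eLpNorm_two_eq hg]
  have : ∫ x, ‖mconv k g x‖ ^ 2 ≤ ∫ x, ‖g x‖ ^ 2 := by
    simp only [Real.norm_eq_abs, sq_abs]
    calc ∫ x, mconv k g x ^ 2 ≤ ∫ x, mconv k (fun y => g y ^ 2) x :=
          integral_mono hml.integrable_sq hci hpt
      _ = ∫ x, g x ^ 2 := by
          rw [mconv, integral_convolution _ hρi hg2, hρ1]; simp
  gcongr

/-- The `L²` norm of the weak Hessian is controlled by that of its trace. -/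
lemma eLpNorm_hvec_le {w : Euc n → ℝ} (hw : ContDiff ℝ 1 w) (hwc : HasCompactSupport w)
    {W : Fin n → Fin n → Euc n → ℝ} (hW2 : ∀ i j, MemLp (W i j) 2 volume)
    (hWi : ∀ i j, Integrable (W i j)) (hW : ∀ i j, WPD univ (pd w i) (W i j) j) :
    eLpNorm (hvec W) 2 volume ≤ eLpNorm (fun x => ∑ i, W i i x) 2 volume := by
  have hwi : Integrable w := hw.continuous.integrable_of_hasCompactSupport hwc
  have hpi : ∀ i, Integrable (pd w i) := fun i =>
    (continuous_pd hw i).integrable_of_hasCompactSupport (hasCompactSupport_pd hwc i)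
  have hw1 : ∀ i, WPD univ w (pd w i) i := fun i ψ hψ => by
    have := integral_mul_pd (hψ.1.of_le (by simp)) hψ.2.1 hw i
    simp only [smul_eq_mul]; rw [this, neg_neg]
  have e1 : ∀ k i, pd (mconv k w) i = mconv k (pd w i) := fun k i => by
    ext x; exact fderiv_mconv_of_wpd k hwi.locallyIntegrable (hw1 i) (subset_univ _)
  have e2 : ∀ k i j, hess (mconv k w) i j = mconv k (W i j) := fun k i j => by
    ext x
    rw [hess, e1]
    exact fderiv_mconv_of_wpd k (hpi i).locallyIntegrable (hW i j) (subset_univ _)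
  have e3 : ∀ k, lap (mconv k w) = mconv k (fun x => ∑ i, W i i x) := fun k => by
    ext x
    have : ∀ i, pd (pd (mconv k w) i) i x = mconv k (W i i) x := fun i => congrFun (e2 k i i) x
    simp_rw [lap, this, mconv_apply, Finset.smul_sum]
    rw [integral_finsetSum]
    intro i _
    simpa using ((bumpSeq n k).hasCompactSupport_normed.convolutionExists_left
      (lsmul ℝ ℝ : ℝ →L[ℝ] ℝ →L[ℝ] ℝ) (bumpSeq n k).continuous_normed
        (hWi i i).locallyIntegrable x).integrable_swap
  have hvs : ∀ k, ContDiff ℝ ∞ (mconv k w) := fun k => contDiff_mconv k hwi.locallyIntegrable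
  have hae : ∀ᵐ x, Tendsto (fun k => hvec (hess (mconv k w)) x) atTop (𝓝 (hvec W x)) := by
    have : ∀ᵐ x, ∀ ij : Fin n × Fin n,
        Tendsto (fun k => mconv k (W ij.1 ij.2) x) atTop (𝓝 (W ij.1 ij.2 x)) :=
      ae_all_iff.2 fun ij => ae_tendsto_mconv (hWi _ _).locallyIntegrable
    filter_upwards [this] with x hx
    refine ((PiLp.continuous_toLp 2 _).tendsto _).comp (tendsto_pi_nhds.2 fun ij => ?_)
    simp_rw [e2]
    exact hx ij
  refine (Lp.eLpNorm_lim_le_liminf_eLpNorm (fun k => aestronglyMeasurable_hvec fun i j =>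
    (continuous_hess (hvs k) i j).aestronglyMeasurable) _ hae).trans ?_
  refine liminf_le_of_frequently_le' (Frequently.of_forall fun k => ?_)
  rw [eLpNorm_hvec_hess (hvs k) (hasCompactSupport_mconv k hwc), e3]
  exact eLpNorm_mconv_two_le k (memLp_finsetSum _ fun i _ => hW2 i i)
    (integrable_finsetSum _ fun i _ => hWi i i)

/-- The quadratic form of a matrix-valued function along a vector field. -/
def qform (a : Fin n → Euc n → ℝ) (X : Fin n → Fin n → Euc n → ℝ) (x : Euc n) : ℝ :=
  ∑ i, ∑ j, a i x * a j x * X i j x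

lemma abs_qform_le {a : Fin n → Euc n → ℝ} {x : Euc n} (ha : ∑ i, a i x ^ 2 ≤ 1)
    (X : Fin n → Fin n → Euc n → ℝ) : |qform a X x| ≤ ‖hvec X x‖ := by
  refine abs_le_of_sq_le_sq ?_ (norm_nonneg _)
  rw [norm_sq_hvec, qform]
  have h := Finset.sum_mul_sq_le_sq_mul_sq Finset.univ
    (fun ij : Fin n × Fin n => a ij.1 x * a ij.2 x) (fun ij => X ij.1 ij.2 x)
  simp only [Fintype.sum_prod_type] at h
  refine h.trans ?_
  have h2 : ∑ i, ∑ j, (a i x * a j x) ^ 2 = (∑ i, a i x ^ 2) ^ 2 := by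
    rw [sq (∑ i, a i x ^ 2), Finset.sum_mul_sum]; simp only [mul_pow]
  rw [h2]
  have h3 : 0 ≤ ∑ i, a i x ^ 2 := Finset.sum_nonneg fun i _ => sq_nonneg _
  have h4 : 0 ≤ ∑ i, ∑ j, X i j x ^ 2 :=
    Finset.sum_nonneg fun i _ => Finset.sum_nonneg fun j _ => sq_nonneg _
  exact mul_le_of_le_one_left h4 (pow_le_one₀ h3 ha)

lemma aestronglyMeasurable_qform {a : Fin n → Euc n → ℝ}
    (ha : ∀ i, AEStronglyMeasurable (a i) volume) {X : Fin n → Fin n → Euc n → ℝ}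
    (hX : ∀ i j, AEStronglyMeasurable (X i j) volume) :
    AEStronglyMeasurable (qform a X) volume :=
  Finset.aestronglyMeasurable_fun_sum _ fun i _ => Finset.aestronglyMeasurable_fun_sum _ fun j _ =>
    ((ha i).mul (ha j)).mul (hX i j)

lemma abs_qform_hess_le {a : Fin n → Euc n → ℝ} {x : Euc n} (ha : ∑ i, a i x ^ 2 ≤ 1)
    {w : Euc n → ℝ} (hw : ContDiff ℝ ∞ w) :
    |qform a (hess w) x| ≤ ‖iteratedFDeriv ℝ 2 w x‖ := by
  set v : Euc n := WithLp.toLp 2 fun i => a i x with hv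
  have hv1 : ‖v‖ ≤ 1 := by
    rw [← sq_le_one_iff₀ (norm_nonneg _), EuclideanSpace.norm_sq_eq]
    simpa [hv] using ha
  have hvs : v = ∑ i, a i x • bas i := (sum_smul_bas _).symm
  have e : iteratedFDeriv ℝ 2 w x ![v, v] = qform a (hess w) x := by
    rw [iteratedFDeriv_two_apply]
    simp only [Matrix.cons_val_zero, Matrix.cons_val_one]
    rw [hvs]
    simp only [map_sum, map_smul, FunLike.coe_sum, Finset.sum_apply, FunLike.coe_smul,
      Pi.smul_apply, smul_eq_mul, qform, hess, pd_pd_eq hw]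
    refine Finset.sum_congr rfl fun i _ => ?_
    simp only [Finset.mul_sum, mul_assoc]
  rw [← e, ← Real.norm_eq_abs]
  refine ((iteratedFDeriv ℝ 2 w x).le_opNorm _).trans ?_
  refine mul_le_of_le_one_right (norm_nonneg _) ?_
  simp only [Fin.prod_univ_two, Matrix.cons_val_zero, Matrix.cons_val_one]
  exact mul_le_one₀ hv1 (norm_nonneg _) hv1

lemma abs_hess_le {w : Euc n → ℝ} (hw : ContDiff ℝ ∞ w) (i j : Fin n) (x : Euc n) :
    |hess w i j x| ≤ ‖iteratedFDeriv ℝ 2 w x‖ := by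
  have e : iteratedFDeriv ℝ 2 w x ![bas j, bas i] = hess w i j x := by
    rw [iteratedFDeriv_two_apply, hess, pd_pd_eq hw]; simp
  rw [← e, ← Real.norm_eq_abs]
  refine ((iteratedFDeriv ℝ 2 w x).le_opNorm _).trans ?_
  simp [Fin.prod_univ_two, bas]

lemma lapl_eq_lap {w : Euc n → ℝ} (hw : ContDiff ℝ ∞ w) (x : Euc n) : lapl w x = lap w x := by
  refine Finset.sum_congr rfl fun i _ => ?_
  rw [iteratedFDeriv_two_apply, pd_pd_eq hw]; simp [bas]

/-- `C` is admissible in the Calderón–Zygmund inequality. -/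
def IsCZBound (n : ℕ) (q C : ℝ) : Prop :=
  0 ≤ C ∧ ∀ w : Euc n → ℝ, ContDiff ℝ (⊤ : ℕ∞) w → HasCompactSupport w →
    (∫ x, ‖iteratedFDeriv ℝ 2 w x‖ ^ q) ^ (1 / q) ≤ C * (∫ x, |lapl w x| ^ q) ^ (1 / q)

lemma IsCZBound.eLpNorm_le {q C : ℝ} (hC : IsCZBound n q C) (hq : 2 ≤ q) {w : Euc n → ℝ}
    (hw : ContDiff ℝ ∞ w) (hwc : HasCompactSupport w) :
    eLpNorm (iteratedFDeriv ℝ 2 w) (ENNReal.ofReal q) volume ≤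
      ENNReal.ofReal C * eLpNorm (lap w) (ENNReal.ofReal q) volume := by
  have hq0 : ENNReal.ofReal q ≠ 0 := by simp; linarith
  have h2 : ((2 : ℕ) : WithTop ℕ∞) ≤ ((⊤ : ℕ∞) : WithTop ℕ∞) :=
    WithTop.coe_le_coe.2 (le_top : ((2 : ℕ) : ℕ∞) ≤ ⊤)
  have hc : Continuous (iteratedFDeriv ℝ 2 w) := hw.continuous_iteratedFDeriv h2
  have hcs : HasCompactSupport (iteratedFDeriv ℝ 2 w) := hwc.iteratedFDeriv 2
  rw [(hc.memLp_of_hasCompactSupport hcs).eLpNorm_eq_integral_rpow_norm hq0 (by simp),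
    ((continuous_lap hw).memLp_of_hasCompactSupport
      (hasCompactSupport_lap hwc)).eLpNorm_eq_integral_rpow_norm hq0 (by simp),
    ← ENNReal.ofReal_mul hC.1, ENNReal.toReal_ofReal (by linarith)]
  refine ENNReal.ofReal_le_ofReal ?_
  have := hC.2 w hw hwc
  simp_rw [lapl_eq_lap hw, one_div] at this
  exact this

lemma exists_geometric {θ : ℝ} (hθ : θ < 1) (b : ℝ) :
    ∃ ρ D : ℝ, 0 ≤ ρ ∧ ρ < 1 ∧ 0 ≤ D ∧ b ≤ D ∧
      ∀ m : ℕ, (1 / 2 : ℝ) ^ m + θ * (D * ρ ^ m) ≤ D * ρ ^ (m + 1) := by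
  set ρ := (max θ (1 / 2) + 1) / 2 with hρ
  have h0 : max θ (1 / 2) < 1 := max_lt hθ (by norm_num)
  have h1 : θ < ρ := lt_of_le_of_lt (le_max_left θ (1 / 2)) (by rw [hρ]; linarith)
  have h2 : 1 / 2 ≤ ρ := (le_max_right θ (1 / 2)).trans (by rw [hρ]; linarith)
  have h3 : 0 < ρ - θ := by linarith
  set D := max b (1 / (ρ - θ)) with hD
  have hD1 : 1 ≤ D * (ρ - θ) := by
    rw [← div_le_iff₀ h3]; exact le_max_right _ _
  have hD0 : 0 ≤ D := le_trans (by positivity) (le_max_right b (1 / (ρ - θ)))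
  refine ⟨ρ, D, by linarith, by rw [hρ]; linarith, hD0, le_max_left _ _, fun m => ?_⟩
  have h4 : (1 / 2 : ℝ) ^ m ≤ ρ ^ m := pow_le_pow_left₀ (by norm_num) h2 m
  have h5 : 0 ≤ ρ ^ m := pow_nonneg (by linarith) m
  have h6 : 1 * ρ ^ m ≤ D * (ρ - θ) * ρ ^ m := by gcongr
  have e : D * ρ ^ (m + 1) = D * (ρ - θ) * ρ ^ m + θ * (D * ρ ^ m) := by ring
  rw [e]; linarith

lemma eLpNorm_two_hvec_sub_le {w ψ : Euc n → ℝ} (hw : ContDiff ℝ 1 w) (hwc : HasCompactSupport w)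
    {W : Fin n → Fin n → Euc n → ℝ} (hW2 : ∀ i j, MemLp (W i j) 2 volume)
    (hWi : ∀ i j, Integrable (W i j)) (hW : ∀ i j, WPD univ (pd w i) (W i j) j)
    (hψ : ContDiff ℝ ∞ ψ) (hψc : HasCompactSupport ψ) :
    eLpNorm (hvec fun i j x => W i j x - hess ψ i j x) 2 volume ≤
      eLpNorm (fun x => lap ψ x - ∑ i, W i i x) 2 volume := by
  have hpd : ∀ i, pd (w - ψ) i = pd w i - pd ψ i := fun i => by
    ext y
    simp [pd, fderiv_sub (hw.differentiable (by simp) y) (hψ.differentiable (by simp) y)]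
  have hcs : HasCompactSupport (w - ψ) := hwc.sub hψc
  have hhi : ∀ i j, Integrable (hess ψ i j) := fun i j =>
    (continuous_hess hψ i j).integrable_of_hasCompactSupport (hasCompactSupport_hess hψc i j)
  have h := eLpNorm_hvec_le (w := w - ψ) (W := fun i j x => W i j x - hess ψ i j x)
    (hw.sub (hψ.of_le (by simp))) hcs
    (fun i j => (hW2 i j).sub ((continuous_hess hψ i j).memLp_of_hasCompactSupport
      (hasCompactSupport_hess hψc i j)))
    (fun i j => (hWi i j).sub (hhi i j)) ?_
  · refine h.trans (le_of_eq ?_)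
    rw [← eLpNorm_neg]
    congr 1
    ext x
    simp only [Pi.neg_apply, Finset.sum_sub_distrib, neg_sub]
    rfl
  · intro i j φ hφ
    have hφ1 : ContDiff ℝ 1 φ := hφ.1.of_le (by simp)
    have hb : ∀ {F : Euc n → ℝ}, Integrable F → Integrable fun x => φ x * F x := fun {F} hF => by
      obtain ⟨C, hC⟩ := hφ.2.1.exists_bound_of_continuous hφ.1.continuous
      exact hF.bdd_mul hφ.1.continuous.aestronglyMeasurable (Eventually.of_forall hC)
    have hc : ∀ {F : Euc n → ℝ}, Continuous F → Integrable fun x => pd φ j x * F x := fun hF =>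
      ((continuous_pd hφ1 j).mul hF).integrable_of_hasCompactSupport
        (hasCompactSupport_pd hφ.2.1 j).mul_right
    have e1 := hW i j φ hφ
    have e2 := integral_mul_pd hφ1 hφ.2.1 ((contDiff_pd hψ i).of_le (m := 1) (by simp)) j
    simp only [smul_eq_mul] at e1 ⊢
    rw [hpd]
    simp only [Pi.sub_apply, mul_sub]
    rw [integral_sub (hc (continuous_pd hw i)) (hc (contDiff_pd hψ i).continuous),
      integral_sub (hb (hWi i j)) (hb (hhi i j)), e1]
    have e3 : ∫ x, φ x * hess ψ i j x = -∫ x, pd φ j x * pd ψ i x := e2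
    rw [e3]; ring

lemma eLpNorm_const_mul_real (c : ℝ) (F : Euc n → ℝ) (r : ℝ≥0∞) :
    eLpNorm (fun x => c * F x) r volume = ENNReal.ofReal |c| * eLpNorm F r volume := by
  have := eLpNorm_const_smul (μ := volume) c F r
  rw [← Real.norm_eq_abs, ofReal_norm, ← this]
  rfl

/-- If the Hessian is in `L²` and a small perturbation of the Laplacian is in `L^q`, then the
Hessian is in `L^q`. -/
theorem memLp_of_memLp_perturbation (hn : 0 < n) {q C s : ℝ} (hq : 2 ≤ q) (hC : IsCZBound n q C)
    (hs : |s| < 1) (hsC : |s| * C < 1) {w : Euc n → ℝ} (hw : ContDiff ℝ 1 w)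
    (hwc : HasCompactSupport w)
    {W : Fin n → Fin n → Euc n → ℝ} (hW2 : ∀ i j, MemLp (W i j) 2 volume)
    (hWi : ∀ i j, Integrable (W i j)) (hW : ∀ i j, WPD univ (pd w i) (W i j) j)
    {K : Set (Euc n)} (hK : IsCompact K) (h0 : ∀ i j x, x ∉ K → W i j x = 0)
    {a : Fin n → Euc n → ℝ} (ham : ∀ i, AEStronglyMeasurable (a i) volume)
    (ha : ∀ x, ∑ i, a i x ^ 2 ≤ 1)
    (hG : MemLp (fun x => ∑ i, W i i x + s * qform a W x) (ENNReal.ofReal q) volume) :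
    ∀ i j, MemLp (W i j) (ENNReal.ofReal q) volume := by
  set r := ENNReal.ofReal q with hr
  have hr2 : 2 ≤ r := by
    rw [hr, ← ENNReal.ofReal_ofNat]; exact ENNReal.ofReal_le_ofReal hq
  have hr1 : 1 ≤ r := le_trans (by norm_num) hr2
  have hrt : r ≠ ⊤ := by simp [hr]
  set G : Euc n → ℝ := fun x => ∑ i, W i i x + s * qform a W x with hGd
  have hhm : ∀ {φ : Euc n → ℝ}, ContDiff ℝ ∞ φ → ∀ i j, AEStronglyMeasurable (hess φ i j) volume :=
    fun hφ i j => (continuous_hess hφ i j).aestronglyMeasurable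
  have hqm : ∀ {φ : Euc n → ℝ}, ContDiff ℝ ∞ φ →
      AEStronglyMeasurable (qform a (hess φ)) volume := fun hφ =>
    aestronglyMeasurable_qform ham (hhm hφ)
  have hqb : ∀ {φ : Euc n → ℝ}, ContDiff ℝ ∞ φ → HasCompactSupport φ →
      eLpNorm (qform a (hess φ)) r volume ≤ ENNReal.ofReal C * eLpNorm (lap φ) r volume :=
    fun hφ hφc => (eLpNorm_mono fun x => by
      rw [Real.norm_eq_abs]; exact abs_qform_hess_le (ha x) hφ).trans (hC.eLpNorm_le hq hφ hφc)
  have hlap : ∀ {φ : Euc n → ℝ}, ContDiff ℝ ∞ φ → HasCompactSupport φ → ∀ t,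
      MemLp (lap φ) t volume := fun hφ hφc t =>
    (continuous_lap hφ).memLp_of_hasCompactSupport (hasCompactSupport_lap hφc)
  have step : ∀ (m : ℕ) (ψ : {φ : Euc n → ℝ // ContDiff ℝ ∞ φ ∧ HasCompactSupport φ}),
      ∃ φ : {φ : Euc n → ℝ // ContDiff ℝ ∞ φ ∧ HasCompactSupport φ},
        eLpNorm (fun x => lap φ.1 x - (G x - s * qform a (hess ψ.1) x)) 2 volume ≤
          ENNReal.ofReal ((1 / 2) ^ m) ∧
        eLpNorm (fun x => lap φ.1 x - (G x - s * qform a (hess ψ.1) x)) r volume ≤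
          ENNReal.ofReal ((1 / 2) ^ m) := by
    rintro m ⟨ψ, hψ, hψc⟩
    have hql : MemLp (qform a (hess ψ)) r volume :=
      ⟨hqm hψ, (hqb hψ hψc).trans_lt
        (ENNReal.mul_lt_top ENNReal.ofReal_lt_top (hlap hψ hψc r).2)⟩
    have hz : ∀ x, x ∉ K ∪ tsupport ψ → G x - s * qform a (hess ψ) x = 0 := fun x hx => by
      simp only [mem_union, not_or] at hx
      have e1 : ∀ i j, hess ψ i j x = 0 := fun i j => image_eq_zero_of_notMem_tsupport fun h =>
        hx.2 (tsupport_pd_subset ψ _ (tsupport_pd_subset _ _ h))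
      simp [hGd, qform, e1, h0 _ _ x hx.1]
    obtain ⟨φ, h1, h2, h3, h4⟩ := exists_lap_approx hn hr2 hrt (hG.sub (hql.const_mul s))
      (hK.union hψc.isCompact) hz (ε := ENNReal.ofReal ((1 / 2) ^ m)) (by simp)
    exact ⟨⟨φ, h1, h2⟩, h3, h4⟩
  choose next hnext2 hnextr using step
  let ψ : ℕ → {φ : Euc n → ℝ // ContDiff ℝ ∞ φ ∧ HasCompactSupport φ} := fun m =>
    Nat.rec ⟨0, contDiff_const, HasCompactSupport.zero⟩ (fun m φ => next m φ) m
  have hψs : ∀ m, ψ (m + 1) = next m (ψ m) := fun m => rfl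
  have hlap0 : lap ((ψ 0).1) = 0 := by
    ext x
    have : (ψ 0).1 = 0 := rfl
    have h0 : ∀ i, pd (0 : Euc n → ℝ) i = 0 := fun i => by ext y; simp [pd]
    rw [this]
    simp [lap, h0]
  -- bounds in `L^r`
  obtain ⟨M, hM⟩ : ∃ M : ℝ, ∀ m, eLpNorm (lap (ψ m).1) r volume ≤ ENNReal.ofReal M := by
    set g := (eLpNorm G r volume).toReal with hg
    have hgG : eLpNorm G r volume = ENNReal.ofReal g := (ENNReal.ofReal_toReal hG.2.ne).symm
    have hg0 : 0 ≤ g := ENNReal.toReal_nonneg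
    set M := (1 + g) / (1 - |s| * C) with hMd
    have hM0 : 0 ≤ M := div_nonneg (by linarith) (by linarith)
    refine ⟨M, fun m => ?_⟩
    induction m with
    | zero => rw [hlap0]; simp
    | succ m ih =>
      have hφ := (ψ m).2
      have e : lap (ψ (m + 1)).1 = (fun x => lap (next m (ψ m)).1 x -
          (G x - s * qform a (hess (ψ m).1) x)) + (fun x => G x - s * qform a (hess (ψ m).1) x) := by
        ext x; simp [hψs]
      rw [e]
      have hm1 : AEStronglyMeasurable (fun x => G x - s * qform a (hess (ψ m).1) x) volume :=
        hG.1.sub ((hqm hφ.1).const_mul s)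
      refine (eLpNorm_add_le ((continuous_lap (next m (ψ m)).2.1).aestronglyMeasurable.sub hm1)
        hm1 hr1).trans ?_
      have h2 : eLpNorm (fun x => G x - s * qform a (hess (ψ m).1) x) r volume ≤
          ENNReal.ofReal (g + |s| * (C * M)) := by
        refine (eLpNorm_sub_le (f := G) (g := fun x => s * qform a (hess (ψ m).1) x)
          hG.1 ((hqm hφ.1).const_mul s) hr1).trans ?_
        rw [ENNReal.ofReal_add hg0 (by have := hC.1; positivity), hgG, eLpNorm_const_mul_real,
          ENNReal.ofReal_mul (abs_nonneg s), ENNReal.ofReal_mul hC.1]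
        gcongr
        exact (hqb hφ.1 hφ.2).trans (by gcongr)
      refine (add_le_add (hnextr m (ψ m)) h2).trans ?_
      rw [← ENNReal.ofReal_add (by positivity) (by have := hC.1; positivity)]
      refine ENNReal.ofReal_le_ofReal ?_
      have h3 : ((1 : ℝ) / 2) ^ m ≤ 1 := pow_le_one₀ (by norm_num) (by norm_num)
      have h4 : M * (1 - |s| * C) = 1 + g := div_mul_cancel₀ _ (by linarith)
      nlinarith
  -- convergence in `L²`
  set tr : Euc n → ℝ := fun x => ∑ i, W i i x with htr
  have htr2 : MemLp tr 2 volume := memLp_finsetSum _ fun i _ => hW2 i i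
  have hE : Tendsto (fun m => eLpNorm (fun x => lap (ψ m).1 x - tr x) 2 volume) atTop (𝓝 0) := by
    obtain ⟨ρ, D, hρ0, hρ1, hD, hbD, hrec⟩ :=
      exists_geometric hs (eLpNorm (fun x => lap (ψ 0).1 x - tr x) 2 volume).toReal
    have hle : ∀ m, eLpNorm (fun x => lap (ψ m).1 x - tr x) 2 volume ≤
        ENNReal.ofReal (D * ρ ^ m) := by
      intro m
      induction m with
      | zero =>
        rw [pow_zero, mul_one]
        refine (ENNReal.ofReal_toReal ?_).symm.le.trans (ENNReal.ofReal_le_ofReal hbD)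
        exact ((hlap (ψ 0).2.1 (ψ 0).2.2 2).sub htr2).2.ne
      | succ m ih =>
        have hφ := (ψ m).2
        have e : (fun x => lap (ψ (m + 1)).1 x - tr x) = (fun x => lap (next m (ψ m)).1 x -
            (G x - s * qform a (hess (ψ m).1) x)) +
            (fun x => s * qform a (fun i j x => W i j x - hess (ψ m).1 i j x) x) := by
          ext x
          simp only [hψs, Pi.add_apply, hGd, htr, qform, mul_sub, Finset.sum_sub_distrib]
          ring
        rw [e]
        have hm1 : AEStronglyMeasurable (fun x => G x - s * qform a (hess (ψ m).1) x) volume :=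
          hG.1.sub ((hqm hφ.1).const_mul s)
        have hm2 : AEStronglyMeasurable
            (qform a fun i j x => W i j x - hess (ψ m).1 i j x) volume :=
          aestronglyMeasurable_qform ham fun i j => (hW2 i j).1.sub (hhm hφ.1 i j)
        refine (eLpNorm_add_le ((continuous_lap (next m (ψ m)).2.1).aestronglyMeasurable.sub hm1)
          (hm2.const_mul s) (by norm_num)).trans ?_
        refine le_trans ?_ (ENNReal.ofReal_le_ofReal (hrec m))
        rw [ENNReal.ofReal_add (by positivity) (by positivity), eLpNorm_const_mul_real,
          ENNReal.ofReal_mul (abs_nonneg s)]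
        gcongr
        · exact hnext2 m (ψ m)
        · refine le_trans ?_ ih
          refine (eLpNorm_mono fun x => ?_).trans
            (eLpNorm_two_hvec_sub_le hw hwc hW2 hWi hW hφ.1 hφ.2)
          rw [Real.norm_eq_abs]; exact abs_qform_le (ha x) _
    have hlim : Tendsto (fun m : ℕ => ENNReal.ofReal (D * ρ ^ m)) atTop (𝓝 0) := by
      have := ((tendsto_pow_atTop_nhds_zero_of_lt_one hρ0 hρ1).const_mul D)
      have h2 := (ENNReal.continuous_ofReal.tendsto _).comp this
      rw [mul_zero, ENNReal.ofReal_zero] at h2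
      exact h2
    exact tendsto_of_tendsto_of_tendsto_of_le_of_le tendsto_const_nhds hlim (fun _ => bot_le) hle
  intro i j
  have hij : Tendsto (fun m => eLpNorm (hess (ψ m).1 i j - W i j) 2 volume) atTop (𝓝 0) := by
    refine tendsto_of_tendsto_of_tendsto_of_le_of_le tendsto_const_nhds hE (fun _ => bot_le)
      fun m => ?_
    refine (eLpNorm_mono fun x => ?_).trans
      (eLpNorm_two_hvec_sub_le hw hwc hW2 hWi hW (ψ m).2.1 (ψ m).2.2)
    rw [Pi.sub_apply, norm_sub_rev, Real.norm_eq_abs]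
    exact abs_le_norm_hvec (fun i j x => W i j x - hess (ψ m).1 i j x) i j x
  obtain ⟨ns, -, hae⟩ := (tendstoInMeasure_of_tendsto_eLpNorm (by norm_num)
    (fun m => hhm (ψ m).2.1 i j) (hW2 i j).1 hij).exists_seq_tendsto_ae
  refine ⟨(hW2 i j).1, ?_⟩
  have hfin := Lp.eLpNorm_lim_le_liminf_eLpNorm (p := r)
    (fun k => hhm (ψ (ns k)).2.1 i j) (W i j) hae
  refine lt_of_le_of_lt (hfin.trans (liminf_le_of_frequently_le' (Frequently.of_forall fun k => ?_)))
    (ENNReal.mul_lt_top (ENNReal.ofReal_lt_top (r := C)) (ENNReal.ofReal_lt_top (r := M)))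
  refine (eLpNorm_mono fun x => ?_).trans
    ((hC.eLpNorm_le hq (ψ (ns k)).2.1 (ψ (ns k)).2.2).trans (by gcongr; exact hM _))
  rw [Real.norm_eq_abs]; exact abs_hess_le (ψ (ns k)).2.1 i j x

lemma exists_cutoff {K U : Set (Euc n)} (hK : IsCompact K) (hU : IsOpen U) (hKU : K ⊆ U) :
    ∃ (η : Euc n → ℝ) (V : Set (Euc n)), IsTestFun U η ∧ IsOpen V ∧ K ⊆ V ∧ V ⊆ U ∧
      ∀ x ∈ V, η x = 1 := by
  obtain ⟨L, hL, hKL, hLU⟩ := exists_compact_between hK hU hKU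
  obtain ⟨η, h1, h0, -⟩ := exists_contMDiffMap_one_nhds_of_subset_interior (n := ⊤)
    (modelWithCornersSelf ℝ (Euc n)) hK.isClosed hKL
  obtain ⟨V, hV, hKV, hV1⟩ := eventually_nhdsSet_iff_exists.1 h1
  have hs : Function.support η ⊆ L := fun x hx => by
    by_contra h; exact hx (h0 x h)
  refine ⟨η, V, ⟨η.contMDiff.contDiff, HasCompactSupport.of_support_subset_isCompact hL hs,
    (closure_minimal hs hL.isClosed).trans hLU⟩, hV, hKV, fun x hx => ?_, hV1⟩
  exact hLU (hs (by simp [hV1 x hx]))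

lemma pd_mul {a b : Euc n → ℝ} {x : Euc n} (ha : DifferentiableAt ℝ a x)
    (hb : DifferentiableAt ℝ b x) (i : Fin n) :
    pd (fun y => a y * b y) i x = pd a i x * b x + a x * pd b i x := by
  simp only [pd, fderiv_fun_mul ha hb, add_apply, FunLike.coe_smul, Pi.smul_apply, smul_eq_mul]
  ring

/-- The product rule for the weak Hessian of a function multiplied by a cutoff. -/
lemma WPD.cutoff {u η : Euc n → ℝ} {O : Set (Euc n)} (hu : ContDiff ℝ 1 u) (hη : IsTestFun O η)
    {D : Euc n → ℝ} {i j : Fin n} (hD : Integrable D) (hW : WPD O (pd u i) D j) :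
    WPD univ (pd (fun x => η x * u x) i) (fun x => (pd (pd η i) j x * u x + pd η i x * pd u j x +
      pd η j x * pd u i x) + η x * D x) j := by
  intro ψ hψ
  have hη1 : ContDiff ℝ 1 η := hη.1.of_le (by simp)
  have hψ1 : ContDiff ℝ 1 ψ := hψ.1.of_le (by simp)
  have hηi : ContDiff ℝ 1 (pd η i) := (contDiff_pd hη.1 i).of_le (by simp)
  have hηij := (contDiff_pd (contDiff_pd hη.1 i) j).continuous
  have hui := continuous_pd hu i
  have huj := continuous_pd hu j
  have hηj := continuous_pd hη1 j
  have hψj := continuous_pd hψ1 j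
  have hψc := hψ.2.1
  have hψjc := hasCompactSupport_pd hψ.2.1 j
  have e0 : ∀ x, pd (fun x => η x * u x) i x = pd η i x * u x + η x * pd u i x := fun x =>
    pd_mul (hη1.differentiable (by simp) x) (hu.differentiable (by simp) x) i
  have t : IsTestFun O fun x => ψ x * η x :=
    ⟨hψ.1.mul hη.1, hψc.mul_right, (tsupport_mul_subset_right).trans hη.2.2⟩
  have e1 := hW _ t
  have e1' : ∀ x, pd (fun x => ψ x * η x) j x = pd ψ j x * η x + ψ x * pd η j x := fun x =>
    pd_mul (hψ1.differentiable (by simp) x) (hη1.differentiable (by simp) x) j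
  have e2 := integral_mul_pd hψ1 hψc (hηi.mul hu) j
  have e2' : ∀ x, pd (fun x => pd η i x * u x) j x =
      pd (pd η i) j x * u x + pd η i x * pd u j x := fun x =>
    pd_mul (hηi.differentiable (by simp) x) (hu.differentiable (by simp) x) j
  have i1 : Integrable fun x => pd ψ j x * (pd η i x * u x) :=
    (hψj.mul (hηi.continuous.mul hu.continuous)).integrable_of_hasCompactSupport hψjc.mul_right
  have i2 : Integrable fun x => pd ψ j x * (η x * pd u i x) :=
    (hψj.mul (hη1.continuous.mul hui)).integrable_of_hasCompactSupport hψjc.mul_right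
  have i3 : Integrable fun x => ψ x * (pd η j x * pd u i x) :=
    (hψ1.continuous.mul (hηj.mul hui)).integrable_of_hasCompactSupport hψc.mul_right
  have i4 : Integrable fun x => ψ x * (pd (pd η i) j x * u x + pd η i x * pd u j x) :=
    (hψ1.continuous.mul ((hηij.mul hu.continuous).add
      (hηi.continuous.mul huj))).integrable_of_hasCompactSupport
      hψc.mul_right
  have i5 : Integrable fun x => (ψ x * η x) * D x := by
    obtain ⟨C, hC⟩ := t.2.1.exists_bound_of_continuous t.1.continuous
    exact hD.bdd_mul t.1.continuous.aestronglyMeasurable (Eventually.of_forall hC)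
  simp only [smul_eq_mul] at e1 ⊢
  simp_rw [e1'] at e1
  simp_rw [e2'] at e2
  have e3 : ∫ x, (pd ψ j x * η x + ψ x * pd η j x) * pd u i x =
      (∫ x, pd ψ j x * (η x * pd u i x)) + ∫ x, ψ x * (pd η j x * pd u i x) := by
    rw [← integral_add i2 i3]; congr 1; ext x; ring
  have e4 : ∫ x, ψ x * (pd (pd η i) j x * u x + pd η i x * pd u j x + pd η j x * pd u i x +
      η x * D x) = (∫ x, ψ x * (pd (pd η i) j x * u x + pd η i x * pd u j x)) +
        (∫ x, ψ x * (pd η j x * pd u i x)) + ∫ x, (ψ x * η x) * D x := by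
    have i43 : Integrable fun x => ψ x * (pd (pd η i) j x * u x + pd η i x * pd u j x) +
        ψ x * (pd η j x * pd u i x) := i4.add i3
    rw [← integral_add i4 i3, ← integral_add i43 i5]; congr 1; ext x; ring
  have e5 : ∫ x, pd ψ j x * pd (fun x => η x * u x) i x =
      (∫ x, pd ψ j x * (pd η i x * u x)) + ∫ x, pd ψ j x * (η x * pd u i x) := by
    rw [← integral_add i1 i2]; congr 1; ext x; rw [e0]; ring
  rw [e4, e5]
  linarith

theorem IsLocSol.exists_hessian_integrableOn {p q C : ℝ} {O O' K : Set (Euc n)}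
    {u f φ : Euc n → ℝ} (S : IsLocSol p O u f) (hn : 0 < n) (hp : 1 < p) (hq : 2 ≤ q)
    (hpq : 2 < p → (p - 2) * (q - 1) < 1) (hC : IsCZBound n q C) (hpC : |p - 2| * C < 1)
    (hO' : IsOpen O') (hOO : O' ⊆ O) (hφ : IsC1c O φ) (hφ1 : ∀ x ∈ O', φ x = 1)
    (hK : IsCompact K) (hKO : K ⊆ O') :
    ∃ D : Fin n → Fin n → Euc n → ℝ, (∀ i j, Integrable (D i j)) ∧
      (∀ i j, WPD O' (pd u i) (D i j) j) ∧
      ∀ i j, IntegrableOn (fun x => |D i j x| ^ q) K volume := by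
  obtain ⟨D, hD2, hDi, hD0, hDW, hnpl⟩ := S.exists_hessian_memLp hp hq hpq hO' hOO hφ hφ1
  obtain ⟨η, V, hη, hV, hKV, hVU, hη1⟩ := exists_cutoff hK hO' hKO
  have hu := S.contDiff
  have hη1' : ContDiff ℝ 1 η := hη.1.of_le (by simp)
  have hηc := hη.2.1
  have hs : |p - 2| < 1 := by
    rw [abs_lt]
    refine ⟨by linarith, ?_⟩
    by_contra h
    have h2 := hpq (by linarith)
    nlinarith
  set w : Euc n → ℝ := fun x => η x * u x with hw
  set X : Fin n → Fin n → Euc n → ℝ := fun i j x => pd (pd η i) j x * u x +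
    pd η i x * pd u j x + pd η j x * pd u i x with hX
  set W : Fin n → Fin n → Euc n → ℝ := fun i j x => X i j x + η x * D i j x with hW
  have hXc : ∀ i j, Continuous (X i j) := fun i j =>
    (((contDiff_pd (contDiff_pd hη.1 i) j).continuous.mul hu.continuous).add
      ((continuous_pd hη1' i).mul (continuous_pd hu j))).add
      ((continuous_pd hη1' j).mul (continuous_pd hu i))
  have hX0 : ∀ i j x, x ∉ tsupport η → X i j x = 0 := fun i j x hx => by
    have h1 : ∀ i, pd η i x = 0 := fun i => image_eq_zero_of_notMem_tsupport fun h =>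
      hx (tsupport_pd_subset η i h)
    have h2 : pd (pd η i) j x = 0 := image_eq_zero_of_notMem_tsupport fun h =>
      hx (tsupport_pd_subset η i (tsupport_pd_subset _ j h))
    simp [hX, h1, h2]
  have hXs : ∀ i j, HasCompactSupport (X i j) := fun i j =>
    HasCompactSupport.of_support_subset_isCompact hηc.isCompact fun x hx => by
      by_contra h; exact hx (hX0 i j x h)
  obtain ⟨B, hB⟩ := hηc.exists_bound_of_continuous hη.1.continuous
  have hηL : ∀ {F : Euc n → ℝ} {r : ℝ≥0∞}, MemLp F r volume →
      MemLp (fun x => η x * F x) r volume := fun {F r} hF =>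
    MemLp.of_le_mul (c := B) hF (hη.1.continuous.aestronglyMeasurable.mul hF.1)
      (Eventually.of_forall fun x => by rw [norm_mul]; gcongr; exact hB x)
  have hW2 : ∀ i j, MemLp (W i j) 2 volume := fun i j =>
    ((hXc i j).memLp_of_hasCompactSupport (hXs i j)).add (hηL (hD2 i j))
  have hWi : ∀ i j, Integrable (W i j) := fun i j =>
    ((hXc i j).integrable_of_hasCompactSupport (hXs i j)).add
      ((hDi i j).bdd_mul hη.1.continuous.aestronglyMeasurable (Eventually.of_forall hB))
  have hWW : ∀ i j, WPD univ (pd w i) (W i j) j := fun i j => (hDW i j).cutoff hu hη (hDi i j)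
  have hW0 : ∀ i j x, x ∉ tsupport η → W i j x = 0 := fun i j x hx => by
    simp [hW, hX0 i j x hx, image_eq_zero_of_notMem_tsupport hx]
  set a : Fin n → Euc n → ℝ := fun i x => dir u x i with ha
  have ham : ∀ i, AEStronglyMeasurable (a i) volume := fun i =>
    (measurable_dir hu i).aestronglyMeasurable
  have ha1 : ∀ x, ∑ i, a i x ^ 2 ≤ 1 := fun x => by
    have h := norm_dir_le u x
    have h2 : ‖dir u x‖ ^ 2 ≤ 1 := pow_le_one₀ (norm_nonneg _) h
    rw [EuclideanSpace.norm_sq_eq] at h2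
    simpa [ha] using h2
  have hXv : Continuous (hvec X) := (PiLp.continuous_toLp 2 _).comp
    (continuous_pi fun ij : Fin n × Fin n => hXc ij.1 ij.2)
  have hXvs : HasCompactSupport (hvec X) :=
    HasCompactSupport.of_support_subset_isCompact hηc.isCompact fun x hx => by
      by_contra h
      apply hx
      ext ij
      exact hX0 _ _ x h
  have hG : MemLp (fun x => ∑ i, W i i x + (p - 2) * qform a W x) (ENNReal.ofReal q) volume := by
    have e : (fun x => ∑ i, W i i x + (p - 2) * qform a W x) = fun x =>
        (∑ i, X i i x + (p - 2) * qform a X x) + η x * npl p u D x := by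
      ext x
      simp only [hW, qform, npl, mul_add, Finset.sum_add_distrib, Finset.mul_sum, ha]
      have : ∀ i j, η x * ((p - 2) * (dir u x i * dir u x j * D i j x)) =
        (p - 2) * (dir u x i * dir u x j * (η x * D i j x)) := fun i j => by ring
      simp only [this]
      ring
    rw [e]
    refine (MemLp.add (memLp_finsetSum _ fun i _ =>
      (hXc i i).memLp_of_hasCompactSupport (hXs i i)) (MemLp.const_mul ?_ _)).add (hηL hnpl)
    exact (hXv.memLp_of_hasCompactSupport hXvs).of_le
      (aestronglyMeasurable_qform ham fun i j => (hXc i j).aestronglyMeasurable)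
      (Eventually.of_forall fun x => by rw [Real.norm_eq_abs]; exact abs_qform_le (ha1 x) X)
  have hL := memLp_of_memLp_perturbation hn hq hC hs hpC (hη1'.mul hu) hηc.mul_right hW2 hWi hWW
    hηc.isCompact hW0 ham ha1 hG
  refine ⟨D, hDi, hDW, fun i j => ?_⟩
  have h1 := (hL i j).integrable_norm_rpow (by simp; linarith) (by simp)
  rw [ENNReal.toReal_ofReal (by linarith)] at h1
  refine (h1.integrableOn (s := K)).congr_fun (fun x hx => ?_) hK.measurableSet
  have hXx : X i j x = 0 := by
    have hev : ∀ᶠ y in 𝓝 x, η y = 1 := by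
      filter_upwards [hV.mem_nhds (hKV hx)] with y hy using hη1 y hy
    have hev2 : ∀ i, pd η i =ᶠ[𝓝 x] 0 := fun i => by
      filter_upwards [hev.eventually_nhds] with y hy
      have : η =ᶠ[𝓝 y] fun _ => (1 : ℝ) := hy
      simp [pd, this.fderiv_eq]
    have h3 : pd (pd η i) j x = 0 := by
      rw [pd, (hev2 i).fderiv_eq]; simp [Pi.zero_def]
    simp [hX, h3, (hev2 i).eq_of_nhds, (hev2 j).eq_of_nhds]
  simp only [hW, hXx, hη1 x (hKV hx), zero_add, one_mul, Real.norm_eq_abs]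

lemma pd_mconv {ψ : Euc n → ℝ} (hψ : ContDiff ℝ 1 ψ) (k : ℕ) (i : Fin n) :
    pd (mconv k ψ) i = mconv k (pd ψ i) := by
  ext x
  have hW : WPD univ ψ (pd ψ i) i := fun η hη => by
    have hη1 := hη.isC1c
    have := integral_mul_pd hη1.1 hη1.2.1 hψ i
    simp only [smul_eq_mul]
    linarith
  exact fderiv_mconv_of_wpd k hψ.continuous.locallyIntegrable hW (subset_univ _)

lemma tendsto_integral_mul_mconv {g h : Euc n → ℝ} (hg : Integrable g) (hh : Continuous h)
    (hhc : HasCompactSupport h) :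
    Tendsto (fun k => ∫ x, g x * mconv k h x) atTop (𝓝 (∫ x, g x * h x)) := by
  obtain ⟨B, hB⟩ := hhc.exists_bound_of_continuous hh
  refine tendsto_integral_of_dominated_convergence (fun x => ‖g x‖ * B) (fun k => ?_)
    (hg.norm.mul_const B) (fun k => Eventually.of_forall fun x => ?_)
    (Eventually.of_forall fun x => ?_)
  · exact hg.1.mul (contDiff_mconv k hh.locallyIntegrable).continuous.aestronglyMeasurable
  · rw [norm_mul]
    gcongr
    exact norm_mconv_le k hh.aestronglyMeasurable hB
  · exact ((tendstoUniformly_mconv hh hhc).tendsto_at x).const_mul _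

lemma IsC1c.eventually_isTestFun_mconv {O : Set (Euc n)} (hO : IsOpen O) {ψ : Euc n → ℝ}
    (hψ : IsC1c O ψ) : ∀ᶠ k in atTop, IsTestFun O (mconv k ψ) := by
  obtain ⟨δ, hδ, hδO⟩ := hψ.2.1.isCompact.exists_cthickening_subset_open hO hψ.2.2
  filter_upwards [(tendsto_bumpSeq_rOut n).eventually (gt_mem_nhds hδ)] with k hk
  exact ⟨contDiff_mconv k hψ.1.continuous.locallyIntegrable, hasCompactSupport_mconv k hψ.2.1,
    ((tsupport_mconv_subset k ψ).trans (cthickening_mono (le_of_lt hk) _)).trans hδO⟩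

lemma inner_gradient_eq_sum (z : Euc n) (ψ : Euc n → ℝ) (x : Euc n) :
    ⟪z, gradient ψ x⟫_ℝ = ∑ i, z i * pd ψ i x := by
  simp only [PiLp.inner_apply, gradient_apply]
  simp [mul_comm]

/-- Solutions tested against smooth functions are solutions tested against `C¹` functions. -/
lemma IsLocSol.of_isTestFun {p : ℝ} (hp : 1 < p) {O : Set (Euc n)} {u f : Euc n → ℝ}
    (hO : IsOpen O) (hu : ContDiff ℝ 1 u) (huc : HasCompactSupport u) (hf : Continuous f)
    (hfc : HasCompactSupport f)
    (heq : ∀ ψ, IsTestFun O ψ → ∫ x, ⟪Vf p (gradient u x), gradient ψ x⟫_ℝ = ∫ x, f x * ψ x)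
    (hb : ∀ i : Fin n, ∃ C ≥ 0, ∀ ψ, IsTestFun O ψ → ∀ B, (∀ x, |ψ x| ≤ B) →
      |∫ x, f x * pd ψ i x| ≤ C * B) : IsLocSol p O u f where
  isOpen := hO
  contDiff := hu
  hasCompactSupport := huc
  continuous_rhs := hf
  hasCompactSupport_rhs := hfc
  eqn := by
    intro ψ hψ
    have hVc : Continuous fun x => Vf p (gradient u x) :=
      (continuous_Vf hp).comp (continuous_gradient hu)
    have hVs : HasCompactSupport fun x => Vf p (gradient u x) :=
      (hasCompactSupport_gradient huc).comp_left (g := Vf p) (by simp [Vf])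
    have hVi : ∀ i, Integrable fun x => Vf p (gradient u x) i := fun i =>
      ((PiLp.continuous_apply 2 _ i).comp hVc).integrable_of_hasCompactSupport
        (hVs.comp_left (g := fun z : Euc n => z i) rfl)
    have e : ∀ η : Euc n → ℝ, ContDiff ℝ 1 η → HasCompactSupport η →
        ∫ x, ⟪Vf p (gradient u x), gradient η x⟫_ℝ =
          ∑ i, ∫ x, Vf p (gradient u x) i * pd η i x := fun η hη hηc => by
      simp only [inner_gradient_eq_sum]
      refine integral_finsetSum _ fun i _ => ?_
      exact (((PiLp.continuous_apply 2 _ i).comp hVc).mul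
        (continuous_pd hη i)).integrable_of_hasCompactSupport
        (hasCompactSupport_pd hηc i).mul_left
    have h1 := tendsto_integral_mul_mconv (hf.integrable_of_hasCompactSupport hfc)
      hψ.1.continuous hψ.2.1
    have h2 : Tendsto (fun k => ∑ i, ∫ x, Vf p (gradient u x) i * mconv k (pd ψ i) x) atTop
        (𝓝 (∑ i, ∫ x, Vf p (gradient u x) i * pd ψ i x)) := tendsto_finsetSum _ fun i _ =>
      tendsto_integral_mul_mconv (hVi i) (continuous_pd hψ.1 i) (hasCompactSupport_pd hψ.2.1 i)
    rw [e ψ hψ.1 hψ.2.1]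
    refine tendsto_nhds_unique h2 (h1.congr' ?_)
    filter_upwards [hψ.eventually_isTestFun_mconv hO] with k hk
    rw [← heq _ hk, e _ hk.isC1c.1 hk.2.1]
    simp only [pd_mconv hψ.1]
  rhs_bound := by
    intro i
    obtain ⟨C, hC, h⟩ := hb i
    refine ⟨C, hC, fun ψ hψ B hB => ?_⟩
    have h1 := tendsto_integral_mul_mconv (hf.integrable_of_hasCompactSupport hfc)
      (continuous_pd hψ.1 i) (hasCompactSupport_pd hψ.2.1 i)
    refine le_of_tendsto h1.abs ?_
    filter_upwards [hψ.eventually_isTestFun_mconv hO] with k hk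
    rw [← pd_mconv hψ.1]
    exact h _ hk B fun x => norm_mconv_le k hψ.1.continuous.aestronglyMeasurable hB

lemma C1Loc.contDiffAt {Ω : Set (Euc n)} {β : ℝ≥0} {u : Euc n → ℝ} (hu : C1Loc Ω β u)
    (hΩ : IsOpen Ω) (hβ : 0 < β) {x : Euc n} (hx : x ∈ Ω) : ContDiffAt ℝ 1 u x := by
  have h1 : ∀ y ∈ Ω, ContinuousAt (gradient u) y := fun y hy => by
    obtain ⟨K, hK, hyK, hKΩ⟩ := exists_compact_subset hΩ hy
    obtain ⟨C, hC⟩ := hu.2 K hKΩ hK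
    exact (hC.continuousOn hβ).continuousAt (mem_interior_iff_mem_nhds.1 hyK)
  have h2 : ContDiffOn ℝ 1 u Ω := by
    rw [show (1 : WithTop ℕ∞) = 0 + 1 by simp, contDiffOn_succ_iff_fderiv_of_isOpen hΩ,
      contDiffOn_zero]
    refine ⟨fun y hy => (hu.1 y hy).differentiableWithinAt, by simp, fun y hy => ?_⟩
    have h3 := (InnerProductSpace.toDual ℝ (Euc n)).continuous.continuousAt.comp (h1 y hy)
    refine ContinuousAt.continuousWithinAt (h3.congr (Eventually.of_forall fun z => ?_))
    simp [gradient_eq_toDual_symm]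
  exact h2.contDiffAt (hΩ.mem_nhds hx)

lemma integral_mul_eq_setIntegral {Ω : Set (Euc n)} {a b : Euc n → ℝ}
    (h : tsupport b ⊆ Ω) : ∫ x, a x * b x = ∫ x in Ω, a x * b x := by
  refine (setIntegral_eq_integral_of_forall_compl_eq_zero fun x hx => ?_).symm
  rw [image_eq_zero_of_notMem_tsupport fun h' => hx (h h'), mul_zero]

/-- Localization of a weak solution near a compact set. -/
lemma exists_isLocSol {Ω : Set (Euc n)} (hΩ : IsOpen Ω) {p : ℝ} {β β' : ℝ≥0} (hβ : 0 < β)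
    {u f : Euc n → ℝ} (hu : C1Loc Ω β u) (hsol : IsPWeakSol p Ω u f) (hf1 : MemW1Loc Ω 1 f)
    (hf2 : C0Loc Ω β' f) (hp : 1 < p) {K : Set (Euc n)} (hK : IsCompact K) (hKΩ : K ⊆ Ω) :
    ∃ (O O' : Set (Euc n)) (u₀ f₀ φ : Euc n → ℝ), IsLocSol p O u₀ f₀ ∧ IsOpen O' ∧ K ⊆ O' ∧
      O' ⊆ O ∧ O ⊆ Ω ∧ IsC1c O φ ∧ (∀ x ∈ O', φ x = 1) ∧ ∀ x ∈ O, u₀ x = u x := by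
  obtain ⟨L, hL, hKL, hLΩ⟩ := exists_compact_between hK hΩ hKΩ
  obtain ⟨χ, V, hχ, hV, hLV, hVΩ, hχ1⟩ := exists_cutoff hL hΩ hLΩ
  obtain ⟨φ, O', hφ, hO', hKO', hO'O, hφ1⟩ := exists_cutoff hK isOpen_interior hKL
  have hOL : interior L ⊆ L := interior_subset
  obtain ⟨d, hd, hdi⟩ := hf1
  have hu1 : ContDiff ℝ 1 fun x => χ x * u x := contDiff_iff_contDiffAt.2 fun x => by
    by_cases hx : x ∈ tsupport χ
    · exact hχ.isC1c.1.contDiffAt.mul (hu.contDiffAt hΩ hβ (hχ.2.2 hx))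
    · refine contDiffAt_const (c := (0 : ℝ)).congr_of_eventuallyEq ?_
      filter_upwards [(isClosed_tsupport χ).isOpen_compl.mem_nhds hx] with y hy
      rw [image_eq_zero_of_notMem_tsupport hy, zero_mul]
  have hf0 : Continuous fun x => χ x * f x := continuous_of_tsupport fun x hx =>
    hχ.1.continuous.continuousAt.mul (hf2.1.continuousAt
      (hΩ.mem_nhds (hχ.2.2 (tsupport_mul_subset_left hx))))
  refine ⟨interior L, O', fun x => χ x * u x, fun x => χ x * f x, φ,
    IsLocSol.of_isTestFun hp isOpen_interior hu1 hχ.2.1.mul_right hf0 hχ.2.1.mul_right ?_ ?_,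
    hO', hKO', hO'O, hOL.trans hLΩ, hφ.isC1c, hφ1, fun x hx => ?_⟩
  · intro ψ hψ
    have hψΩ : IsTestFun Ω ψ := ⟨hψ.1, hψ.2.1, (hψ.2.2.trans hOL).trans hLΩ⟩
    have h := hsol ψ hψΩ
    rw [← integral_mul_eq_setIntegral hψΩ.2.2] at h
    have e1 : ∫ x, χ x * f x * ψ x = ∫ x, f x * ψ x := by
      congr 1; ext x
      by_cases hx : x ∈ tsupport ψ
      · rw [hχ1 x (hLV (hOL (hψ.2.2 hx))), one_mul]
      · simp [image_eq_zero_of_notMem_tsupport hx]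
    rw [e1, ← h, ← setIntegral_eq_integral_of_forall_compl_eq_zero (s := Ω)]
    · refine setIntegral_congr_fun hΩ.measurableSet fun x _ => ?_
      by_cases hx : x ∈ tsupport ψ
      · have : (fun x => χ x * u x) =ᶠ[𝓝 x] u := by
          filter_upwards [hV.mem_nhds (hLV (hOL (hψ.2.2 hx)))] with y hy
          rw [hχ1 y hy, one_mul]
        have hg : gradient (fun x => χ x * u x) x = gradient u x := by
          rw [gradient_eq_toDual_symm, this.fderiv_eq, ← gradient_eq_toDual_symm]
        simp only [hg, Vf, real_inner_smul_left]
      · have : gradient ψ x = 0 := image_eq_zero_of_notMem_tsupport fun h =>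
          hx (tsupport_gradient_subset ψ h)
        simp [this]
    · intro x hx
      have : gradient ψ x = 0 := image_eq_zero_of_notMem_tsupport fun h =>
          hx (hψΩ.2.2 (tsupport_gradient_subset ψ h))
      simp [this]
  · intro i
    have hdL := (hdi L hLΩ hL).2 i
    simp only [Real.rpow_one] at hdL
    refine ⟨∫ x in L, |d i x|, integral_nonneg fun x => abs_nonneg _, fun ψ hψ B hB => ?_⟩
    have hψΩ : IsTestFun Ω ψ := ⟨hψ.1, hψ.2.1, (hψ.2.2.trans hOL).trans hLΩ⟩
    have h := hd i ψ hψΩ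
    rw [← integral_mul_eq_setIntegral hψΩ.2.2,
      ← integral_mul_eq_setIntegral ((tsupport_pd_subset ψ i).trans hψΩ.2.2)] at h
    have e1 : ∫ x, χ x * f x * pd ψ i x = ∫ x, f x * pd ψ i x := by
      congr 1; ext x
      by_cases hx : x ∈ tsupport ψ
      · rw [hχ1 x (hLV (hOL (hψ.2.2 hx))), one_mul]
      · simp [image_eq_zero_of_notMem_tsupport fun h => hx (tsupport_pd_subset ψ i h)]
    rw [e1, h, abs_neg, integral_mul_eq_setIntegral (hψ.2.2.trans hOL), ← integral_mul_const]
    rw [← Real.norm_eq_abs]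
    refine (norm_integral_le_integral_norm _).trans ?_
    have hm : ∀ x, ‖d i x * ψ x‖ ≤ |d i x| * B := fun x => by
      rw [norm_mul]; exact mul_le_mul_of_nonneg_left (hB x) (abs_nonneg _)
    exact integral_mono_of_nonneg (Eventually.of_forall fun x => norm_nonneg _)
      (hdL.mul_const B) (Eventually.of_forall hm)
  · simp [hχ1 x (hLV (hOL hx))]

lemma WPD.ae_eq {V : Set (Euc n)} (hV : IsOpen V) {g D₁ D₂ : Euc n → ℝ} {j : Fin n}
    (h1 : Integrable D₁) (h2 : Integrable D₂) (hW1 : WPD V g D₁ j) (hW2 : WPD V g D₂ j) :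
    ∀ᵐ x, x ∈ V → D₁ x = D₂ x := by
  have h := hV.ae_eq_zero_of_integral_contDiff_smul_eq_zero (μ := volume) (f := fun x => D₁ x - D₂ x)
    ((h1.sub h2).locallyIntegrable.locallyIntegrableOn V) fun ψ hψ hψc hψV => by
      obtain ⟨C, hC⟩ := hψc.exists_bound_of_continuous hψ.continuous
      have i1 : Integrable fun x => ψ x • D₁ x :=
        h1.bdd_mul hψ.continuous.aestronglyMeasurable (Eventually.of_forall hC)
      have i2 : Integrable fun x => ψ x • D₂ x :=
        h2.bdd_mul hψ.continuous.aestronglyMeasurable (Eventually.of_forall hC)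
      simp only [smul_sub]
      rw [integral_sub i1 i2]
      have e1 := hW1 ψ ⟨hψ, hψc, hψV⟩
      have e2 := hW2 ψ ⟨hψ, hψc, hψV⟩
      linarith
  filter_upwards [h] with x hx hxV
  exact sub_eq_zero.1 (hx hxV)

lemma WPD.mono {V V' : Set (Euc n)} (hV : V ⊆ V') {g D : Euc n → ℝ} {j : Fin n}
    (h : WPD V' g D j) : WPD V g D j := fun ψ hψ => h ψ ⟨hψ.1, hψ.2.1, hψ.2.2.trans hV⟩

lemma WPD.congr_left {V : Set (Euc n)} {g g' D : Euc n → ℝ} {j : Fin n}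
    (h : WPD V g D j) (hg : ∀ x ∈ V, g x = g' x) : WPD V g' D j := fun ψ hψ => by
  rw [← h ψ hψ]
  congr 1; ext x
  by_cases hx : x ∈ tsupport ψ
  · rw [hg x (hψ.2.2 hx)]
  · simp [image_eq_zero_of_notMem_tsupport fun h => hx (tsupport_pd_subset ψ j h)]

/-- Exhaustion of an open set by open subsets with compact neighbourhoods. -/
lemma exists_open_exhaustion {Ω : Set (Euc n)} (hΩ : IsOpen Ω) :
    ∃ V K : ℕ → Set (Euc n), (∀ m, IsOpen (V m)) ∧ Monotone V ∧ (∀ m, IsCompact (K m)) ∧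
      (∀ m, V m ⊆ K m) ∧ (∀ m, K m ⊆ Ω) ∧ ∀ x ∈ Ω, ∃ m, x ∈ V m := by
  have : LocallyCompactSpace Ω := hΩ.locallyCompactSpace
  let E : CompactExhaustion Ω := default
  refine ⟨fun m => Subtype.val '' interior (E m), fun m => Subtype.val '' (E m),
    fun m => hΩ.isOpenMap_subtype_val _ isOpen_interior,
    fun a b h => image_mono (interior_mono (E.subset h)),
    fun m => (E.isCompact m).image continuous_subtype_val,
    fun m => image_mono interior_subset, fun m => Subtype.coe_image_subset _ _, fun x hx => ?_⟩
  obtain ⟨m, hm⟩ := E.exists_mem ⟨x, hx⟩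
  exact ⟨m + 1, ⟨x, hx⟩, E.subset_interior_succ m hm, rfl⟩

lemma exists_subset_of_exhaustion {Ω L : Set (Euc n)} {V : ℕ → Set (Euc n)}
    (hV : ∀ m, IsOpen (V m)) (hmono : Monotone V) (hΩV : ∀ x ∈ Ω, ∃ m, x ∈ V m)
    (hL : IsCompact L) (hLΩ : L ⊆ Ω) : ∃ m, L ⊆ V m :=
  hL.elim_directed_cover V hV (fun x hx => mem_iUnion.2 (hΩV x (hLΩ hx)))
    (hmono.directed_le)

/-- Weak derivatives existing locally can be glued together. -/
lemma exists_hasWeakPD_of_local {Ω : Set (Euc n)} (hΩ : IsOpen Ω) {g : Euc n → ℝ} {j : Fin n}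
    {q : ℝ} (h : ∀ K, IsCompact K → K ⊆ Ω → ∃ (V : Set (Euc n)) (D : Euc n → ℝ), K ⊆ V ∧
      Integrable D ∧ WPD V g D j ∧ IntegrableOn (fun x => |D x| ^ q) K volume) :
    ∃ d, HasWeakPD Ω g d j ∧
      ∀ K, K ⊆ Ω → IsCompact K → IntegrableOn (fun x => |d x| ^ q) K volume := by
  classical
  obtain ⟨V, K, hV, hmono, hK, hVK, hKΩ, hΩV⟩ := exists_open_exhaustion hΩ
  choose U D hKU hDi hDW hDq using fun m => h (K m) (hK m) (hKΩ m)
  have hW : ∀ m, WPD (V m) g (D m) j := fun m => (hDW m).mono ((hVK m).trans (hKU m))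
  set d : Euc n → ℝ := fun x => if hx : ∃ m, x ∈ V m then D (Nat.find hx) x else 0 with hd
  have hae : ∀ m, ∀ᵐ x, x ∈ V m → d x = D m x := fun m => by
    have h1 : ∀ᵐ x, ∀ k, k ≤ m → x ∈ V k → D k x = D m x := by
      rw [ae_all_iff]
      intro k
      by_cases hk : k ≤ m
      · filter_upwards [WPD.ae_eq (hV k) (hDi k) (hDi m) (hW k) ((hW m).mono (hmono hk))]
          with x hx _ using hx
      · exact Eventually.of_forall fun x hk' => absurd hk' hk
    filter_upwards [h1] with x hx hxm
    have hex : ∃ m, x ∈ V m := ⟨m, hxm⟩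
    rw [hd]
    simp only [dif_pos hex]
    exact hx _ (Nat.find_min' hex hxm) (Nat.find_spec hex)
  refine ⟨d, fun ψ hψ => ?_, fun L hLΩ hL => ?_⟩
  · obtain ⟨m, hm⟩ := exists_subset_of_exhaustion hV hmono hΩV hψ.2.1.isCompact hψ.2.2
    rw [← integral_mul_eq_setIntegral hψ.2.2,
      ← integral_mul_eq_setIntegral ((tsupport_pd_subset ψ j).trans hψ.2.2)]
    have e := hW m ψ ⟨hψ.1, hψ.2.1, hm⟩
    simp only [smul_eq_mul] at e
    have e2 : ∫ x, d x * ψ x = ∫ x, ψ x * D m x := by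
      refine integral_congr_ae ?_
      filter_upwards [hae m] with x hx
      by_cases hxt : x ∈ tsupport ψ
      · rw [hx (hm hxt), mul_comm]
      · simp [image_eq_zero_of_notMem_tsupport hxt]
    rw [e2, ← e]
    congr 1; ext x; ring
  · obtain ⟨m, hm⟩ := exists_subset_of_exhaustion hV hmono hΩV hL hLΩ
    refine ((hDq m).mono_set (hm.trans (hVK m))).congr ?_
    filter_upwards [ae_restrict_of_ae (hae m), ae_restrict_mem hL.measurableSet] with x hx hxL
    rw [hx (hm hxL)]

lemma pd_congr_of_eqOn {O : Set (Euc n)} (hO : IsOpen O) {a b : Euc n → ℝ}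
    (h : ∀ x ∈ O, a x = b x) (i : Fin n) {x : Euc n} (hx : x ∈ O) : pd a i x = pd b i x := by
  have : a =ᶠ[𝓝 x] b := by filter_upwards [hO.mem_nhds hx] with y hy using h y hy
  rw [pd, pd, this.fderiv_eq]

lemma C1Loc.hasWeakPD {Ω : Set (Euc n)} {β : ℝ≥0} {u : Euc n → ℝ} (hu : C1Loc Ω β u)
    (hΩ : IsOpen Ω) (hβ : 0 < β) (i : Fin n) : HasWeakPD Ω u (pd u i) i := by
  intro ψ hψ
  obtain ⟨χ, V, hχ, hV, hψV, hVΩ, hχ1⟩ := exists_cutoff hψ.2.1.isCompact hΩ hψ.2.2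
  have hu1 : ContDiff ℝ 1 fun x => χ x * u x := contDiff_iff_contDiffAt.2 fun x => by
    by_cases hx : x ∈ tsupport χ
    · exact hχ.isC1c.1.contDiffAt.mul (hu.contDiffAt hΩ hβ (hχ.2.2 hx))
    · refine contDiffAt_const (c := (0 : ℝ)).congr_of_eventuallyEq ?_
      filter_upwards [(isClosed_tsupport χ).isOpen_compl.mem_nhds hx] with y hy
      rw [image_eq_zero_of_notMem_tsupport hy, zero_mul]
  rw [← integral_mul_eq_setIntegral hψ.2.2,
    ← integral_mul_eq_setIntegral ((tsupport_pd_subset ψ i).trans hψ.2.2)]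
  have e := integral_mul_pd hψ.isC1c.1 hψ.2.1 hu1 i
  have e1 : ∫ x, ψ x * pd (fun x => χ x * u x) i x = ∫ x, pd u i x * ψ x := by
    congr 1; ext x
    by_cases hx : x ∈ tsupport ψ
    · rw [pd_congr_of_eqOn hV (b := u) (fun y hy => by rw [hχ1 y hy, one_mul]) i (hψV hx), mul_comm]
    · simp [image_eq_zero_of_notMem_tsupport hx]
  have e2 : ∫ x, pd ψ i x * (χ x * u x) = ∫ x, u x * pd ψ i x := by
    congr 1; ext x
    by_cases hx : x ∈ tsupport ψ
    · rw [hχ1 x (hψV hx), one_mul, mul_comm]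
    · simp [image_eq_zero_of_notMem_tsupport fun h => hx (tsupport_pd_subset ψ i h)]
  linarith

lemma integrableOn_abs_rpow {K : Set (Euc n)} (hK : IsCompact K) {g : Euc n → ℝ} {q : ℝ}
    (hq : 0 ≤ q) (hg : ContinuousOn g K) : IntegrableOn (fun x => |g x| ^ q) K volume :=
  (hg.abs.rpow_const fun _ _ => Or.inr hq).integrableOn_compact hK

/-- `W^{2,q}_loc` regularity for exponents close to `2`, in terms of a Calderón–Zygmund bound. -/
theorem memW2Loc_of_isCZBound (hn : 0 < n) {Ω : Set (Euc n)} (hΩ : IsOpen Ω) {p q C : ℝ}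
    {β β' : ℝ≥0} (hβ : 0 < β) {u f : Euc n → ℝ} (hu : C1Loc Ω β u) (hsol : IsPWeakSol p Ω u f)
    (hf1 : MemW1Loc Ω 1 f) (hf2 : C0Loc Ω β' f) (hp : 1 < p) (hq : 2 ≤ q)
    (hpq : 2 < p → (p - 2) * (q - 1) < 1) (hC : IsCZBound n q C) (hpC : |p - 2| * C < 1) :
    MemW2Loc Ω q u := by
  have hloc : ∀ i j, ∃ d, HasWeakPD Ω (pd u i) d j ∧
      ∀ K, K ⊆ Ω → IsCompact K → IntegrableOn (fun x => |d x| ^ q) K volume := fun i j =>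
    exists_hasWeakPD_of_local hΩ fun K hK hKΩ => by
      obtain ⟨O, O', u₀, f₀, φ, S, hO', hKO', hOO, hOΩ, hφ, hφ1, hu₀⟩ :=
        exists_isLocSol hΩ hβ hu hsol hf1 hf2 hp hK hKΩ
      obtain ⟨D, hDi, hDW, hDq⟩ :=
        S.exists_hessian_integrableOn hn hp hq hpq hC hpC hO' hOO hφ hφ1 hK hKO'
      exact ⟨O', D i j, hKO', hDi i j, (hDW i j).congr_left fun x hx =>
        pd_congr_of_eqOn S.isOpen hu₀ i (hOO hx), hDq i j⟩
  choose d2 hd2 hd2q using hloc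
  refine ⟨pd u, d2, hu.hasWeakPD hΩ hβ, hd2, fun K hKΩ hK => ⟨?_, fun i => ?_,
    fun i j => hd2q i j K hKΩ hK⟩⟩
  · exact integrableOn_abs_rpow hK (by linarith) fun x hx =>
      (hu.1 x (hKΩ hx)).continuousAt.continuousWithinAt
  · refine integrableOn_abs_rpow hK (by linarith) fun x hx => ?_
    have h := ((hu.contDiffAt hΩ hβ (hKΩ hx)).fderiv_right (m := 0) (by simp)).continuousAt
    exact (h.clm_apply continuousAt_const).continuousWithinAt

lemma exists_isCZBound {q s : ℝ} (hs : |s| < 1 / CZ n q) : ∃ C, IsCZBound n q C ∧ |s| * C < 1 := by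
  have h0 : 0 < CZ n q := one_div_pos.1 ((abs_nonneg s).trans_lt hs)
  have hne : {C : ℝ | IsCZBound n q C}.Nonempty := by
    by_contra h
    have h1 : CZ n q = sInf {C : ℝ | IsCZBound n q C} := rfl
    rw [not_nonempty_iff_eq_empty.1 h, Real.sInf_empty] at h1
    exact h0.ne' h1
  rcases (abs_nonneg s).eq_or_lt with h | h
  · obtain ⟨C, hC⟩ := hne
    exact ⟨C, hC, by rw [← h]; simp⟩
  · have h1 : sInf {C : ℝ | IsCZBound n q C} < 1 / |s| := by
      rw [lt_div_iff₀ h, mul_comm]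
      exact (lt_div_iff₀ h0).1 hs
    obtain ⟨C, hC, hlt⟩ := exists_lt_of_csInf_lt hne h1
    refine ⟨C, hC, ?_⟩
    rwa [lt_div_iff₀ h, mul_comm] at hlt

end

/-- Theorem `teoremacalderon`: `W^{2,q}_loc` regularity of weak solutions
for `p` close to `2` in terms of the Calderón–Zygmund constant. -/
theorem calderon_zygmund_W2q
    {n : ℕ} (hn : 2 ≤ n) (Ω : Set (Euc n)) (hΩo : IsOpen Ω) (hΩc : IsConnected Ω)
    (p q : ℝ) (β β' : ℝ≥0) (hβ : 0 < β) (hβ1 : β < 1) (hβ' : 0 < β') (hβ'1 : β' < 1)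
    (u f : Euc n → ℝ) (hu : C1Loc Ω β u) (hsol : IsPWeakSol p Ω u f)
    (hf1 : MemW1Loc Ω 1 f) (hf2 : C0Loc Ω β' f)
    (hq : 2 ≤ q) (hp1 : 1 < p) (hp2 : |p - 2| < 1 / CZ n q) :
    (p ≤ 2 → MemW2Loc Ω q u) ∧
    (2 < p → q < (p - 1) / (p - 2) → MemW2Loc Ω q u) := by
  obtain ⟨C, hC, hpC⟩ := exists_isCZBound hp2
  have key : (2 < p → (p - 2) * (q - 1) < 1) → MemW2Loc Ω q u := fun hpq =>
    memW2Loc_of_isCZBound (by omega) hΩo hβ hu hsol hf1 hf2 hp1 hq hpq hC hpC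
  refine ⟨fun h => key fun h' => absurd h' (not_lt.2 h), fun h hqp => key fun _ => ?_⟩
  rw [lt_div_iff₀ (by linarith)] at hqp
  nlinarith

end
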